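/- Let I ≠ {0} be a closed ideal of A⁺ such that h(I) is finite or countable. Then I = I⁺(h(I) ∩ Γ) ∩ S_I·H^∞, i.e., I consists exactly of the elements of A⁺ vanishing on h(I) ∩ Γ whose inner factor is divisible by S_I. -/

import Mathlib

noncomputable section

/-- An invertible contraction on a (complex) Banach space. -/
structure BanachContraction where
  X : Type
  [grp : NormedAddCommGroup X]
  [mod : NormedSpace ℂ X]
  [cpl : CompleteSpace X]
  T : X →L[ℂ] X
  Tinv : X →L[ℂ] X
  norm_le : ‖T‖ ≤ 1
  mul_inv : T * Tinv = 1
  inv_mul : Tinv * T = 1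

attribute [instance] BanachContraction.grp BanachContraction.mod BanachContraction.cpl

open Complex MeasureTheory Metric Set Filter

/-- The `n`-th Taylor coefficient of `f` at `0`, i.e. `f⁽ⁿ⁾(0)/n!`. -/
def taylorCoeff (f : ℂ → ℂ) (n : ℕ) : ℂ := iteratedDeriv n f 0 / (n.factorial : ℂ)

/-- `A⁺`, the algebra of absolutely convergent Taylor series: functions which, on the
closed unit disk, are sums of a power series with absolutely summable coefficients. -/
def APlus : Set (ℂ → ℂ) :=
  {f | ∃ a : ℕ → ℂ, Summable (fun n => ‖a n‖) ∧
    ∀ z ∈ Metric.closedBall (0 : ℂ) 1, HasSum (fun n => a n * z ^ n) (f z)}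

/-- The norm `‖f‖₁ = ∑ₙ |f⁽ⁿ⁾(0)/n!|` on `A⁺`. -/
def APlusNorm (f : ℂ → ℂ) : ℝ := ∑' n : ℕ, ‖taylorCoeff f n‖

/-- The `n`-th Fourier coefficient of (the boundary values of) `f` on the unit circle. -/
def fcoeff (f : ℂ → ℂ) (n : ℤ) : ℂ :=
  (1 / (2 * Real.pi)) * ∫ θ in (0:ℝ)..(2 * Real.pi),
    f (Complex.exp ((θ : ℂ) * Complex.I)) * Complex.exp (-(n : ℂ) * (θ : ℂ) * Complex.I)

/-- The Wiener algebra `A(Γ)` of absolutely convergent Fourier series on the unit circle,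
viewed as functions `ℂ → ℂ` (only the values on the unit circle are relevant). -/
def WienerAlg : Set (ℂ → ℂ) :=
  {f | Summable (fun n : ℤ => ‖fcoeff f n‖) ∧
    ∀ z ∈ Metric.sphere (0 : ℂ) 1, HasSum (fun n : ℤ => fcoeff f n * z ^ n) (f z)}

/-- The norm `‖f‖₁ = ∑_{n ∈ ℤ} |f̂(n)|` on `A(Γ)`. -/
def WienerNorm (f : ℂ → ℂ) : ℝ := ∑' n : ℤ, ‖fcoeff f n‖

/-- `I` is a closed ideal of `A⁺` (closedness w.r.t. the norm `APlusNorm`). -/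
def IsClosedIdealAPlus (I : Set (ℂ → ℂ)) : Prop :=
  I ⊆ APlus ∧
  (∀ f ∈ I, ∀ g ∈ I, f + g ∈ I) ∧
  (∀ f ∈ APlus, ∀ g ∈ I, f * g ∈ I) ∧
  (∀ f ∈ APlus, (∀ ε > 0, ∃ g ∈ I, APlusNorm (f - g) < ε) → f ∈ I)

/-- `J` is a closed ideal of the Wiener algebra `A(Γ)`. -/
def IsClosedIdealW (J : Set (ℂ → ℂ)) : Prop :=
  J ⊆ WienerAlg ∧
  (∀ f ∈ J, ∀ g ∈ J, f + g ∈ J) ∧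
  (∀ f ∈ WienerAlg, ∀ g ∈ J, f * g ∈ J) ∧
  (∀ f ∈ WienerAlg, (∀ ε > 0, ∃ g ∈ J, WienerNorm (f - g) < ε) → f ∈ J)

/-- `I^A` : the closed ideal generated by `I` in the Wiener algebra `A(Γ)`. -/
def IdealGenW (I : Set (ℂ → ℂ)) : Set (ℂ → ℂ) := ⋂₀ {J | IsClosedIdealW J ∧ I ⊆ J}

/-- The hull `h(I)`: common zeros in the closed unit disk of all elements of `I`. -/
def hull (I : Set (ℂ → ℂ)) : Set ℂ :=
  {z ∈ Metric.closedBall (0 : ℂ) 1 | ∀ f ∈ I, f z = 0}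

/-- `I ≠ {0}`: `I` contains an element not identically zero on the unit disk. -/
def NontrivialIdeal (I : Set (ℂ → ℂ)) : Prop :=
  ∃ f ∈ I, ∃ z ∈ Metric.ball (0 : ℂ) 1, f z ≠ 0

/-- `H^∞(D)`: bounded holomorphic functions on the open unit disk. -/
def Hinf : Set (ℂ → ℂ) :=
  {f | DifferentiableOn ℂ f (Metric.ball (0 : ℂ) 1) ∧
    ∃ C : ℝ, ∀ z ∈ Metric.ball (0 : ℂ) 1, ‖f z‖ ≤ C}

/-- An inner function: a bounded-by-one holomorphic function on the unit disk whose
radial limits have modulus `1` at almost every boundary point. -/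
def IsInnerFunction (u : ℂ → ℂ) : Prop :=
  DifferentiableOn ℂ u (Metric.ball (0 : ℂ) 1) ∧
  (∀ z ∈ Metric.ball (0 : ℂ) 1, ‖u z‖ ≤ 1) ∧
  ∀ᵐ (θ : ℝ) ∂(MeasureTheory.volume.restrict (Set.Ioc (0 : ℝ) (2 * Real.pi))),
    Filter.Tendsto (fun r : ℝ => ‖u ((r : ℂ) * Complex.exp ((θ : ℂ) * Complex.I))‖)
      (nhdsWithin 1 (Set.Iio 1)) (nhds 1)

/-- `S` divides (the inner factor of) `f`, i.e. `f ∈ S·H^∞`. -/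
def InnerDivides (S f : ℂ → ℂ) : Prop :=
  ∃ g ∈ Hinf, ∀ z ∈ Metric.ball (0 : ℂ) 1, f z = S z * g z

/-- `S` is a greatest common divisor of the inner factors of the nonzero elements of `I`:
`S` is inner, divides every nonzero element of `I`, and every inner function with this
property divides `S`. -/
def IsGcdInner (I : Set (ℂ → ℂ)) (S : ℂ → ℂ) : Prop :=
  IsInnerFunction S ∧
  (∀ f ∈ I, (∃ z ∈ Metric.ball (0 : ℂ) 1, f z ≠ 0) → InnerDivides S f) ∧
  ∀ S' : ℂ → ℂ, IsInnerFunction S' →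
    (∀ f ∈ I, (∃ z ∈ Metric.ball (0 : ℂ) 1, f z ≠ 0) → InnerDivides S' f) →
    InnerDivides S' S

/-- The perfect symmetric set `E_ξ` of constant ratio `ξ` on the unit circle. -/
def Eset (ξ : ℝ) : Set ℂ :=
  {z | ∃ ε : ℕ → ℕ, (∀ k, ε k ≤ 1) ∧
    z = Complex.exp (2 * Real.pi * Complex.I *
      (((1 - ξ) * ∑' k : ℕ, (ε k : ℝ) * ξ ^ k : ℝ) : ℂ))}

/-- A Carleson set: a closed subset of the unit circle with
`∫_{-π}^{π} log (2 / dist(e^{iθ}, E)) dθ < ∞`. -/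
def IsCarleson (E : Set ℂ) : Prop :=
  IsClosed E ∧ E ⊆ Metric.sphere (0 : ℂ) 1 ∧
  MeasureTheory.IntegrableOn
    (fun θ : ℝ => Real.log (2 / Metric.infDist (Complex.exp ((θ : ℂ) * Complex.I)) E))
    (Set.Ioc (-Real.pi) Real.pi)

/-- The division ideal `I(f) = {g ∈ A⁺ : fg ∈ I}`. -/
def Idiv (I : Set (ℂ → ℂ)) (f : ℂ → ℂ) : Set (ℂ → ℂ) := {g ∈ APlus | f * g ∈ I}

/-- `f` belongs to `A^∞(D)` and vanishes on `E` together with all its derivatives: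
`f` is holomorphic on the disk, and each derivative extends continuously to the closed
disk with the extension vanishing on `E`. -/
def VanishAllDeriv (E : Set ℂ) (f : ℂ → ℂ) : Prop :=
  ContinuousOn f (Metric.closedBall (0 : ℂ) 1) ∧
  DifferentiableOn ℂ f (Metric.ball (0 : ℂ) 1) ∧
  (∀ z ∈ E, f z = 0) ∧
  ∀ n : ℕ, ∃ g : ℂ → ℂ, ContinuousOn g (Metric.closedBall (0 : ℂ) 1) ∧
    Set.EqOn g (iteratedDeriv n f) (Metric.ball (0 : ℂ) 1) ∧ ∀ z ∈ E, g z = 0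

/-- `J₀⁺(E)`: the closure in `A⁺` of the set of elements of `A^∞(D)` vanishing on `E`
together with all their derivatives. -/
def J0Plus (E : Set ℂ) : Set (ℂ → ℂ) :=
  {f | f ∈ APlus ∧ ∀ ε > 0, ∃ g ∈ APlus, VanishAllDeriv E g ∧ APlusNorm (f - g) < ε}

/-- `I⁺(E) = {f ∈ A⁺ : f ≡ 0 on E}`. -/
def IPlus (E : Set ℂ) : Set (ℂ → ℂ) := {f ∈ APlus | ∀ z ∈ E, f z = 0}

/-- The pairing of `f ∈ A⁺ ≅ ℓ¹(ℕ)` with an element `c ∈ c₀`. -/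
def pairing (f : ℂ → ℂ) (c : ℕ → ℂ) : ℂ := ∑' n : ℕ, taylorCoeff f n * c n

/-- `S` is dense in `A⁺` for the weak-star topology `σ(ℓ¹, c₀)`. -/
def WStarDense (S : Set (ℂ → ℂ)) : Prop :=
  ∀ f ∈ APlus, ∀ (m : ℕ) (c : Fin m → ℕ → ℂ),
    (∀ i, Filter.Tendsto (c i) Filter.atTop (nhds 0)) →
    ∀ ε > 0, ∃ g ∈ S, ∀ i, ‖pairing f (c i) - pairing g (c i)‖ < ε

/-- `S` is closed in `A⁺` for the weak-star topology `σ(ℓ¹, c₀)`. -/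
def WStarClosed (S : Set (ℂ → ℂ)) : Prop :=
  S ⊆ APlus ∧
  ∀ f ∈ APlus,
    (∀ (m : ℕ) (c : Fin m → ℕ → ℂ),
      (∀ i, Filter.Tendsto (c i) Filter.atTop (nhds 0)) →
      ∀ ε > 0, ∃ g ∈ S, ∀ i, ‖pairing f (c i) - pairing g (c i)‖ < ε) → f ∈ S

/-- A Kronecker set: a compact subset of the unit circle on which every continuous
unimodular function is a uniform limit of characters `z ↦ zⁿ`, `n ∈ ℤ`. -/
def IsKronecker (K : Set ℂ) : Prop :=
  IsCompact K ∧ K ⊆ Metric.sphere (0 : ℂ) 1 ∧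
  ∀ f : ℂ → ℂ, ContinuousOn f K → (∀ z ∈ K, ‖f z‖ = 1) →
    ∀ ε > 0, ∃ n : ℤ, ∀ z ∈ K, ‖f z - z ^ n‖ < ε

/-- A Helson set: a compact subset of the unit circle on which every continuous function
is the restriction of an element of the Wiener algebra. -/
def IsHelson (K : Set ℂ) : Prop :=
  IsCompact K ∧ K ⊆ Metric.sphere (0 : ℂ) 1 ∧
  ∀ f : ℂ → ℂ, ContinuousOn f K → ∃ g ∈ WienerAlg, ∀ z ∈ K, f z = g z

/-- The little Lipschitz class `Λ_α(D)`: disc-algebra functions with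
`|f(e^{it₁}) - f(e^{it₂})| / |t₁-t₂|^α → 0` uniformly as `|t₁-t₂| → 0`. -/
def LittleLip (α : ℝ) (f : ℂ → ℂ) : Prop :=
  ContinuousOn f (Metric.closedBall (0 : ℂ) 1) ∧
  DifferentiableOn ℂ f (Metric.ball (0 : ℂ) 1) ∧
  ∀ ε > 0, ∃ δ > 0, ∀ t₁ t₂ : ℝ, t₁ ≠ t₂ → |t₁ - t₂| < δ →
    ‖f (Complex.exp ((t₁ : ℂ) * Complex.I)) - f (Complex.exp ((t₂ : ℂ) * Complex.I))‖ ≤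
      ε * |t₁ - t₂| ^ α

/-- The perfect part of a set: the union of all its perfect subsets. -/
def perfectPart (C : Set ℂ) : Set ℂ := ⋃₀ {P | Perfect P ∧ P ⊆ C}

/-- A distribution on the unit circle, encoded by its sequence of Fourier coefficients
`μ̂(n) = μ(e^{-int})`, which has polynomial growth. -/
structure CircleDistribution where
  coeff : ℤ → ℂ
  growth : ∃ (C : ℝ) (k : ℕ), ∀ n : ℤ, ‖coeff n‖ ≤ C * (1 + (n.natAbs : ℝ)) ^ k

/-- A smooth `2π`-periodic function (test function on the circle). -/
def PeriodicSmooth (φ : ℝ → ℂ) : Prop :=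
  ContDiff ℝ (⊤ : ℕ∞) φ ∧ ∀ θ : ℝ, φ (θ + 2 * Real.pi) = φ θ

/-- Fourier coefficients of a test function. -/
def testCoeff (φ : ℝ → ℂ) (n : ℤ) : ℂ :=
  (1 / (2 * Real.pi)) * ∫ θ in (0:ℝ)..(2 * Real.pi),
    φ θ * Complex.exp (-(n : ℂ) * (θ : ℂ) * Complex.I)

/-- The action of a distribution on a test function: `μ(φ) = ∑ₙ μ̂(n) φ̂(-n)`. -/
def distAct (μ : CircleDistribution) (φ : ℝ → ℂ) : ℂ := ∑' n : ℤ, μ.coeff n * testCoeff φ (-n)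

/-- The support of a distribution on the circle: the points of the circle having no open
neighbourhood `U` such that `μ` kills every test function supported in `U`. -/
def distSupport (μ : CircleDistribution) : Set ℂ :=
  {z ∈ Metric.sphere (0 : ℂ) 1 | ∀ U : Set ℂ, IsOpen U → z ∈ U →
    ∃ φ : ℝ → ℂ, PeriodicSmooth φ ∧
      (∀ θ : ℝ, Complex.exp ((θ : ℂ) * Complex.I) ∉ U → φ θ = 0) ∧ distAct μ φ ≠ 0}

/-- A set of multiplicity: a closed subset of the circle supporting a nonzero
pseudofunction (distribution whose Fourier coefficients tend to `0` as `|n| → ∞`). -/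
def IsMSet (E : Set ℂ) : Prop :=
  IsClosed E ∧ E ⊆ Metric.sphere (0 : ℂ) 1 ∧
  ∃ μ : CircleDistribution, μ.coeff ≠ 0 ∧ distSupport μ ⊆ E ∧
    Filter.Tendsto μ.coeff Filter.cofinite (nhds 0)

/-- A Dirichlet set: `sup_{z ∈ E} |z^{n_k} - 1| → 0` for some sequence `n_k → ∞`. -/
def IsDirichletSet (E : Set ℂ) : Prop :=
  ∃ n : ℕ → ℕ, Filter.Tendsto n Filter.atTop Filter.atTop ∧
    ∀ ε > 0, ∀ᶠ k in Filter.atTop, ∀ z ∈ E, ‖z ^ (n k) - 1‖ < ε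

theorem log_norm_le_circleAverage {f : ℂ → ℂ} {c : ℂ} {R : ℝ} (hR : 0 < R)
    (hf : AnalyticOnNhd ℂ f (closedBall c R)) (h0 : f c ≠ 0) :
    Real.log ‖f c‖ ≤ Real.circleAverage (fun z => Real.log ‖f z‖) c R := by
  have hR' : |R| = R := abs_of_pos hR
  rw [← hR'] at hf
  rw [AnalyticOnNhd.circleAverage_log_norm hR.ne' hf h0]
  refine le_add_of_nonneg_left (finsum_nonneg fun u => ?_)
  have hdiv := MeromorphicOn.AnalyticOnNhd.divisor_nonneg hf u
  by_cases hu : u ∈ closedBall c |R|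
  · refine mul_nonneg (by exact_mod_cast hdiv) ?_
    rcases eq_or_ne c u with rfl | hcu
    · simp
    · apply Real.log_nonneg
      rw [mem_closedBall, dist_comm, dist_eq_norm, hR'] at hu
      rw [← div_eq_mul_inv, le_div_iff₀ (norm_pos_iff.2 (sub_ne_zero.2 hcu))]
      simpa using hu
  · rw [Function.locallyFinsuppWithin.apply_eq_zero_of_notMem _ hu]
    simp

theorem integrableOn_log_norm_circleMap {f : ℂ → ℂ} {c : ℂ} {R : ℝ} (hR : 0 < R)
    (hf : AnalyticOnNhd ℂ f (closedBall c R)) :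
    IntegrableOn (fun θ => Real.log ‖f (circleMap c R θ)‖) (Ioc (-Real.pi) Real.pi) := by
  have h1 : CircleIntegrable (fun z => Real.log ‖f z‖) c R := by
    apply MeromorphicOn.circleIntegrable_log_norm
    intro z hz
    apply (hf z _).meromorphicAt
    rw [abs_of_pos hR] at hz
    exact sphere_subset_closedBall hz
  have h2 : IntervalIntegrable (fun θ => Real.log ‖f (circleMap c R θ)‖) volume
      (-Real.pi) Real.pi := by
    have hp : Function.Periodic (fun θ => Real.log ‖f (circleMap c R θ)‖) (2 * Real.pi) := by
      intro θ
      simp only [periodic_circleMap c R θ]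
    exact hp.intervalIntegrable (by positivity) (t := 0) (by simpa [CircleIntegrable] using h1) _ _
  rwa [intervalIntegrable_iff_integrableOn_Ioc_of_le (by linarith [Real.pi_pos])] at h2

theorem circleAverage_eq_setIntegral (h : ℂ → ℝ) (c : ℂ) (R : ℝ) :
    2 * Real.pi * Real.circleAverage h c R =
      ∫ θ in Ioc (-Real.pi) Real.pi, h (circleMap c R θ) := by
  have hp : Function.Periodic (fun θ => h (circleMap c R θ)) (2 * Real.pi) := by
    intro θ
    simp only [periodic_circleMap c R θ]
  have := hp.intervalIntegral_add_eq 0 (-Real.pi)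
  rw [Real.circleAverage_def, smul_eq_mul, mul_inv_cancel_left₀ (by positivity)]
  rw [zero_add] at this
  rw [this, show -Real.pi + 2 * Real.pi = Real.pi by ring,
    intervalIntegral.integral_of_le (by linarith [Real.pi_pos])]

theorem ofReal_log_norm_le_lintegral {f : ℂ → ℂ} {c : ℂ} {R : ℝ} (hR : 0 < R)
    (hf : AnalyticOnNhd ℂ f (closedBall c R)) :
    ENNReal.ofReal (2 * Real.pi * Real.log ‖f c‖) ≤
      ∫⁻ θ in Ioo (-Real.pi) Real.pi, ENNReal.ofReal (Real.log ‖f (circleMap c R θ)‖) := by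
  rcases eq_or_ne (f c) 0 with h0 | h0
  · simp [h0]
  have hInt := integrableOn_log_norm_circleMap hR hf
  rw [restrict_Ioo_eq_restrict_Ioc]
  calc ENNReal.ofReal (2 * Real.pi * Real.log ‖f c‖)
      ≤ ENNReal.ofReal (∫ θ in Ioc (-Real.pi) Real.pi,
          max (Real.log ‖f (circleMap c R θ)‖) 0) := by
        apply ENNReal.ofReal_le_ofReal
        calc 2 * Real.pi * Real.log ‖f c‖
            ≤ 2 * Real.pi * Real.circleAverage (fun z => Real.log ‖f z‖) c R := by
              gcongr
              exact log_norm_le_circleAverage hR hf h0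
          _ = ∫ θ in Ioc (-Real.pi) Real.pi, Real.log ‖f (circleMap c R θ)‖ :=
              circleAverage_eq_setIntegral _ _ _
          _ ≤ _ := integral_mono hInt hInt.pos_part fun θ => le_max_left _ _
    _ = ∫⁻ θ in Ioc (-Real.pi) Real.pi,
          ENNReal.ofReal (max (Real.log ‖f (circleMap c R θ)‖) 0) :=
        ofReal_integral_eq_lintegral_ofReal hInt.pos_part
          (Eventually.of_forall fun θ => le_max_right _ _)
    _ = _ := by
        refine lintegral_congr fun θ => ?_
        rcases le_total 0 (Real.log ‖f (circleMap c R θ)‖) with h | h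
        · rw [max_eq_left h]
        · rw [max_eq_right h, ENNReal.ofReal_of_nonpos h, ENNReal.ofReal_zero]

theorem lintegral_neg_log_norm_le {g : ℂ → ℂ} {c : ℂ} {R : ℝ} (hR : 0 < R)
    (hg : AnalyticOnNhd ℂ g (closedBall c R)) (h1 : ∀ z ∈ closedBall c R, ‖g z‖ ≤ 1)
    (h0 : g c ≠ 0) :
    ∫⁻ θ in Ioo (-Real.pi) Real.pi, ENNReal.ofReal (-Real.log ‖g (circleMap c R θ)‖) ≤
      ENNReal.ofReal (2 * Real.pi * (-Real.log ‖g c‖)) := by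
  have hInt : IntegrableOn (fun θ => -Real.log ‖g (circleMap c R θ)‖)
      (Ioc (-Real.pi) Real.pi) := (integrableOn_log_norm_circleMap hR hg).neg
  rw [restrict_Ioo_eq_restrict_Ioc, ← ofReal_integral_eq_lintegral_ofReal hInt]
  · apply ENNReal.ofReal_le_ofReal
    rw [integral_neg, ← circleAverage_eq_setIntegral (fun z => Real.log ‖g z‖)]
    have := log_norm_le_circleAverage hR hg h0
    nlinarith [Real.pi_pos]
  · refine Eventually.of_forall fun θ => ?_
    exact neg_nonneg.2 (Real.log_nonpos (norm_nonneg _)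
      (h1 _ (sphere_subset_closedBall (circleMap_mem_sphere c hR.le θ))))

theorem lintegral_eq_lintegral_circleMap {F : ℂ → ENNReal} (hF : Measurable F) (c : ℂ) :
    ∫⁻ z, F z = ∫⁻ r in Ioi (0 : ℝ), ENNReal.ofReal r *
      ∫⁻ θ in Ioo (-Real.pi) Real.pi, F (circleMap c r θ) := by
  rw [← lintegral_add_left_eq_self F c,
    ← Complex.lintegral_comp_polarCoord_symm (fun z => F (c + z))]
  have hmeas : Measurable fun p : ℝ × ℝ => F (c + Complex.polarCoord.symm p) := by
    apply hF.comp
    apply Measurable.const_add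
    have : (fun p : ℝ × ℝ => Complex.polarCoord.symm p) =
        fun p : ℝ × ℝ => (p.1 : ℂ) * (Real.cos p.2 + Real.sin p.2 * Complex.I) := by
      ext p
      rw [Complex.polarCoord_symm_apply]
    rw [show (Complex.polarCoord.symm : ℝ × ℝ → ℂ) = _ from this]
    fun_prop
  rw [show polarCoord.target = Ioi (0 : ℝ) ×ˢ Ioo (-Real.pi) Real.pi from rfl,
    Measure.volume_eq_prod, ← Measure.prod_restrict, lintegral_prod]
  · refine lintegral_congr fun r => ?_
    rw [← lintegral_const_mul]
    · refine lintegral_congr fun θ => ?_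
      simp only [smul_eq_mul, Complex.polarCoord_symm_apply, circleMap]
      rw [Complex.exp_mul_I]
      simp
    · exact hF.comp (measurable_circleMap c r)
  · apply Measurable.aemeasurable
    simp only [smul_eq_mul]
    exact (ENNReal.measurable_ofReal.comp measurable_fst).mul hmeas

theorem measurable_indicator_of_continuousOn {f : ℂ → ℂ} {s : Set ℂ} (hs : MeasurableSet s)
    (hf : ContinuousOn f s) : Measurable (s.indicator f) := by
  classical
  rw [← piecewise_eq_indicator]
  exact hf.measurable_piecewise continuousOn_const hs

theorem lintegral_Ico_ofReal {a b : ℝ} (ha : 0 ≤ a) (hab : a ≤ b) :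
    ∫⁻ r in Ico a b, ENNReal.ofReal r = ENNReal.ofReal ((b ^ 2 - a ^ 2) / 2) := by
  have h1 : IntegrableOn (fun r : ℝ => r) (Ioc a b) :=
    (continuous_id.integrableOn_Icc).mono_set Ioc_subset_Icc_self
  rw [restrict_Ico_eq_restrict_Ioc, ← ofReal_integral_eq_lintegral_ofReal h1,
    ← intervalIntegral.integral_of_le hab, integral_id]
  filter_upwards [ae_restrict_mem measurableSet_Ioc] with r hr
  exact ha.trans hr.1.le

theorem ofReal_log_norm_le_lintegral_ball {f : ℂ → ℂ} {c : ℂ} {R : ℝ} (hR : 0 < R)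
    (hf : AnalyticOnNhd ℂ f (ball c R)) :
    ENNReal.ofReal (Real.pi * R ^ 2 * Real.log ‖f c‖) ≤
      ∫⁻ z in ball c R, ENNReal.ofReal (Real.log ‖f z‖) := by
  set F : ℂ → ENNReal := fun z => ENNReal.ofReal (Real.log ‖(ball c R).indicator f z‖) with hF
  have hm : Measurable F := by
    have := measurable_indicator_of_continuousOn measurableSet_ball hf.continuousOn
    fun_prop
  have hFe : F = (ball c R).indicator fun z => ENNReal.ofReal (Real.log ‖f z‖) := by
    ext z
    by_cases hz : z ∈ ball c R <;> simp [hF, hz]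
  have hin : ∀ r ∈ Ico (0 : ℝ) R, ∀ θ, circleMap c r θ ∈ ball c R := by
    intro r hr θ
    exact closedBall_subset_ball hr.2 (circleMap_mem_closedBall c hr.1 θ)
  rw [← lintegral_indicator measurableSet_ball, ← hFe, lintegral_eq_lintegral_circleMap hm c]
  calc ENNReal.ofReal (Real.pi * R ^ 2 * Real.log ‖f c‖)
      = ENNReal.ofReal (R ^ 2 / 2) * ENNReal.ofReal (2 * Real.pi * Real.log ‖f c‖) := by
        rw [← ENNReal.ofReal_mul (by positivity)]
        congr 1
        ring
    _ = ∫⁻ r in Ico 0 R, ENNReal.ofReal r * ENNReal.ofReal (2 * Real.pi * Real.log ‖f c‖) := by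
        rw [lintegral_mul_const _ ENNReal.measurable_ofReal, lintegral_Ico_ofReal le_rfl hR.le]
        simp
    _ = ∫⁻ r in Ioo 0 R, ENNReal.ofReal r * ENNReal.ofReal (2 * Real.pi * Real.log ‖f c‖) := by
        rw [restrict_Ico_eq_restrict_Ioc, restrict_Ioo_eq_restrict_Ioc]
    _ ≤ ∫⁻ r in Ioo 0 R, ENNReal.ofReal r *
          ∫⁻ θ in Ioo (-Real.pi) Real.pi, F (circleMap c r θ) := by
        apply setLIntegral_mono' measurableSet_Ioo
        intro r hr
        gcongr
        refine (ofReal_log_norm_le_lintegral hr.1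
          (hf.mono (closedBall_subset_ball hr.2))).trans_eq ?_
        refine lintegral_congr fun θ => ?_
        rw [hFe, indicator_of_mem (hin r ⟨hr.1.le, hr.2⟩ θ)]
    _ ≤ _ := lintegral_mono_set Ioo_subset_Ioi_self

theorem lintegral_neg_log_norm_annulus_le {g : ℂ → ℂ} {c : ℂ} {a R : ℝ} (ha : 0 ≤ a)
    (haR : a ≤ R) (hg : AnalyticOnNhd ℂ g (ball c R)) (h1 : ∀ z ∈ ball c R, ‖g z‖ ≤ 1)
    (h0 : g c ≠ 0) :
    ∫⁻ z in ball c R \ ball c a, ENNReal.ofReal (-Real.log ‖g z‖) ≤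
      ENNReal.ofReal (Real.pi * (R ^ 2 - a ^ 2) * (-Real.log ‖g c‖)) := by
  set s := ball c R \ ball c a with hs
  have hsm : MeasurableSet s := measurableSet_ball.diff measurableSet_ball
  set F : ℂ → ENNReal := fun z => ENNReal.ofReal (-Real.log ‖s.indicator g z‖) with hF
  have hm : Measurable F := by
    have := measurable_indicator_of_continuousOn hsm (hg.continuousOn.mono sdiff_subset)
    fun_prop
  have hFe : F = s.indicator fun z => ENNReal.ofReal (-Real.log ‖g z‖) := by
    ext z
    by_cases hz : z ∈ s <;> simp [hF, hz]
  have hzero : ∀ r, 0 < r → r ∉ Ico a R → ∀ θ, F (circleMap c r θ) = 0 := by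
    intro r hr hra θ
    rw [hFe, indicator_of_notMem]
    simp only [hs, Set.mem_sdiff, mem_ball, dist_eq_norm, circleMap_sub_center, norm_circleMap_zero,
      abs_of_pos hr]
    simpa [and_comm] using hra
  rw [← lintegral_indicator hsm, ← hFe, lintegral_eq_lintegral_circleMap hm c]
  calc ∫⁻ r in Ioi (0 : ℝ), ENNReal.ofReal r *
        ∫⁻ θ in Ioo (-Real.pi) Real.pi, F (circleMap c r θ)
      ≤ ∫⁻ r in Ioi (0 : ℝ), (Ico a R).indicator (fun r => ENNReal.ofReal r *
          ENNReal.ofReal (2 * Real.pi * (-Real.log ‖g c‖))) r := by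
        apply setLIntegral_mono' measurableSet_Ioi
        intro r (hr : 0 < r)
        by_cases hra : r ∈ Ico a R
        · rw [indicator_of_mem hra]
          gcongr
          have hsub : closedBall c r ⊆ ball c R := closedBall_subset_ball hra.2
          refine le_trans (lintegral_mono fun θ => ?_) (lintegral_neg_log_norm_le hr
            (hg.mono hsub) (fun z hz => h1 z (hsub hz)) h0)
          rw [hFe]
          exact indicator_le_self _ _ _
        · simp [hzero r hr hra, indicator_of_notMem hra]
    _ ≤ ∫⁻ r, (Ico a R).indicator (fun r => ENNReal.ofReal r *
          ENNReal.ofReal (2 * Real.pi * (-Real.log ‖g c‖))) r := setLIntegral_le_lintegral _ _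
    _ = ∫⁻ r in Ico a R, ENNReal.ofReal r *
          ENNReal.ofReal (2 * Real.pi * (-Real.log ‖g c‖)) :=
        lintegral_indicator measurableSet_Ico _
    _ = ENNReal.ofReal ((R ^ 2 - a ^ 2) / 2) *
          ENNReal.ofReal (2 * Real.pi * (-Real.log ‖g c‖)) := by
        rw [lintegral_mul_const _ ENNReal.measurable_ofReal, lintegral_Ico_ofReal ha haR]
    _ = _ := by
        rw [← ENNReal.ofReal_mul (by nlinarith)]
        congr 1
        ring

theorem lintegral_rpow_abs_sub_one_le {η : ℝ} (hη : 0 < η) :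
    ∫⁻ r in Ioo (1 - η) (1 + η), ENNReal.ofReal (|r - 1| ^ (-(1 / 2) : ℝ)) ≤
      ENNReal.ofReal (4 * Real.sqrt η) := by
  have key : ∫⁻ t in Ioc 0 η, ENNReal.ofReal (t ^ (-(1 / 2) : ℝ)) =
      ENNReal.ofReal (2 * Real.sqrt η) := by
    rw [← ofReal_integral_eq_lintegral_ofReal, ← intervalIntegral.integral_of_le hη.le,
      integral_rpow (by norm_num)]
    · rw [Real.zero_rpow (by norm_num), Real.sqrt_eq_rpow]
      congr 1
      norm_num
      ring
    · rw [← IntegrableOn, ← intervalIntegrable_iff_integrableOn_Ioc_of_le hη.le]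
      exact intervalIntegral.intervalIntegrable_rpow' (by norm_num)
    · filter_upwards [ae_restrict_mem measurableSet_Ioc] with t ht
      exact Real.rpow_nonneg ht.1.le _
  set G : ℝ → ENNReal := (Ioc 0 η).indicator fun t => ENNReal.ofReal (t ^ (-(1 / 2) : ℝ)) with hG
  have key' : ∫⁻ t, G t = ENNReal.ofReal (2 * Real.sqrt η) := by
    rw [hG, lintegral_indicator measurableSet_Ioc, key]
  have hGm : Measurable G := by
    apply Measurable.indicator _ measurableSet_Ioc
    fun_prop
  calc ∫⁻ r in Ioo (1 - η) (1 + η), ENNReal.ofReal (|r - 1| ^ (-(1 / 2) : ℝ))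
      = ∫⁻ r, (Ioo (1 - η) (1 + η)).indicator
          (fun r => ENNReal.ofReal (|r - 1| ^ (-(1 / 2) : ℝ))) r :=
        (lintegral_indicator measurableSet_Ioo _).symm
    _ ≤ ∫⁻ r, (G (r - 1) + G (1 - r)) := by
        apply lintegral_mono_ae
        have : ∀ᵐ r : ℝ, r ≠ 1 := by
          simp [ae_iff, measure_singleton]
        filter_upwards [this] with r hr1
        by_cases hr : r ∈ Ioo (1 - η) (1 + η)
        · rw [indicator_of_mem hr]
          rcases lt_or_gt_of_ne hr1 with h | h
          · refine le_trans ?_ le_add_self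
            rw [hG, indicator_of_mem (by constructor <;> linarith [hr.1, hr.2]),
              abs_of_neg (by linarith), neg_sub]
          · refine le_trans ?_ le_self_add
            rw [hG, indicator_of_mem (by constructor <;> linarith [hr.1, hr.2]),
              abs_of_pos (by linarith)]
        · simp [indicator_of_notMem hr]
    _ = ENNReal.ofReal (4 * Real.sqrt η) := by
        rw [lintegral_add_left (f := fun r => G (r - 1)) (hGm.comp (measurable_id.sub_const 1)),
          lintegral_sub_right_eq_self G 1, lintegral_sub_left_eq_self G 1, key',
          ← ENNReal.ofReal_add (by positivity) (by positivity)]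
        congr 1
        ring

theorem lintegral_thin_annulus_le {η : ℝ} (hη : 0 < η) (hη1 : η ≤ 1) :
    ∫⁻ z : ℂ, (Ioo (1 - η) (1 + η)).indicator
      (fun r : ℝ => ENNReal.ofReal (|r - 1| ^ (-(1 / 2) : ℝ))) ‖z‖ ≤
      ENNReal.ofReal (16 * Real.pi * Real.sqrt η) := by
  set G : ℝ → ENNReal := (Ioo (1 - η) (1 + η)).indicator
      (fun r : ℝ => ENNReal.ofReal (|r - 1| ^ (-(1 / 2) : ℝ))) with hG
  have hGm : Measurable G := by
    apply Measurable.indicator _ measurableSet_Ioo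
    apply ENNReal.measurable_ofReal.comp
    have : Measurable fun r : ℝ => |r - 1| := (continuous_id.sub continuous_const).abs.measurable
    exact this.pow_const _
  rw [lintegral_eq_lintegral_circleMap (F := fun z : ℂ => G ‖z‖) (hGm.comp measurable_norm) 0]
  calc ∫⁻ r in Ioi (0 : ℝ), ENNReal.ofReal r *
        ∫⁻ θ in Ioo (-Real.pi) Real.pi, G ‖circleMap 0 r θ‖
      ≤ ∫⁻ r in Ioi (0 : ℝ), ENNReal.ofReal (4 * Real.pi) * G r := by
        apply setLIntegral_mono' measurableSet_Ioi
        intro r (hr : 0 < r)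
        simp only [norm_circleMap_zero, abs_of_pos hr, lintegral_const, Measure.restrict_apply_univ,
          Real.volume_Ioo]
        by_cases h : r ∈ Ioo (1 - η) (1 + η)
        · rw [mul_comm (G r), ← mul_assoc, ← ENNReal.ofReal_mul hr.le]
          refine mul_le_mul_left (ENNReal.ofReal_le_ofReal ?_) _
          nlinarith [Real.pi_pos, h.2]
        · simp [hG, indicator_of_notMem h]
    _ ≤ ∫⁻ r, ENNReal.ofReal (4 * Real.pi) * G r := setLIntegral_le_lintegral _ _
    _ = ENNReal.ofReal (4 * Real.pi) *
        ∫⁻ r in Ioo (1 - η) (1 + η), ENNReal.ofReal (|r - 1| ^ (-(1 / 2) : ℝ)) := by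
        rw [lintegral_const_mul _ hGm, hG, lintegral_indicator measurableSet_Ioo]
    _ ≤ ENNReal.ofReal (4 * Real.pi) * ENNReal.ofReal (4 * Real.sqrt η) := by
        gcongr
        exact lintegral_rpow_abs_sub_one_le hη
    _ = _ := by
        rw [← ENNReal.ofReal_mul (by positivity)]
        congr 1
        ring

theorem log_le_two_mul_sqrt {y : ℝ} (hy : 0 < y) : Real.log y ≤ 2 * Real.sqrt y := by
  have h1 := Real.log_le_sub_one_of_pos (Real.sqrt_pos.2 hy)
  rw [Real.log_sqrt hy.le] at h1
  linarith

theorem log_div_le_rpow {C t : ℝ} (hC : 0 < C) (ht : 0 < t) :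
    Real.log (C / t) ≤ 2 * Real.sqrt C * t ^ (-(1 / 2) : ℝ) := by
  refine (log_le_two_mul_sqrt (div_pos hC ht)).trans_eq ?_
  rw [Real.sqrt_div hC.le, Real.rpow_neg ht.le, ← Real.sqrt_eq_rpow]
  ring

theorem ae_ne_zero_of_analytic_disc {g : ℂ → ℂ} {x : ℂ} (hg : AnalyticOnNhd ℂ g (ball 0 1))
    (hx : x ∈ ball (0 : ℂ) 1) (h0 : g x ≠ 0) : ∀ᵐ z : ℂ, z ∈ ball (0 : ℂ) 1 → g z ≠ 0 := by
  have h := hg.preimage_zero_mem_codiscreteWithin h0 hx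
    (isConnected_ball one_pos)
  rw [← ae_restrict_iff' measurableSet_ball]
  filter_upwards [ae_restrict_le_codiscreteWithin measurableSet_ball h] with z hz
  simpa using hz

theorem exists_growth_bound {F g : ℂ → ℂ} {C : ℝ} (hF : Differentiable ℂ F) (hC : 0 < C)
    (h1 : ∀ z : ℂ, 1 < ‖z‖ → ‖F (z - 1)⁻¹‖ ≤ C / (‖z‖ - 1))
    (hg : DifferentiableOn ℂ g (ball 0 1)) (hg1 : ∀ z ∈ ball (0 : ℂ) 1, ‖g z‖ ≤ 1)
    (hg0 : g 0 ≠ 0)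
    (h2 : ∀ z ∈ ball (0 : ℂ) 1, ‖g z‖ * ‖F (z - 1)⁻¹‖ ≤ C / (1 - ‖z‖)) :
    ∃ K : ℝ, ∀ s : ℂ, 6 ≤ ‖s‖ → ‖F s‖ ≤ Real.exp (K * ‖s‖ ^ (3 / 2 : ℝ)) := by
  have hga : AnalyticOnNhd ℂ g (ball 0 1) := hg.analyticOnNhd isOpen_ball
  set K0 : ℝ := 32 * Real.pi * Real.sqrt C + 2 * Real.pi * (-Real.log ‖g 0‖) with hK0
  have hlog0 : 0 ≤ -Real.log ‖g 0‖ :=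
    neg_nonneg.2 (Real.log_nonpos (norm_nonneg _) (hg1 0 (mem_ball_self one_pos)))
  have hK0n : 0 ≤ K0 := by positivity
  refine ⟨K0 * 8 / Real.pi, fun s hs => ?_⟩
  have hs0 : s ≠ 0 := by
    rintro rfl
    norm_num at hs
  have hspos : 0 < ‖s‖ := norm_pos_iff.2 hs0
  set δ : ℝ := 1 / (2 * ‖s‖) with hδ
  have hδpos : 0 < δ := by positivity
  have hδle : 3 * δ ≤ 1 / 4 := by
    rw [hδ, ← mul_div_assoc, div_le_div_iff₀ (by positivity) (by norm_num)]
    linarith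
  set c : ℂ := 1 + s⁻¹ with hc
  have hdist : ∀ z ∈ ball c δ, δ < ‖z - 1‖ ∧ ‖z - 1‖ < 3 * δ := by
    intro z hz
    rw [mem_ball, dist_eq_norm] at hz
    have h3 : ‖s⁻¹‖ = 2 * δ := by
      rw [norm_inv, hδ]
      field_simp
    have h4 : z - 1 = (z - c) + s⁻¹ := by
      rw [hc]
      ring
    have h5 := norm_add_le (z - c) s⁻¹
    have h6 := norm_sub_norm_le (s⁻¹) (-(z - c))
    rw [sub_neg_eq_add, add_comm, norm_neg, add_comm] at h6
    rw [add_comm s⁻¹] at h6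
    rw [← h4] at h5 h6
    constructor <;> linarith
  have hΦ : AnalyticOnNhd ℂ (fun z => F (z - 1)⁻¹) (ball c δ) := by
    apply DifferentiableOn.analyticOnNhd _ isOpen_ball
    intro z hz
    have hz1 : z - 1 ≠ 0 := norm_pos_iff.1 (hδpos.trans (hdist z hz).1)
    apply DifferentiableAt.differentiableWithinAt
    exact (hF _).comp z ((differentiableAt_id.sub_const 1).inv hz1)
  have hmean := ofReal_log_norm_le_lintegral_ball hδpos hΦ
  have hFc : F (c - 1)⁻¹ = F s := by simp [hc]
  simp only [hFc] at hmean
  set H : ℂ → ENNReal := fun z => (Ioo (1 - 3 * δ) (1 + 3 * δ)).indicator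
      (fun r : ℝ => ENNReal.ofReal (|r - 1| ^ (-(1 / 2) : ℝ))) ‖z‖ with hH
  have hHm : Measurable H := by
    refine Measurable.comp (g := (Ioo (1 - 3 * δ) (1 + 3 * δ)).indicator
      (fun r : ℝ => ENNReal.ofReal (|r - 1| ^ (-(1 / 2) : ℝ)))) ?_ measurable_norm
    apply Measurable.indicator _ measurableSet_Ioo
    apply ENNReal.measurable_ofReal.comp
    have : Measurable fun r : ℝ => |r - 1| := (continuous_id.sub continuous_const).abs.measurable
    exact this.pow_const _
  set s' : Set ℂ := ball (0 : ℂ) 1 \ ball 0 (1 - 3 * δ) with hs'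
  have hs'm : MeasurableSet s' := measurableSet_ball.diff measurableSet_ball
  have hpt : ∀ᵐ z : ℂ, z ∈ ball c δ → ENNReal.ofReal (Real.log ‖F (z - 1)⁻¹‖) ≤
      ENNReal.ofReal (2 * Real.sqrt C) * H z +
        s'.indicator (fun z => ENNReal.ofReal (-Real.log ‖g z‖)) z := by
    have hsph : ∀ᵐ z : ℂ, z ∉ sphere (0 : ℂ) 1 := by
      rw [ae_iff]
      simp only [not_not, ofPred_mem_eq]
      exact Measure.addHaar_sphere volume (0 : ℂ) 1
    filter_upwards [hsph, ae_ne_zero_of_analytic_disc hga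
      (mem_ball_self one_pos) hg0] with z hz1 hgz hz
    have hd := hdist z hz
    have habs : |‖z‖ - 1| < 3 * δ := by
      have := abs_norm_sub_norm_le z 1
      rw [norm_one] at this
      exact this.trans_lt hd.2
    rw [abs_lt] at habs
    have hHz : H z = ENNReal.ofReal (|‖z‖ - 1| ^ (-(1 / 2) : ℝ)) := by
      simp only [hH]
      rw [indicator_of_mem]
      constructor <;> linarith [habs.1, habs.2]
    rw [hHz, ← ENNReal.ofReal_mul (by positivity)]
    rcases eq_or_ne (F (z - 1)⁻¹) 0 with hF0 | hF0
    · simp [hF0]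
    have hFpos : 0 < ‖F (z - 1)⁻¹‖ := norm_pos_iff.2 hF0
    have hne : ‖z‖ ≠ 1 := by simpa using hz1
    rcases lt_or_gt_of_ne hne with hlt | hgt
    · have hzb : z ∈ ball (0 : ℂ) 1 := by simpa using hlt
      have hgz' : 0 < ‖g z‖ := norm_pos_iff.2 (hgz hzb)
      have hmem : z ∈ s' := by
        refine ⟨hzb, ?_⟩
        simp only [mem_ball, dist_zero_right, not_lt]
        linarith [habs.1]
      rw [indicator_of_mem hmem, ← ENNReal.ofReal_add (by positivity)
        (neg_nonneg.2 (Real.log_nonpos (norm_nonneg _) (hg1 z hzb)))]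
      apply ENNReal.ofReal_le_ofReal
      have h3 := Real.log_le_log (mul_pos hgz' hFpos) (h2 z hzb)
      rw [Real.log_mul hgz'.ne' hFpos.ne'] at h3
      have h4 := log_div_le_rpow hC (sub_pos.2 hlt)
      rw [abs_of_neg (by linarith), neg_sub]
      linarith
    · refine le_trans ?_ le_self_add
      apply ENNReal.ofReal_le_ofReal
      rw [abs_of_pos (by linarith)]
      exact (Real.log_le_log hFpos (h1 z hgt)).trans (log_div_le_rpow hC (sub_pos.2 hgt))
  have htotal : ENNReal.ofReal (Real.pi * δ ^ 2 * Real.log ‖F s‖) ≤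
      ENNReal.ofReal (K0 * Real.sqrt (3 * δ)) := by
    refine hmean.trans ?_
    calc ∫⁻ z in ball c δ, ENNReal.ofReal (Real.log ‖F (z - 1)⁻¹‖)
        ≤ ∫⁻ z in ball c δ, (ENNReal.ofReal (2 * Real.sqrt C) * H z +
          s'.indicator (fun z => ENNReal.ofReal (-Real.log ‖g z‖)) z) :=
          setLIntegral_mono_ae' measurableSet_ball hpt
      _ ≤ ∫⁻ z, (ENNReal.ofReal (2 * Real.sqrt C) * H z +
          s'.indicator (fun z => ENNReal.ofReal (-Real.log ‖g z‖)) z) :=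
          setLIntegral_le_lintegral _ _
      _ = ENNReal.ofReal (2 * Real.sqrt C) * (∫⁻ z, H z) +
          ∫⁻ z in s', ENNReal.ofReal (-Real.log ‖g z‖) := by
          rw [lintegral_add_left (hHm.const_mul _), lintegral_const_mul _ hHm,
            lintegral_indicator hs'm]
      _ ≤ ENNReal.ofReal (2 * Real.sqrt C) *
            ENNReal.ofReal (16 * Real.pi * Real.sqrt (3 * δ)) +
          ENNReal.ofReal (Real.pi * (1 ^ 2 - (1 - 3 * δ) ^ 2) * (-Real.log ‖g 0‖)) := by
          gcongr
          · exact lintegral_thin_annulus_le (by positivity) (by linarith)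
          · exact lintegral_neg_log_norm_annulus_le (by linarith) (by linarith) hga hg1 hg0
      _ = ENNReal.ofReal (32 * Real.pi * Real.sqrt C * Real.sqrt (3 * δ) +
          Real.pi * (1 ^ 2 - (1 - 3 * δ) ^ 2) * (-Real.log ‖g 0‖)) := by
          rw [← ENNReal.ofReal_mul (by positivity), ← ENNReal.ofReal_add (by positivity)]
          · congr 1
            ring
          · have : 0 ≤ (1 ^ 2 - (1 - 3 * δ) ^ 2) := by nlinarith
            positivity
      _ ≤ _ := by
          apply ENNReal.ofReal_le_ofReal
          have h3 : (1 ^ 2 - (1 - 3 * δ) ^ 2) ≤ 2 * Real.sqrt (3 * δ) := by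
            have : 3 * δ ≤ Real.sqrt (3 * δ) := Real.le_sqrt_of_sq_le (by nlinarith)
            nlinarith
          have h4 : Real.pi * (1 ^ 2 - (1 - 3 * δ) ^ 2) * (-Real.log ‖g 0‖) ≤
              Real.pi * (2 * Real.sqrt (3 * δ)) * (-Real.log ‖g 0‖) := by gcongr
          rw [hK0]
          linarith
  rw [ENNReal.ofReal_le_ofReal_iff (by positivity)] at htotal
  rcases eq_or_ne (F s) 0 with hFs | hFs
  · rw [hFs, norm_zero]
    positivity
  rw [← Real.log_le_iff_le_exp (norm_pos_iff.2 hFs)]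
  have hsq : Real.sqrt (3 * δ) ≤ 2 / Real.sqrt ‖s‖ := by
    rw [Real.sqrt_le_left (by positivity), div_pow, Real.sq_sqrt hspos.le, hδ]
    rw [← mul_div_assoc, div_le_div_iff₀ (by positivity) hspos]
    nlinarith
  have hpow : ‖s‖ ^ (3 / 2 : ℝ) = ‖s‖ ^ 2 / Real.sqrt ‖s‖ := by
    rw [Real.sqrt_eq_rpow, ← Real.rpow_natCast, ← Real.rpow_sub hspos]
    norm_num
  rw [hpow]
  have h5 : Real.pi * δ ^ 2 * Real.log ‖F s‖ ≤ K0 * (2 / Real.sqrt ‖s‖) :=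
    htotal.trans (by gcongr)
  have h6 : Real.log ‖F s‖ = (4 * ‖s‖ ^ 2 / Real.pi) * (Real.pi * δ ^ 2 * Real.log ‖F s‖) := by
    rw [hδ]
    field_simp
    norm_num
  rw [h6]
  calc (4 * ‖s‖ ^ 2 / Real.pi) * (Real.pi * δ ^ 2 * Real.log ‖F s‖)
      ≤ (4 * ‖s‖ ^ 2 / Real.pi) * (K0 * (2 / Real.sqrt ‖s‖)) := by gcongr
    _ = _ := by ring

theorem norm_le_of_exterior_bound {F : ℂ → ℂ} {C : ℝ}
    (h1 : ∀ z : ℂ, 1 < ‖z‖ → ‖F (z - 1)⁻¹‖ ≤ C / (‖z‖ - 1)) {s : ℂ} (hs : s ≠ 0)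
    (hre : -1 / 2 < s.re) :
    ‖F s‖ ≤ C * (‖s‖ * (‖s‖ + ‖s + 1‖) / (2 * s.re + 1)) := by
  have hsp : 0 < ‖s‖ := norm_pos_iff.2 hs
  have hsq : ‖s + 1‖ ^ 2 - ‖s‖ ^ 2 = 2 * s.re + 1 := by
    rw [← Complex.normSq_eq_norm_sq, ← Complex.normSq_eq_norm_sq, Complex.normSq_apply,
      Complex.normSq_apply]
    simp
    ring
  have hlt : ‖s‖ < ‖s + 1‖ := lt_of_pow_lt_pow_left₀ 2 (norm_nonneg _) (by linarith)
  have hnorm : ‖1 + s⁻¹‖ = ‖s + 1‖ / ‖s‖ := by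
    rw [← norm_div]
    congr 1
    field_simp
  have h := h1 (1 + s⁻¹) (by rw [hnorm, lt_div_iff₀ hsp]; linarith)
  rw [add_sub_cancel_left, inv_inv, hnorm] at h
  refine h.trans_eq ?_
  rw [← hsq]
  have h2 : ‖s + 1‖ - ‖s‖ ≠ 0 := by linarith
  have h3 : ‖s + 1‖ + ‖s‖ ≠ 0 := by positivity
  have h4 : ‖s + 1‖ ^ 2 - ‖s‖ ^ 2 ≠ 0 := by
    rw [sq_sub_sq]
    exact mul_ne_zero h3 h2
  have h5 : ‖s + 1‖ / ‖s‖ - 1 = (‖s + 1‖ - ‖s‖) / ‖s‖ := by field_simp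
  rw [h5]
  field_simp
  ring

theorem norm_le_of_exterior_bound_of_subexponential {F : ℂ → ℂ} {C K : ℝ} (hF : Differentiable ℂ F)
    (hF0 : F 0 = 0) (hC : 0 < C)
    (h1 : ∀ z : ℂ, 1 < ‖z‖ → ‖F (z - 1)⁻¹‖ ≤ C / (‖z‖ - 1))
    (hK : ∀ s : ℂ, 6 ≤ ‖s‖ → ‖F s‖ ≤ Real.exp (K * ‖s‖ ^ (3 / 2 : ℝ)))
    (hsub : ∀ a : ℝ, 0 < a → ∀ᶠ x : ℝ in atTop, ‖F (-(x : ℂ))‖ ≤ Real.exp (a * x)) (s : ℂ) :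
    ‖F s‖ ≤ 3 * C * (1 + ‖s‖) ^ 2 := by
  rcases le_total 0 s.re with hre | hre
  · rcases eq_or_ne s 0 with rfl | hs
    · rw [hF0]
      simp only [norm_zero]
      positivity
    refine (norm_le_of_exterior_bound h1 hs (by linarith)).trans ?_
    rw [mul_comm 3 C, mul_assoc]
    gcongr
    rw [div_le_iff₀ (by linarith)]
    have h3 : ‖s + 1‖ ≤ ‖s‖ + 1 := by simpa using norm_add_le s 1
    have h4 := norm_nonneg s
    have h5 : ‖s‖ * (‖s‖ + ‖s + 1‖) ≤ 3 * (1 + ‖s‖) ^ 2 := by nlinarith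
    nlinarith [sq_nonneg (1 + ‖s‖)]
  · have key : ∀ a : ℝ, 0 < a → ‖F s‖ * Real.exp (a * s.re) ≤ 3 * C * ‖1 - s‖ ^ 2 := by
      intro a ha
      set G : ℂ → ℂ := fun w => F (-w) * Complex.exp (-(a * w)) / (1 + w) ^ 2 with hG
      have hGnorm : ∀ w : ℂ, ‖G w‖ = ‖F (-w)‖ * Real.exp (-(a * w.re)) / ‖1 + w‖ ^ 2 := by
        intro w
        simp [hG, Complex.norm_exp]
      have hne : ∀ w : ℂ, 0 ≤ w.re → 1 + w ≠ 0 := by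
        intro w hw h
        have := congrArg Complex.re h
        simp at this
        linarith
      have hge : ∀ w : ℂ, 0 ≤ w.re → 1 ≤ ‖1 + w‖ := by
        intro w hw
        have := (Complex.re_le_norm (1 + w))
        simp at this
        linarith
      have hGd : ∀ w : ℂ, 0 ≤ w.re → DifferentiableAt ℂ G w := by
        intro w hw
        have hFn : DifferentiableAt ℂ (fun w => F (-w)) w :=
          (hF (-w)).comp w differentiableAt_id.neg
        exact (hFn.mul (by fun_prop)).div (by fun_prop) (pow_ne_zero 2 (hne w hw))
      have hle : ∀ w : ℂ, 0 ≤ w.re → ‖G w‖ ≤ ‖F (-w)‖ := by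
        intro w hw
        rw [hGnorm]
        refine (div_le_self (by positivity) (one_le_pow₀ (hge w hw))).trans ?_
        refine mul_le_of_le_one_right (norm_nonneg _) (Real.exp_le_one_iff.2 ?_)
        nlinarith
      have hPL : ‖G (-s)‖ ≤ 3 * C := by
        refine PhragmenLindelof.right_half_plane_of_tendsto_zero_on_real ?_ ?_ ?_ ?_
          (show 0 ≤ (-s).re by simpa using hre)
        · apply DifferentiableOn.diffContOnCl
          rw [Complex.closure_setOfPred_lt_re]
          exact fun w hw => (hGd w hw).differentiableWithinAt
        · refine ⟨3 / 2, by norm_num, K, ?_⟩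
          apply Asymptotics.IsBigO.of_bound 1
          have hev : ∀ᶠ w : ℂ in Bornology.cobounded ℂ, 6 ≤ ‖w‖ :=
            tendsto_norm_cobounded_atTop.eventually (eventually_ge_atTop 6)
          filter_upwards [hev.filter_mono inf_le_left, mem_inf_of_right (mem_principal_self _)]
            with w hw6 hw
          have hw' : 0 ≤ w.re := le_of_lt hw
          rw [one_mul, Real.norm_eq_abs, abs_of_pos (Real.exp_pos _)]
          refine (hle w hw').trans ?_
          simpa using hK (-w) (by simpa using hw6)
        · rw [tendsto_zero_iff_norm_tendsto_zero]
          have h0 : Tendsto (fun x : ℝ => (1 : ℝ) / (1 + x) ^ 2) atTop (nhds 0) := by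
            refine Tendsto.div_atTop tendsto_const_nhds ?_
            exact (tendsto_pow_atTop two_ne_zero).comp (tendsto_atTop_add_const_left _ _ tendsto_id)
          refine squeeze_zero' (Eventually.of_forall fun x => norm_nonneg _) ?_ h0
          filter_upwards [hsub a ha, eventually_ge_atTop 0] with x hx hx0
          rw [hGnorm]
          have h3 : ‖(1 : ℂ) + x‖ = 1 + x := by
            rw [← Complex.ofReal_one, ← Complex.ofReal_add, Complex.norm_real, Real.norm_eq_abs,
              abs_of_nonneg (by linarith)]
          rw [h3]
          gcongr
          rw [Complex.ofReal_re, Real.exp_neg, ← div_eq_mul_inv, div_le_one (Real.exp_pos _)]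
          exact hx
        · intro y
          rw [hGnorm]
          rcases eq_or_ne y 0 with rfl | hy
          · simp [hF0]
            positivity
          have hy' : -((y : ℂ) * I) ≠ 0 := by simpa using hy
          have h3 := norm_le_of_exterior_bound h1 hy' (by simp; norm_num)
          have h4 : ‖-((y : ℂ) * I)‖ = |y| := by simp
          have h5 : ‖-((y : ℂ) * I) + 1‖ ≤ |y| + 1 := by
            simpa [h4] using norm_add_le (-((y : ℂ) * I)) 1
          have h6 : ‖1 + (y : ℂ) * I‖ ^ 2 = 1 + |y| ^ 2 := by
            rw [← Complex.normSq_eq_norm_sq, Complex.normSq_apply]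
            simp
            ring
          rw [h6, div_le_iff₀ (by positivity)]
          rw [h4] at h3
          simp only [neg_re, mul_re, ofReal_re, I_re, mul_zero, ofReal_im, I_im, mul_one, sub_self,
            neg_zero, zero_add, div_one, Real.exp_zero] at h3 ⊢
          have h7 : |y| * (|y| + ‖-((y : ℂ) * I) + 1‖) ≤ 3 * (1 + |y| ^ 2) := by
            nlinarith [abs_nonneg y, sq_nonneg (|y| - 1)]
          calc _ ≤ C * (|y| * (|y| + ‖-((y : ℂ) * I) + 1‖)) := h3
            _ ≤ C * (3 * (1 + |y| ^ 2)) := by gcongr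
            _ = _ := by ring
      rw [hGnorm, div_le_iff₀] at hPL
      · simpa [sub_eq_add_neg] using hPL
      · have := hge (-s) (by simpa using hre)
        positivity
    have hlim : Tendsto (fun a : ℝ => ‖F s‖ * Real.exp (a * s.re)) (nhdsWithin 0 (Ioi 0))
        (nhds (‖F s‖ * Real.exp (0 * s.re))) := by
      apply Tendsto.mono_left _ nhdsWithin_le_nhds
      apply Continuous.tendsto
      fun_prop
    have := le_of_tendsto hlim (eventually_mem_nhdsWithin.mono key)
    rw [zero_mul, Real.exp_zero, mul_one] at this
    refine this.trans ?_
    gcongr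
    simpa using norm_sub_le 1 s

theorem eq_linear_of_subexponential {F : ℂ → ℂ} {C K : ℝ} (hF : Differentiable ℂ F)
    (hF0 : F 0 = 0) (hC : 0 < C)
    (h1 : ∀ z : ℂ, 1 < ‖z‖ → ‖F (z - 1)⁻¹‖ ≤ C / (‖z‖ - 1))
    (hK : ∀ s : ℂ, 6 ≤ ‖s‖ → ‖F s‖ ≤ Real.exp (K * ‖s‖ ^ (3 / 2 : ℝ)))
    (hsub : ∀ a : ℝ, 0 < a → ∀ᶠ x : ℝ in atTop, ‖F (-(x : ℂ))‖ ≤ Real.exp (a * x)) :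
    ∃ B : ℂ, ∀ s, F s = B * s := by
  set G := dslope F 0 with hG
  set H := dslope G 0 with hH
  have hGd : Differentiable ℂ G := by
    rw [← differentiableOn_univ] at hF ⊢
    exact (Complex.differentiableOn_dslope univ_mem).2 hF
  have hHd : Differentiable ℂ H := by
    rw [← differentiableOn_univ] at hGd ⊢
    exact (Complex.differentiableOn_dslope univ_mem).2 hGd
  have hFG : ∀ s, F s = s * G s := by
    intro s
    have := sub_smul_dslope F 0 s
    simpa [hF0] using this.symm
  have hGH : ∀ s, G s = G 0 + s * H s := by
    intro s
    have := sub_smul_dslope G 0 s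
    simp only [sub_zero, smul_eq_mul] at this
    rw [hH, this]
    ring
  have hbig : ∀ s, 1 ≤ ‖s‖ → ‖H s‖ ≤ 12 * C + ‖G 0‖ := by
    intro s hs
    have h3 := norm_le_of_exterior_bound_of_subexponential hF hF0 hC h1 hK hsub s
    have hsp : 0 < ‖s‖ := by linarith
    rw [hFG, norm_mul] at h3
    have h4 : ‖G s‖ ≤ 12 * C * ‖s‖ := by
      have : (1 + ‖s‖) ^ 2 ≤ 4 * ‖s‖ ^ 2 := by nlinarith
      have h5 : ‖s‖ * ‖G s‖ ≤ ‖s‖ * (12 * C * ‖s‖) := by nlinarith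
      exact le_of_mul_le_mul_left h5 hsp
    have h5 : s * H s = G s - G 0 := by
      rw [hGH s]
      ring
    have h6 : ‖s‖ * ‖H s‖ ≤ ‖s‖ * (12 * C + ‖G 0‖) := by
      rw [← norm_mul, h5]
      refine (norm_sub_le _ _).trans ?_
      nlinarith [norm_nonneg (G 0)]
    exact le_of_mul_le_mul_left h6 hsp
  have hbdd : Bornology.IsBounded (range H) := by
    obtain ⟨M, hM⟩ := (isCompact_closedBall (0 : ℂ) 1).exists_bound_of_continuousOn
      hHd.continuous.continuousOn
    rw [isBounded_iff_forall_norm_le]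
    refine ⟨max M (12 * C + ‖G 0‖), ?_⟩
    rintro _ ⟨s, rfl⟩
    rcases le_total ‖s‖ 1 with hs | hs
    · exact (hM s (by simpa using hs)).trans (le_max_left _ _)
    · exact (hbig s hs).trans (le_max_right _ _)
  have hreal : ∀ x : ℝ, 1 ≤ x → ‖H 0‖ ≤ (C + ‖G 0‖) / x := by
    intro x hx
    rw [hHd.apply_eq_apply_of_bounded hbdd 0 (x : ℂ)]
    have hx0 : (0 : ℝ) < x := by linarith
    have hxc : (x : ℂ) ≠ 0 := by exact_mod_cast hx0.ne'
    have h3 := norm_le_of_exterior_bound h1 hxc (by simp; linarith)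
    have h4 : ‖(x : ℂ)‖ = x := by simp [abs_of_pos hx0]
    have h5 : ‖(x : ℂ) + 1‖ = x + 1 := by
      rw [← Complex.ofReal_one, ← Complex.ofReal_add, Complex.norm_real, Real.norm_eq_abs,
        abs_of_nonneg (by linarith)]
    rw [h4, h5, Complex.ofReal_re, hFG, norm_mul, h4,
      show x * (x + (x + 1)) / (2 * x + 1) = x by field_simp; ring] at h3
    have h6 : ‖G x‖ ≤ C := by
      have : x * ‖G x‖ ≤ x * C := by linarith
      exact le_of_mul_le_mul_left this hx0
    rw [le_div_iff₀ hx0]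
    have h7 : (x : ℂ) * H x = G x - G 0 := by
      rw [hGH x]
      ring
    calc ‖H x‖ * x = ‖G x - G 0‖ := by rw [← h7, norm_mul, h4, mul_comm]
      _ ≤ ‖G x‖ + ‖G 0‖ := norm_sub_le _ _
      _ ≤ _ := by linarith
  have hlim : Tendsto (fun x : ℝ => (C + ‖G 0‖) / x) atTop (nhds 0) :=
    tendsto_const_nhds.div_atTop tendsto_id
  have hH0 : ‖H 0‖ ≤ 0 := ge_of_tendsto hlim ((eventually_ge_atTop 1).mono hreal)
  refine ⟨G 0, fun s => ?_⟩
  rw [hFG, hGH, hHd.apply_eq_apply_of_bounded hbdd s 0, norm_le_zero_iff.1 hH0]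
  ring

theorem norm_le_exp_of_mul_norm_le {h Ψ : ℂ → ℂ} {M : ℝ} (hM : 0 < M)
    (hh : AnalyticOnNhd ℂ h (ball 0 1)) (hh1 : ∀ z ∈ ball (0 : ℂ) 1, ‖h z‖ ≤ 1)
    (hΨ : AnalyticOnNhd ℂ Ψ (ball 0 (1 / 2))) (hΨ0 : Ψ 0 ≠ 0)
    (hb : ∀ z ∈ ball (0 : ℂ) (1 / 2), ‖h z‖ * ‖Ψ z‖ ≤ M) {ζ : ℂ} (hζ : ‖ζ‖ ≤ 1 / 8) :
    ‖h ζ‖ ≤ Real.exp (-(4 / 9 * (Real.log ‖Ψ 0‖ - Real.log M))) := by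
  rcases eq_or_ne (h ζ) 0 with h0 | h0
  · rw [h0, norm_zero]
    positivity
  have hζ1 : ζ ∈ ball (0 : ℂ) 1 := by
    rw [mem_ball_zero_iff]
    linarith
  have hsub : ball (0 : ℂ) (1 / 4) ⊆ ball ζ (3 / 8) := by
    apply ball_subset_ball'
    rw [dist_zero_left]
    linarith
  have hsub2 : ball ζ (3 / 8) ⊆ ball (0 : ℂ) 1 := by
    apply ball_subset_ball'
    rw [dist_zero_right]
    linarith
  have hsub3 : ball (0 : ℂ) (1 / 4) ⊆ ball (0 : ℂ) (1 / 2) := ball_subset_ball (by norm_num)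
  have hMc : (M : ℂ) ≠ 0 := by exact_mod_cast hM.ne'
  have hΨM : AnalyticOnNhd ℂ (fun z => Ψ z / M) (ball 0 (1 / 4)) :=
    (hΨ.mono hsub3).div analyticOnNhd_const fun _ _ => hMc
  have hnM : ‖(M : ℂ)‖ = M := by simp [abs_of_pos hM]
  have hA := ofReal_log_norm_le_lintegral_ball (by norm_num) hΨM
  have hB := lintegral_neg_log_norm_annulus_le (le_refl (0 : ℝ)) (by norm_num : (0 : ℝ) ≤ 3 / 8)
    (hh.mono hsub2) (fun z hz => hh1 z (hsub2 hz)) h0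
  have hAB : ENNReal.ofReal (Real.pi * (1 / 4) ^ 2 * Real.log ‖Ψ 0 / M‖) ≤
      ENNReal.ofReal (Real.pi * ((3 / 8) ^ 2 - 0 ^ 2) * (-Real.log ‖h ζ‖)) := by
    refine hA.trans (le_trans ?_ hB)
    rw [ball_zero, sdiff_empty]
    refine le_trans (setLIntegral_mono_ae' measurableSet_ball ?_) (lintegral_mono_set hsub)
    filter_upwards [ae_ne_zero_of_analytic_disc hh hζ1 h0] with z hz hzb
    apply ENNReal.ofReal_le_ofReal
    have hz1 : z ∈ ball (0 : ℂ) 1 := hsub2 (hsub hzb)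
    rcases eq_or_ne (Ψ z) 0 with hz0 | hz0
    · simpa [hz0] using Real.log_nonpos (norm_nonneg _) (hh1 z hz1)
    have hp1 : 0 < ‖h z‖ := norm_pos_iff.2 (hz hz1)
    have hp2 : 0 < ‖Ψ z‖ := norm_pos_iff.2 hz0
    have := Real.log_le_log (mul_pos hp1 hp2) (hb z (hsub3 hzb))
    rw [Real.log_mul hp1.ne' hp2.ne'] at this
    rw [norm_div, hnM, Real.log_div hp2.ne' hM.ne']
    linarith
  have hneg : 0 ≤ -Real.log ‖h ζ‖ :=
    neg_nonneg.2 (Real.log_nonpos (norm_nonneg _) (hh1 ζ hζ1))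
  rw [ENNReal.ofReal_le_ofReal_iff (mul_nonneg (by positivity) hneg), norm_div, hnM,
    Real.log_div (norm_ne_zero_iff.2 hΨ0) hM.ne', mul_assoc, mul_assoc] at hAB
  have h2 := le_of_mul_le_mul_left hAB Real.pi_pos
  rw [← Real.log_le_iff_le_exp (norm_pos_iff.2 h0)]
  linarith

theorem norm_le_pow_of_norm_le_on_closedBall {h : ℂ → ℂ} {N : ℕ}
    (hc : ContinuousOn h (closedBall 0 1)) (hd : DifferentiableOn ℂ h (ball 0 1))
    (h1 : ∀ z ∈ closedBall (0 : ℂ) 1, ‖h z‖ ≤ 1)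
    (hN : ∀ z : ℂ, ‖z‖ ≤ 1 / 8 → ‖h z‖ ≤ (1 / 8) ^ N) {ζ : ℂ} (hζ : 1 / 8 ≤ ‖ζ‖)
    (hζ1 : ‖ζ‖ ≤ 1) : ‖h ζ‖ ≤ ‖ζ‖ ^ N := by
  set U : Set ℂ := ball 0 1 \ closedBall 0 (1 / 8) with hU
  have hcl : closure U ⊆ closedBall 0 1 \ ball 0 (1 / 8) := by
    apply closure_minimal (sdiff_subset_sdiff ball_subset_closedBall ball_subset_closedBall)
    exact isClosed_closedBall.sdiff isOpen_ball
  have hne : ∀ z ∈ closedBall (0 : ℂ) 1 \ ball 0 (1 / 8), z ≠ 0 := by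
    rintro z hz rfl
    exact hz.2 (mem_ball_self (by norm_num))
  have hdc : DiffContOnCl ℂ (fun z => h z / z ^ N) U := by
    constructor
    · intro z hz
      have hzn : z ≠ 0 := hne z (hcl (subset_closure hz))
      have : DifferentiableAt ℂ h z := (hd z hz.1).differentiableAt (isOpen_ball.mem_nhds hz.1)
      have hpow : DifferentiableAt ℂ (fun z : ℂ => z ^ N) z := by fun_prop
      exact (this.div hpow (pow_ne_zero N hzn)).differentiableWithinAt
    · apply ContinuousOn.div (hc.mono fun z hz => (hcl hz).1) (by fun_prop)
      exact fun z hz => pow_ne_zero N (hne z (hcl hz))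
  have hmem : ∀ z : ℂ, 1 / 8 < ‖z‖ → ‖z‖ < 1 → z ∈ U := by
    intro z hz hz1
    refine ⟨by simpa using hz1, ?_⟩
    simpa using hz
  have hfr : ∀ z ∈ frontier U, ‖h z / z ^ N‖ ≤ 1 := by
    intro z hz
    have hzc := hcl hz.1
    have hopen : IsOpen U := isOpen_ball.sdiff isClosed_closedBall
    have hzU : z ∉ U := by
      rw [hopen.frontier_eq] at hz
      exact hz.2
    have h3 : ‖z‖ ≤ 1 := by simpa using hzc.1
    have h4 : 1 / 8 ≤ ‖z‖ := by simpa using hzc.2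
    rw [norm_div, norm_pow, div_le_one (pow_pos (by linarith) N)]
    rcases h4.eq_or_lt with h5 | h5
    · rw [← h5]
      exact hN z h5.symm.le
    · rcases h3.eq_or_lt with h6 | h6
      · rw [h6, one_pow]
        exact h1 z hzc.1
      · exact absurd (hmem z h5 h6) hzU
  rcases hζ.eq_or_lt with h5 | h5
  · rw [← h5]
    exact hN ζ h5.symm.le
  rcases hζ1.eq_or_lt with h6 | h6
  · rw [h6, one_pow]
    exact h1 ζ (by simpa using hζ1)
  have h7 := Complex.norm_le_of_forall_mem_frontier_norm_le
    ((isBounded_ball (x := (0 : ℂ)) (r := 1)).subset sdiff_subset) hdc hfr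
    (subset_closure (hmem ζ h5 h6))
  rwa [norm_div, norm_pow, div_le_one (pow_pos (by linarith) N)] at h7

theorem norm_sq_moebius (r : ℝ) (z : ℂ) :
    ‖1 + r * z‖ ^ 2 - ‖z + r‖ ^ 2 = (1 - r ^ 2) * (1 - ‖z‖ ^ 2) := by
  simp only [← Complex.normSq_eq_norm_sq, Complex.normSq_apply]
  simp
  ring

theorem norm_le_pow_of_large {F g : ℂ → ℂ} {C r : ℝ} {N : ℕ} (hF : Differentiable ℂ F)
    (hC : 0 < C) (hr0 : 0 < r) (hr1 : r < 1)
    (hgc : ContinuousOn g (closedBall 0 1)) (hg : DifferentiableOn ℂ g (ball 0 1))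
    (hg1 : ∀ z ∈ closedBall (0 : ℂ) 1, ‖g z‖ ≤ 1)
    (h2 : ∀ z ∈ ball (0 : ℂ) 1, ‖g z‖ * ‖F (z - 1)⁻¹‖ ≤ C / (1 - ‖z‖))
    (hF0 : F (r - 1)⁻¹ ≠ 0)
    (hN : Real.exp (-(4 / 9 * (Real.log ‖F (r - 1)⁻¹‖ - Real.log (6 * C / (1 - r))))) ≤
      (1 / 8) ^ N)
    {z : ℂ} (hz : ‖z‖ < 1) (hz8 : 1 / 8 ≤ ‖(z - r) / (1 - r * z)‖) :
    ‖g z‖ ≤ ‖(z - r) / (1 - r * z)‖ ^ N := by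
  have hrc : (1 : ℂ) - r ≠ 0 := by
    rw [← Complex.ofReal_one, ← Complex.ofReal_sub]
    exact_mod_cast (sub_pos.2 hr1).ne'
  set τ : ℂ → ℂ := fun ζ => (ζ + r) / (1 + r * ζ) with hτ
  have hden : ∀ ζ : ℂ, ‖ζ‖ ≤ 1 → 1 - r ≤ ‖1 + r * ζ‖ := by
    intro ζ hζ
    have h3 := norm_sub_norm_le (1 : ℂ) (-(r * ζ))
    rw [sub_neg_eq_add, norm_neg, norm_mul, norm_one, Complex.norm_real, Real.norm_eq_abs,
      abs_of_pos hr0] at h3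
    nlinarith
  have hden0 : ∀ ζ : ℂ, ‖ζ‖ ≤ 1 → 1 + r * ζ ≠ 0 := by
    intro ζ hζ
    exact norm_pos_iff.1 ((sub_pos.2 hr1).trans_le (hden ζ hζ))
  have hτsq : ∀ ζ : ℂ, ‖ζ‖ ≤ 1 →
      1 - ‖τ ζ‖ ^ 2 = (1 - r ^ 2) * (1 - ‖ζ‖ ^ 2) / ‖1 + r * ζ‖ ^ 2 := by
    intro ζ hζ
    have h3 : ‖1 + r * ζ‖ ≠ 0 := norm_ne_zero_iff.2 (hden0 ζ hζ)
    rw [← norm_sq_moebius, hτ, norm_div, div_pow, sub_div, div_self (pow_ne_zero 2 h3)]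
  have hr2 : 0 < 1 - r ^ 2 := by nlinarith
  have hτc : MapsTo τ (closedBall 0 1) (closedBall 0 1) := by
    intro ζ hζ
    rw [mem_closedBall_zero_iff] at hζ ⊢
    have h3 : 0 ≤ 1 - ‖τ ζ‖ ^ 2 := by
      rw [hτsq ζ hζ]
      have : 0 ≤ 1 - ‖ζ‖ ^ 2 := by nlinarith [norm_nonneg ζ]
      positivity
    nlinarith [norm_nonneg (τ ζ)]
  have hτb : MapsTo τ (ball 0 1) (ball 0 1) := by
    intro ζ hζ
    rw [mem_ball_zero_iff] at hζ ⊢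
    have h3 : 0 < 1 - ‖τ ζ‖ ^ 2 := by
      rw [hτsq ζ hζ.le]
      have h4 : 0 < 1 - ‖ζ‖ ^ 2 := by nlinarith [norm_nonneg ζ]
      have h5 : 0 < ‖1 + r * ζ‖ := norm_pos_iff.2 (hden0 ζ hζ.le)
      positivity
    nlinarith [norm_nonneg (τ ζ)]
  have hτd : ∀ ζ : ℂ, ‖ζ‖ ≤ 1 → DifferentiableAt ℂ τ ζ := by
    intro ζ hζ
    exact DifferentiableAt.div (by fun_prop) (by fun_prop) (hden0 ζ hζ)
  have hhc : ContinuousOn (g ∘ τ) (closedBall 0 1) :=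
    hgc.comp (fun ζ hζ => (hτd ζ (by simpa using hζ)).continuousAt.continuousWithinAt) hτc
  have hhd : DifferentiableOn ℂ (g ∘ τ) (ball 0 1) :=
    hg.comp (fun ζ hζ => (hτd ζ (by
      rw [mem_ball_zero_iff] at hζ
      exact hζ.le)).differentiableWithinAt) hτb
  have hΨ : AnalyticOnNhd ℂ (fun ζ => F (τ ζ - 1)⁻¹) (ball 0 (1 / 2)) := by
    apply DifferentiableOn.analyticOnNhd _ isOpen_ball
    intro ζ hζ
    rw [mem_ball_zero_iff] at hζ
    have hζ1 : ζ ∈ ball (0 : ℂ) 1 := by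
      rw [mem_ball_zero_iff]
      linarith
    have h3 : τ ζ - 1 ≠ 0 := by
      intro h
      have h4 := hτb hζ1
      rw [sub_eq_zero.1 h, mem_ball_zero_iff, norm_one] at h4
      exact lt_irrefl _ h4
    apply DifferentiableAt.differentiableWithinAt
    exact (hF _).comp ζ (((hτd ζ (by linarith)).sub_const 1).inv h3)
  have hb : ∀ ζ ∈ ball (0 : ℂ) (1 / 2), ‖(g ∘ τ) ζ‖ * ‖F (τ ζ - 1)⁻¹‖ ≤ 6 * C / (1 - r) := by
    intro ζ hζ
    rw [mem_ball_zero_iff] at hζ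
    have hζ1 : ζ ∈ ball (0 : ℂ) 1 := by
      rw [mem_ball_zero_iff]
      linarith
    have h3 := hτb hζ1
    refine (h2 _ h3).trans ?_
    rw [mem_ball_zero_iff] at h3
    rw [div_le_div_iff₀ (by linarith) (by linarith), mul_comm 6 C, mul_assoc]
    gcongr
    have h4 := hτsq ζ (by linarith)
    have h5 : ‖1 + r * ζ‖ ≤ 3 / 2 := by
      refine (norm_add_le _ _).trans ?_
      rw [norm_one, norm_mul, Complex.norm_real, Real.norm_eq_abs, abs_of_pos hr0]
      nlinarith [norm_nonneg ζ]
    have h6 : 0 < ‖1 + r * ζ‖ := norm_pos_iff.2 (hden0 ζ (by linarith))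
    have h7 : (1 - r) * (3 / 4) / (3 / 2) ^ 2 ≤ 1 - ‖τ ζ‖ ^ 2 := by
      rw [h4]
      have : 3 / 4 ≤ 1 - ‖ζ‖ ^ 2 := by nlinarith [norm_nonneg ζ]
      have : 1 - r ≤ 1 - r ^ 2 := by nlinarith
      gcongr
    have h8 : 1 - ‖τ ζ‖ ^ 2 ≤ 2 * (1 - ‖τ ζ‖) := by nlinarith [sq_nonneg (1 - ‖τ ζ‖)]
    have h9 : (1 - r) * (3 / 4) / (3 / 2) ^ 2 = (1 - r) / 3 := by ring
    rw [h9] at h7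
    linarith
  have hτ0 : τ 0 = r := by simp [hτ]
  have hsmall : ∀ ζ : ℂ, ‖ζ‖ ≤ 1 / 8 → ‖(g ∘ τ) ζ‖ ≤ (1 / 8) ^ N := by
    intro ζ hζ
    refine le_trans (norm_le_exp_of_mul_norm_le (div_pos (by positivity) (by linarith))
      (hhd.analyticOnNhd isOpen_ball)
      (fun z hz => hg1 _ (ball_subset_closedBall (hτb hz))) hΨ ?_ hb hζ) ?_
    · rw [hτ0]
      exact hF0
    · rw [hτ0]
      exact hN
  have hz1 : 1 - r * z ≠ 0 := by
    have := hden0 (-z) (by rw [norm_neg]; exact hz.le)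
    rwa [mul_neg, ← sub_eq_add_neg] at this
  have hζ1 : ‖(z - r) / (1 - r * z)‖ ≤ 1 := by
    have h3 := norm_sq_moebius r (-z)
    rw [norm_neg, mul_neg, ← sub_eq_add_neg, neg_add_eq_sub, norm_sub_rev (r : ℂ) z] at h3
    rw [norm_div, div_le_one (norm_pos_iff.2 hz1)]
    have h4 : 0 ≤ (1 - r ^ 2) * (1 - ‖z‖ ^ 2) :=
      mul_nonneg hr2.le (by nlinarith [norm_nonneg z])
    exact abs_le_of_sq_le_sq' (by linarith) (norm_nonneg _) |>.2
  have hτz : τ ((z - r) / (1 - r * z)) = z := by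
    have h3 : (1 : ℂ) - r ^ 2 ≠ 0 := by
      rw [← Complex.ofReal_one, ← Complex.ofReal_pow, ← Complex.ofReal_sub]
      exact_mod_cast hr2.ne'
    have h4 := hden0 _ hζ1
    rw [hτ]
    simp only
    rw [div_eq_iff h4]
    have h5 : (z - r) / (1 - r * z) * (1 - r * z) = z - r := div_mul_cancel₀ _ hz1
    apply mul_right_cancel₀ hz1
    linear_combination (1 - z * r) * h5
  have := norm_le_pow_of_norm_le_on_closedBall hhc hhd
    (fun z hz => hg1 _ (hτc hz)) hsmall hz8 hζ1
  rwa [Function.comp_apply, hτz] at this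

/-- The singular inner function with an atom of mass `a` at the point `p` of the circle. -/
def atomInner (a : ℝ) (p z : ℂ) : ℂ := Complex.exp (a * ((z + p) / (z - p)))

theorem norm_le_exp_poisson_of_frequently {F g : ℂ → ℂ} {C a : ℝ} (hF : Differentiable ℂ F)
    (hC : 0 < C) (ha : 0 < a)
    (hfreq : ∃ᶠ x : ℝ in atTop, Real.exp (a * x) < ‖F (-(x : ℂ))‖)
    (hgc : ContinuousOn g (closedBall 0 1)) (hg : DifferentiableOn ℂ g (ball 0 1))
    (hg1 : ∀ z ∈ closedBall (0 : ℂ) 1, ‖g z‖ ≤ 1)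
    (h2 : ∀ z ∈ ball (0 : ℂ) 1, ‖g z‖ * ‖F (z - 1)⁻¹‖ ≤ C / (1 - ‖z‖))
    {z : ℂ} (hz : z ∈ ball (0 : ℂ) 1) :
    ‖g z‖ ≤ Real.exp (-(a / (4 * Real.log 8) * ((1 - ‖z‖ ^ 2) / ‖1 - z‖ ^ 2))) := by
  have hz' : ‖z‖ < 1 := by simpa using hz
  have hlog8 : 0 < Real.log 8 := Real.log_pos (by norm_num)
  set b : ℝ := a / (4 * Real.log 8) with hb
  have hbpos : 0 < b := by positivity
  set r : ℝ → ℝ := fun x => 1 - x⁻¹ with hr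
  have hr1 : Tendsto r atTop (nhds 1) := by
    simpa using tendsto_inv_atTop_zero.const_sub (1 : ℝ)
  set q : ℝ → ℝ := fun x => (1 - ‖z‖ ^ 2) / ‖1 - r x * z‖ ^ 2 with hq
  have h1z : 1 - z ≠ 0 := by
    intro h
    rw [← sub_eq_zero.1 h, norm_one] at hz'
    exact lt_irrefl _ hz'
  have hqlim : Tendsto q atTop (nhds ((1 - ‖z‖ ^ 2) / ‖1 - z‖ ^ 2)) := by
    apply Tendsto.div tendsto_const_nhds
    · have : Tendsto (fun x => (1 : ℂ) - r x * z) atTop (nhds (1 - (1 : ℝ) * z)) :=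
        tendsto_const_nhds.sub (((Complex.continuous_ofReal.tendsto 1).comp hr1).mul_const z)
      simpa using (this.norm.pow 2)
    · exact pow_ne_zero 2 (norm_ne_zero_iff.2 h1z)
  have hinv : Tendsto (fun x : ℝ => x⁻¹) atTop (nhds 0) := tendsto_inv_atTop_zero
  set B : ℝ → ℝ := fun x => Real.exp (-((b - x⁻¹) * (2 - x⁻¹) * q x)) with hB
  have hBlim : Tendsto B atTop
      (nhds (Real.exp (-((b - 0) * (2 - 0) * ((1 - ‖z‖ ^ 2) / ‖1 - z‖ ^ 2))))) := by
    apply (Real.continuous_exp.tendsto _).comp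
    exact (((hinv.const_sub b).mul (hinv.const_sub 2)).mul hqlim).neg
  have hsq : ‖g z‖ ^ 2 ≤ Real.exp (-((b - 0) * (2 - 0) * ((1 - ‖z‖ ^ 2) / ‖1 - z‖ ^ 2))) := by
    refine ge_of_tendsto_of_frequently hBlim ?_
    have hev1 : ∀ᶠ x : ℝ in atTop, 1 < x := eventually_gt_atTop 1
    have hev2 : ∀ᶠ x : ℝ in atTop, Real.log (6 * C * x) ≤ 7 / 16 * a * x := by
      have hlo : Tendsto (fun x : ℝ => Real.log x / x) atTop (nhds 0) := by
        simpa using (Real.isLittleO_log_id_atTop).tendsto_div_nhds_zero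
      have hlim0 : Tendsto (fun x : ℝ => Real.log (6 * C) * x⁻¹ + Real.log x / x) atTop
          (nhds (Real.log (6 * C) * 0 + 0)) := (hinv.const_mul _).add hlo
      rw [mul_zero, add_zero] at hlim0
      filter_upwards [hlim0.eventually (eventually_le_nhds (show 0 < 7 / 16 * a by positivity)),
        hev1] with x hx hx1
      have hx0 : 0 < x := by linarith
      rw [Real.log_mul (by positivity) hx0.ne']
      have h4 : Real.log (6 * C) + Real.log x =
          (Real.log (6 * C) * x⁻¹ + Real.log x / x) * x := by field_simp
      rw [h4]
      gcongr
    have hev3 : ∀ᶠ x : ℝ in atTop, (1 - r x ^ 2) * q x ≤ 63 / 64 := by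
      have hlim0 : Tendsto (fun x => (1 - r x ^ 2) * q x) atTop
          (nhds ((1 - 1 ^ 2) * ((1 - ‖z‖ ^ 2) / ‖1 - z‖ ^ 2))) :=
        ((hr1.pow 2).const_sub 1).mul hqlim
      rw [one_pow, sub_self, zero_mul] at hlim0
      exact hlim0.eventually (eventually_le_nhds (by norm_num))
    refine (hfreq.and_eventually (hev1.and (hev2.and hev3))).mono ?_
    rintro x ⟨hxF, hx1, hxlog, hx3⟩
    have hx0 : 0 < x := by linarith
    have hxinv : 0 < x⁻¹ ∧ x⁻¹ < 1 := ⟨by positivity, inv_lt_one_of_one_lt₀ hx1⟩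
    have hrx : ((r x : ℂ) - 1)⁻¹ = -(x : ℂ) := by
      simp [hr]
    have h1r : 1 - r x = x⁻¹ := by simp [hr]
    set N : ℕ := ⌊b * x⌋₊ with hN
    have hNle : (N : ℝ) ≤ b * x := Nat.floor_le (by positivity)
    have hNge : b * x - 1 ≤ N := by
      have := Nat.lt_floor_add_one (b * x)
      rw [← hN] at this
      linarith
    have hrx0 : 0 < r x := by
      simp only [hr]
      linarith [hxinv.2]
    have hrx1 : r x < 1 := by
      simp only [hr]
      linarith [hxinv.1]
    have hFne : F (-(x : ℂ)) ≠ 0 := norm_pos_iff.1 ((Real.exp_pos _).trans hxF)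
    have hζsq : ‖(z - r x) / (1 - r x * z)‖ ^ 2 = 1 - (1 - r x ^ 2) * q x := by
      have h3 := norm_sq_moebius (r x) (-z)
      have h5 : 0 < ‖1 - r x * z‖ := by
        have h6 := norm_sub_norm_le (1 : ℂ) (r x * z)
        rw [norm_mul, norm_one, Complex.norm_real, Real.norm_eq_abs, abs_of_pos hrx0] at h6
        nlinarith [norm_nonneg z]
      rw [norm_neg, mul_neg, ← sub_eq_add_neg, neg_add_eq_sub, norm_sub_rev (r x : ℂ) z] at h3
      have h4 : ‖z - r x‖ ^ 2 = ‖1 - r x * z‖ ^ 2 - (1 - r x ^ 2) * (1 - ‖z‖ ^ 2) := by linarith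
      rw [norm_div, div_pow, h4, sub_div, div_self (pow_ne_zero 2 h5.ne'), hq, mul_div_assoc]
    have hz8 : 1 / 8 ≤ ‖(z - r x) / (1 - r x * z)‖ := by
      refine le_of_sq_le_sq ?_ (norm_nonneg _)
      rw [hζsq]
      norm_num
      linarith
    have hmain := norm_le_pow_of_large (N := N) hF hC hrx0 hrx1 hgc hg hg1 h2
      (by rw [hrx]; exact hFne) (by
        rw [hrx, h1r, div_inv_eq_mul]
        have h3 : a * x < Real.log ‖F (-(x : ℂ))‖ :=
          (Real.lt_log_iff_exp_lt (norm_pos_iff.2 hFne)).2 hxF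
        rw [← Real.le_log_iff_exp_le (by positivity), Real.log_pow, Real.log_div (by norm_num)
          (by norm_num), Real.log_one, zero_sub]
        have h4 : (N : ℝ) * Real.log 8 ≤ a * x / 4 := by
          calc (N : ℝ) * Real.log 8 ≤ b * x * Real.log 8 := by gcongr
            _ = a * x / 4 := by
              rw [hb]
              field_simp
        linarith) hz' hz8
    have hsq' : ‖g z‖ ^ 2 ≤ (‖(z - r x) / (1 - r x * z)‖ ^ 2) ^ N := by
      calc ‖g z‖ ^ 2 ≤ (‖(z - r x) / (1 - r x * z)‖ ^ N) ^ 2 :=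
            pow_le_pow_left₀ (norm_nonneg _) hmain 2
        _ = (‖(z - r x) / (1 - r x * z)‖ ^ 2) ^ N := by rw [← pow_mul, ← pow_mul, mul_comm N]
    refine hsq'.trans ?_
    have h5 : ‖(z - r x) / (1 - r x * z)‖ ^ 2 ≤ Real.exp (-((1 - r x ^ 2) * q x)) := by
      rw [hζsq]
      linarith [Real.add_one_le_exp (-((1 - r x ^ 2) * q x))]
    have hq0 : 0 ≤ q x := div_nonneg (by nlinarith [norm_nonneg z]) (by positivity)
    calc (‖(z - r x) / (1 - r x * z)‖ ^ 2) ^ N ≤ Real.exp (-((1 - r x ^ 2) * q x)) ^ N := by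
          gcongr
      _ = Real.exp (-(N * (1 - r x ^ 2) * q x)) := by
          rw [← Real.exp_nat_mul]
          congr 1
          ring
      _ ≤ B x := by
          rw [hB]
          apply Real.exp_le_exp.2
          apply neg_le_neg
          have h6 : 1 - r x ^ 2 = x⁻¹ * (2 - x⁻¹) := by
            simp only [hr]
            ring
          have h7 : b - x⁻¹ ≤ N * x⁻¹ := by
            calc b - x⁻¹ = (b * x - 1) * x⁻¹ := by field_simp
              _ ≤ N * x⁻¹ := mul_le_mul_of_nonneg_right hNge hxinv.1.le
          have h8 : 0 ≤ 2 - x⁻¹ := by linarith [hxinv.2]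
          refine mul_le_mul_of_nonneg_right ?_ hq0
          rw [h6, ← mul_assoc]
          exact mul_le_mul_of_nonneg_right h7 h8
  refine le_of_sq_le_sq (hsq.trans_eq ?_) (Real.exp_pos _).le
  rw [← Real.exp_nat_mul]
  congr 1
  push_cast
  ring

/-- Dichotomy for an entire function `F` of `1 / (z - 1)` controlled outside the disc and, after
multiplication by functions of a given class, inside the disc: either `F` is linear, or all
functions of the class decay like an atomic singular inner function at `1`. -/
theorem linear_or_poisson_decay {F : ℂ → ℂ} {G : Set (ℂ → ℂ)} (hF : Differentiable ℂ F)
    (hF0 : F 0 = 0) {C₀ : ℝ} (h1 : ∀ z, 1 < ‖z‖ → ‖F (z - 1)⁻¹‖ ≤ C₀ / (‖z‖ - 1))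
    (hG : ∀ g ∈ G, ContinuousOn g (closedBall 0 1) ∧ DifferentiableOn ℂ g (ball 0 1) ∧
      (∀ z ∈ closedBall (0 : ℂ) 1, ‖g z‖ ≤ 1) ∧
      ∃ C, ∀ z ∈ ball (0 : ℂ) 1, ‖g z‖ * ‖F (z - 1)⁻¹‖ ≤ C / (1 - ‖z‖))
    (hG0 : ∃ g ∈ G, g 0 ≠ 0) :
    (∃ B, ∀ s, F s = B * s) ∨ ∃ c > 0, ∀ g ∈ G, ∀ z ∈ ball (0 : ℂ) 1,
      ‖g z‖ ≤ Real.exp (-(c * ((1 - ‖z‖ ^ 2) / ‖1 - z‖ ^ 2))) := by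
  have key : ∀ C : ℝ, ∃ D : ℝ, 0 < D ∧ C₀ ≤ D ∧ C ≤ D := fun C =>
    ⟨max 1 (max C₀ C), by positivity, by simp, by simp⟩
  by_cases hsub : ∀ a : ℝ, 0 < a → ∀ᶠ x : ℝ in atTop, ‖F (-(x : ℂ))‖ ≤ Real.exp (a * x)
  · left
    obtain ⟨g, hg, hg0⟩ := hG0
    obtain ⟨-, hgd, hg1, C, hC⟩ := hG g hg
    obtain ⟨D, hD, hD0, hDC⟩ := key C
    have h1' : ∀ z, 1 < ‖z‖ → ‖F (z - 1)⁻¹‖ ≤ D / (‖z‖ - 1) := fun z hz =>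
      (h1 z hz).trans (div_le_div_of_nonneg_right hD0 (by linarith))
    obtain ⟨K, hK⟩ := exists_growth_bound hF hD h1' hgd
      (fun z hz => hg1 z (ball_subset_closedBall hz)) hg0 (fun z hz => (hC z hz).trans
        (div_le_div_of_nonneg_right hDC (by
          have : ‖z‖ < 1 := by simpa using hz
          linarith)))
    exact eq_linear_of_subexponential hF hF0 hD h1' hK hsub
  · right
    push Not at hsub
    obtain ⟨a, ha, hfreq⟩ := hsub
    refine ⟨a / (4 * Real.log 8), div_pos ha (mul_pos (by norm_num)
      (Real.log_pos (by norm_num))), fun g hg z hz => ?_⟩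
    obtain ⟨hgc, hgd, hg1, C, hC⟩ := hG g hg
    obtain ⟨D, hD, hD0, hDC⟩ := key C
    exact norm_le_exp_poisson_of_frequently hF hD ha hfreq hgc hgd hg1 (fun z hz =>
      (hC z hz).trans (div_le_div_of_nonneg_right hDC (by
        have : ‖z‖ < 1 := by simpa using hz
        linarith))) hz

theorem resolvent_mul_cancel {𝓑 : Type*} [NormedRing 𝓑] [NormedAlgebra ℂ 𝓑] {T : 𝓑} {μ : ℂ}
    (h : μ ∈ resolventSet ℂ T) : (algebraMap ℂ 𝓑 μ - T) * resolvent T μ = 1 :=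
  Ring.mul_inverse_cancel _ h

theorem clm_circleIntegral {E F : Type*} [NormedAddCommGroup E] [NormedSpace ℂ E] [CompleteSpace E]
    [NormedAddCommGroup F] [NormedSpace ℂ F] [CompleteSpace F] (L : E →L[ℂ] F) {f : ℂ → E} {c : ℂ}
    {R : ℝ} (hf : CircleIntegrable f c R) :
    L (∮ z in C(c, R), f z) = ∮ z in C(c, R), L (f z) := by
  rw [circleIntegral, circleIntegral, ← L.intervalIntegral_comp_comm hf.out]
  simp only [map_smul]

/-- The coefficients of the singular part at `1` of the resolvent of `T`, computed on the circle
of radius `r`. -/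
def resolventCoeff {𝓑 : Type*} [NormedRing 𝓑] [NormedAlgebra ℂ 𝓑] (T : 𝓑) (r : ℝ) (n : ℕ) : 𝓑 :=
  (2 * Real.pi * Complex.I : ℂ)⁻¹ • ∮ z in C(1, r), (z - 1) ^ n • resolvent T z

section ResolventCoeff

variable {𝓑 : Type*} [NormedRing 𝓑] [NormedAlgebra ℂ 𝓑] [CompleteSpace 𝓑] {T : 𝓑} {ρ : ℝ}

theorem continuousOn_smul_resolvent
    (hres : ∀ μ : ℂ, μ ≠ 1 → ‖μ - 1‖ ≤ ρ → μ ∈ resolventSet ℂ T) (n : ℕ) :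
    ContinuousOn (fun z : ℂ => (z - 1) ^ n • resolvent T z) (closedBall 1 ρ \ {1}) := by
  intro z hz
  have hz' : z ∈ resolventSet ℂ T := hres z hz.2 (by simpa [dist_eq_norm] using hz.1)
  exact ((by fun_prop : ContinuousAt (fun z : ℂ => (z - 1) ^ n) z).smul
    (spectrum.hasDerivAt_resolvent_const_left hz').continuousAt).continuousWithinAt

theorem circleIntegrable_smul_resolvent
    (hres : ∀ μ : ℂ, μ ≠ 1 → ‖μ - 1‖ ≤ ρ → μ ∈ resolventSet ℂ T) {r : ℝ} (hr : 0 < r)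
    (hrρ : r ≤ ρ) (n : ℕ) :
    CircleIntegrable (fun z : ℂ => (z - 1) ^ n • resolvent T z) 1 r := by
  refine ContinuousOn.circleIntegrable hr.le ((continuousOn_smul_resolvent hres n).mono ?_)
  intro z hz
  have hz' : ‖z - 1‖ = r := by simpa [dist_eq_norm] using hz
  refine ⟨by simpa [dist_eq_norm, hz'] using hrρ, ?_⟩
  rintro rfl
  simp at hz'
  linarith

theorem resolventCoeff_eq_of_le
    (hres : ∀ μ : ℂ, μ ≠ 1 → ‖μ - 1‖ ≤ ρ → μ ∈ resolventSet ℂ T) {r : ℝ} (hr : 0 < r)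
    (hrρ : r ≤ ρ) (n : ℕ) : resolventCoeff T r n = resolventCoeff T ρ n := by
  unfold resolventCoeff
  congr 1
  refine (Complex.circleIntegral_eq_of_differentiable_on_annulus_off_countable hr hrρ
    countable_empty ((continuousOn_smul_resolvent hres n).mono ?_) fun z hz => ?_).symm
  · rintro z ⟨hz1, hz2⟩
    refine ⟨hz1, ?_⟩
    rintro rfl
    exact hz2 (mem_ball_self hr)
  · have hz1 : z ≠ 1 := by
      rintro rfl
      exact hz.1.2 (mem_closedBall_self hr.le)
    have hz' : z ∈ resolventSet ℂ T := hres z hz1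
      (by simpa [dist_eq_norm] using (ball_subset_closedBall hz.1.1))
    exact (by fun_prop : DifferentiableAt ℂ (fun z : ℂ => (z - 1) ^ n) z).smul
      (spectrum.hasDerivAt_resolvent_const_left hz').differentiableAt

theorem sub_one_mul_resolventCoeff
    (hres : ∀ μ : ℂ, μ ≠ 1 → ‖μ - 1‖ ≤ ρ → μ ∈ resolventSet ℂ T) (hρ : 0 < ρ) (n : ℕ) :
    (T - 1) * resolventCoeff T ρ n = resolventCoeff T ρ (n + 1) := by
  unfold resolventCoeff
  rw [mul_smul_comm]
  congr 1
  have hci := circleIntegrable_smul_resolvent hres hρ le_rfl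
  have h1 := clm_circleIntegral (ContinuousLinearMap.mul ℂ 𝓑 (T - 1)) (hci n)
  simp only [ContinuousLinearMap.mul_apply'] at h1
  rw [h1]
  have hconst : ContinuousOn (fun z : ℂ => (z - 1) ^ n • (1 : 𝓑)) (sphere 1 ρ) := by fun_prop
  have h2 : ∮ z in C(1, ρ), (z - 1) ^ n • (1 : 𝓑) = 0 := by
    refine DiffContOnCl.circleIntegral_eq_zero hρ.le (Differentiable.diffContOnCl ?_)
    fun_prop
  have h3 := circleIntegral.integral_sub (hci (n + 1)) (hconst.circleIntegrable hρ.le)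
  rw [h2, sub_zero] at h3
  rw [← h3]
  refine circleIntegral.integral_congr hρ.le fun z hz => ?_
  have hz' : ‖z - 1‖ = ρ := by simpa [dist_eq_norm] using hz
  have hz1 : z ≠ 1 := by
    rintro rfl
    simp at hz'
    linarith
  have h4 := resolvent_mul_cancel (hres z hz1 hz'.le)
  have h5 : (T - 1) * resolvent T z = (z - 1) • resolvent T z - 1 := by
    rw [sub_mul, ← Algebra.smul_def] at h4
    rw [sub_mul, one_mul, sub_smul, one_smul, ← h4]
    abel
  rw [mul_smul_comm, h5, smul_sub, smul_smul, pow_succ]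

theorem exists_norm_resolventCoeff_le
    (hres : ∀ μ : ℂ, μ ≠ 1 → ‖μ - 1‖ ≤ ρ → μ ∈ resolventSet ℂ T) {r : ℝ} (hr : 0 < r)
    (hrρ : r ≤ ρ) : ∃ C : ℝ, 0 ≤ C ∧ ∀ n, ‖resolventCoeff T ρ n‖ ≤ C * r ^ n := by
  have hsub : sphere (1 : ℂ) r ⊆ closedBall 1 ρ \ {1} := by
    intro z hz
    have hz' : ‖z - 1‖ = r := by simpa [dist_eq_norm] using hz
    refine ⟨by simpa [dist_eq_norm, hz'] using hrρ, ?_⟩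
    rintro rfl
    simp at hz'
    linarith
  obtain ⟨C, hC⟩ := (isCompact_sphere (1 : ℂ) r).exists_bound_of_continuousOn
    ((continuousOn_smul_resolvent hres 0).mono hsub)
  refine ⟨r * max C 0, by positivity, fun n => ?_⟩
  rw [← resolventCoeff_eq_of_le hres hr hrρ]
  refine (circleIntegral.norm_two_pi_i_inv_smul_integral_le_of_norm_le_const hr.le
    (C := r ^ n * max C 0) fun z hz => ?_).trans_eq (by ring)
  have hz' : ‖z - 1‖ = r := by simpa [dist_eq_norm] using hz
  have h := hC z hz
  simp only [pow_zero, one_smul] at h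
  rw [norm_smul, norm_pow, hz']
  exact mul_le_mul_of_nonneg_left (h.trans (le_max_left _ _)) (by positivity)

/-- The singular part at `1` of the resolvent, as a function of `s = 1 / (λ - 1)`. -/
def resolventSingular (T : 𝓑) (ρ : ℝ) (s : ℂ) : 𝓑 := ∑' n, s ^ (n + 1) • resolventCoeff T ρ n

theorem exists_summable_bound
    (hres : ∀ μ : ℂ, μ ≠ 1 → ‖μ - 1‖ ≤ ρ → μ ∈ resolventSet ℂ T) (hρ : 0 < ρ) (R : ℝ) :
    ∃ u : ℕ → ℝ, Summable u ∧ ∀ n, ∀ s : ℂ, ‖s‖ ≤ R →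
      ‖s ^ (n + 1) • resolventCoeff T ρ n‖ ≤ u n := by
  obtain ⟨R', hR', hR'0⟩ : ∃ R', R ≤ R' ∧ 0 < R' := ⟨max R 1, by simp, by positivity⟩
  set r := min ρ (1 / (2 * R')) with hr
  have hr0 : 0 < r := by positivity
  obtain ⟨C, hC0, hC⟩ := exists_norm_resolventCoeff_le hres hr0 (min_le_left _ _)
  have hrR : R' * r ≤ 1 / 2 := by
    calc R' * r ≤ R' * (1 / (2 * R')) := by gcongr; exact min_le_right _ _
      _ = 1 / 2 := by field_simp
  refine ⟨fun n => R' * C * (1 / 2) ^ n, (summable_geometric_of_lt_one (by norm_num)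
    (by norm_num)).mul_left _, fun n s hs => ?_⟩
  rw [norm_smul, norm_pow]
  calc ‖s‖ ^ (n + 1) * ‖resolventCoeff T ρ n‖ ≤ R' ^ (n + 1) * (C * r ^ n) := by
        gcongr
        · exact hs.trans hR'
        · exact hC n
    _ = R' * C * (R' * r) ^ n := by ring
    _ ≤ R' * C * (1 / 2) ^ n := by gcongr

theorem summable_resolventSingular
    (hres : ∀ μ : ℂ, μ ≠ 1 → ‖μ - 1‖ ≤ ρ → μ ∈ resolventSet ℂ T) (hρ : 0 < ρ) (s : ℂ) :
    Summable fun n => s ^ (n + 1) • resolventCoeff T ρ n := by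
  obtain ⟨u, hu, h⟩ := exists_summable_bound hres hρ ‖s‖
  exact Summable.of_norm_bounded hu fun n => h n s le_rfl

theorem differentiable_resolventSingular
    (hres : ∀ μ : ℂ, μ ≠ 1 → ‖μ - 1‖ ≤ ρ → μ ∈ resolventSet ℂ T) (hρ : 0 < ρ) :
    Differentiable ℂ (resolventSingular T ρ) := by
  intro s
  obtain ⟨u, hu, h⟩ := exists_summable_bound hres hρ (‖s‖ + 1)
  have := differentiableOn_tsum_of_summable_norm (U := ball (0 : ℂ) (‖s‖ + 1))
    (F := fun n s => s ^ (n + 1) • resolventCoeff T ρ n) hu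
    (fun n => by fun_prop) isOpen_ball (fun n w hw => h n w (by
      have : ‖w‖ < ‖s‖ + 1 := by simpa using hw
      exact this.le))
  exact this.differentiableAt (isOpen_ball.mem_nhds (by simp))

theorem sub_mul_resolventSingular
    (hres : ∀ μ : ℂ, μ ≠ 1 → ‖μ - 1‖ ≤ ρ → μ ∈ resolventSet ℂ T) (hρ : 0 < ρ) {l : ℂ}
    (hl : l ≠ 1) :
    (algebraMap ℂ 𝓑 l - T) * resolventSingular T ρ (l - 1)⁻¹ = resolventCoeff T ρ 0 := by
  have hl' : l - 1 ≠ 0 := sub_ne_zero.2 hl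
  have hs := summable_resolventSingular hres hρ (l - 1)⁻¹
  have h1 : (l - 1) • resolventSingular T ρ (l - 1)⁻¹ =
      ∑' n, ((l - 1)⁻¹) ^ n • resolventCoeff T ρ n := by
    rw [resolventSingular, ← hs.tsum_const_smul]
    congr 1
    ext1 n
    rw [smul_smul, pow_succ', ← mul_assoc, mul_inv_cancel₀ hl', one_mul]
  have h2 : (T - 1) * resolventSingular T ρ (l - 1)⁻¹ =
      ∑' n, ((l - 1)⁻¹) ^ (n + 1) • resolventCoeff T ρ (n + 1) := by
    rw [resolventSingular, ← hs.tsum_mul_left]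
    congr 1
    ext1 n
    rw [mul_smul_comm, sub_one_mul_resolventCoeff hres hρ]
  have h3 : Summable fun n => ((l - 1)⁻¹) ^ n • resolventCoeff T ρ n := by
    refine (hs.const_smul (l - 1)).congr fun n => ?_
    rw [smul_smul, pow_succ', ← mul_assoc, mul_inv_cancel₀ hl', one_mul]
  have h4 : algebraMap ℂ 𝓑 l - T = algebraMap ℂ 𝓑 (l - 1) - (T - 1) := by
    rw [map_sub, map_one]
    abel
  rw [h4, sub_mul, ← Algebra.smul_def, h1, h2, h3.tsum_eq_zero_add]
  simp

end ResolventCoeff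

theorem resolventSingular_zero {𝓑 : Type*} [NormedRing 𝓑] [NormedAlgebra ℂ 𝓑] (T : 𝓑) (ρ : ℝ) :
    resolventSingular T ρ 0 = 0 := by
  simp [resolventSingular]

theorem norm_coeff_mul_pow_le (a : ℕ → ℂ) (n : ℕ) {z : ℂ} (hz : z ∈ closedBall (0 : ℂ) 1) :
    ‖a n * z ^ n‖ ≤ ‖a n‖ := by
  rw [norm_mul, norm_pow]
  exact mul_le_of_le_one_right (norm_nonneg _)
    (pow_le_one₀ (norm_nonneg _) (by simpa using hz))

theorem summable_coeff_mul_pow {a : ℕ → ℂ} (ha : Summable fun n => ‖a n‖) {z : ℂ}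
    (hz : z ∈ closedBall (0 : ℂ) 1) : Summable fun n => a n * z ^ n :=
  Summable.of_norm_bounded ha fun n => norm_coeff_mul_pow_le a n hz

theorem continuousOn_tsum_coeff {a : ℕ → ℂ} (ha : Summable fun n => ‖a n‖) :
    ContinuousOn (fun z => ∑' n, a n * z ^ n) (closedBall 0 1) :=
  continuousOn_tsum (fun n => by fun_prop) ha fun n _ hz => norm_coeff_mul_pow_le a n hz

theorem differentiableOn_tsum_coeff {a : ℕ → ℂ} (ha : Summable fun n => ‖a n‖) :
    DifferentiableOn ℂ (fun z => ∑' n, a n * z ^ n) (ball 0 1) :=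
  differentiableOn_tsum_of_summable_norm ha (fun n => by fun_prop) isOpen_ball
    fun n _ hz => norm_coeff_mul_pow_le a n (ball_subset_closedBall hz)

section Resolvent

variable {𝓑 : Type*} [NormedRing 𝓑] [NormedAlgebra ℂ 𝓑] [CompleteSpace 𝓑] {T : 𝓑} {ρ : ℝ}

theorem norm_resolventSingular_le_of_one_lt (hT : ‖T‖ ≤ 1)
    (hres : ∀ μ : ℂ, μ ≠ 1 → ‖μ - 1‖ ≤ ρ → μ ∈ resolventSet ℂ T) (hρ : 0 < ρ) {z : ℂ}
    (hz : 1 < ‖z‖) :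
    ‖resolventSingular T ρ (z - 1)⁻¹‖ ≤ ‖resolventCoeff T ρ 0‖ / (‖z‖ - 1) := by
  have hz1 : z ≠ 1 := by
    rintro rfl
    simp at hz
  rw [le_div_iff₀ (by linarith), ← sub_mul_resolventSingular hres hρ hz1, sub_mul,
    ← Algebra.smul_def]
  have h1 := norm_sub_norm_le (z • resolventSingular T ρ (z - 1)⁻¹)
    (T * resolventSingular T ρ (z - 1)⁻¹)
  have h2 : ‖T * resolventSingular T ρ (z - 1)⁻¹‖ ≤ ‖resolventSingular T ρ (z - 1)⁻¹‖ :=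
    (norm_mul_le _ _).trans (mul_le_of_le_one_left (norm_nonneg _) hT)
  rw [norm_smul] at h1
  linarith

theorem norm_mul_norm_resolventSingular_le [NormOneClass 𝓑] (hT : ‖T‖ ≤ 1)
    (hres : ∀ μ : ℂ, μ ≠ 1 → ‖μ - 1‖ ≤ ρ → μ ∈ resolventSet ℂ T) (hρ : 0 < ρ) {a : ℕ → ℂ}
    (ha : Summable fun n => ‖a n‖) (haT : ∑' n, a n • T ^ n = 0) {z : ℂ}
    (hz : z ∈ ball (0 : ℂ) 1) :
    ‖∑' n, a n * z ^ n‖ * ‖resolventSingular T ρ (z - 1)⁻¹‖ ≤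
      (∑' n, ‖a n‖) * ‖resolventCoeff T ρ 0‖ / (1 - ‖z‖) := by
  have hz' : ‖z‖ < 1 := by simpa using hz
  have hz1 : z ≠ 1 := by
    rintro rfl
    simp at hz'
  have hTn : ∀ n, ‖T ^ n‖ ≤ 1 := fun n =>
    (norm_pow_le T n).trans (pow_le_one₀ (norm_nonneg _) hT)
  set U := resolventSingular T ρ (z - 1)⁻¹ with hU
  set Q : ℕ → 𝓑 := fun n =>
    ∑ i ∈ Finset.range n, (algebraMap ℂ 𝓑 z) ^ i * T ^ (n - 1 - i) with hQ
  have hQn : ∀ n, ‖Q n‖ ≤ (1 - ‖z‖)⁻¹ := by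
    intro n
    calc ‖Q n‖ ≤ ∑ i ∈ Finset.range n, ‖z‖ ^ i := by
          refine norm_sum_le_of_le _ fun i _ => ?_
          rw [← map_pow, ← Algebra.smul_def, norm_smul, norm_pow]
          exact mul_le_of_le_one_right (by positivity) (hTn _)
      _ ≤ ∑' i, ‖z‖ ^ i :=
          (summable_geometric_of_lt_one (norm_nonneg _) hz').sum_le_tsum _
            fun i _ => by positivity
      _ = (1 - ‖z‖)⁻¹ := tsum_geometric_of_lt_one (norm_nonneg _) hz'
  have hQU : ∀ n, z ^ n • U - T ^ n * U = Q n * resolventCoeff T ρ 0 := by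
    intro n
    rw [← sub_mul_resolventSingular hres hρ hz1, ← mul_assoc, hQ,
      (show Commute (algebraMap ℂ 𝓑 z) T from Algebra.commutes z T).geom_sum₂_mul, sub_mul, ← map_pow,
      ← Algebra.smul_def]
  have hs1 : Summable fun n => a n * z ^ n :=
    summable_coeff_mul_pow ha (ball_subset_closedBall hz)
  have hs2 : Summable fun n => a n • T ^ n := by
    refine Summable.of_norm_bounded ha fun n => ?_
    rw [norm_smul]
    exact mul_le_of_le_one_right (norm_nonneg _) (hTn n)
  have hkey : (∑' n, a n * z ^ n) • U = ∑' n, a n • (Q n * resolventCoeff T ρ 0) := by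
    have h1 : ∀ n, a n • (Q n * resolventCoeff T ρ 0) = (a n * z ^ n) • U - (a n • T ^ n) * U := by
      intro n
      rw [← hQU, smul_sub, smul_smul, smul_mul_assoc]
    simp_rw [h1]
    rw [(hs1.smul_const U).tsum_sub (hs2.mul_right U), hs1.tsum_smul_const, hs2.tsum_mul_right,
      haT, zero_mul, sub_zero]
  rw [← norm_smul, hkey]
  have hbound : ∀ n, ‖a n • (Q n * resolventCoeff T ρ 0)‖ ≤
      ‖a n‖ * (‖resolventCoeff T ρ 0‖ / (1 - ‖z‖)) := by
    intro n
    rw [norm_smul]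
    refine mul_le_mul_of_nonneg_left ((norm_mul_le _ _).trans ?_) (norm_nonneg _)
    rw [div_eq_inv_mul]
    exact mul_le_mul_of_nonneg_right (hQn n) (norm_nonneg _)
  refine (tsum_of_norm_bounded (ha.mul_right _).hasSum hbound).trans_eq ?_
  rw [ha.tsum_mul_right, mul_div_assoc]

/-- If a contraction `T` with isolated spectrum at `1` is annihilated by a family of absolutely
convergent power series without common atomic decay at `1`, the Riesz projection at `1` is
annihilated by `T - 1`. -/
theorem sub_one_mul_resolventCoeff_zero [NormOneClass 𝓑] (hT : ‖T‖ ≤ 1)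
    (hres : ∀ μ : ℂ, μ ≠ 1 → ‖μ - 1‖ ≤ ρ → μ ∈ resolventSet ℂ T) (hρ : 0 < ρ)
    {A : Set (ℕ → ℂ)}
    (hA : ∀ a ∈ A, (Summable fun n => ‖a n‖) ∧ ∑' n, a n • T ^ n = 0 ∧
      ∀ z ∈ closedBall (0 : ℂ) 1, ‖∑' n, a n * z ^ n‖ ≤ 1)
    (hA0 : ∃ a ∈ A, a 0 ≠ 0)
    (hdecay : ¬ ∃ c > 0, ∀ a ∈ A, ∀ z ∈ ball (0 : ℂ) 1, ‖∑' n, a n * z ^ n‖ ≤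
      Real.exp (-(c * ((1 - ‖z‖ ^ 2) / ‖1 - z‖ ^ 2)))) :
    (T - 1) * resolventCoeff T ρ 0 = 0 := by
  set U := resolventSingular T ρ with hU
  have hUd : Differentiable ℂ U := differentiable_resolventSingular hres hρ
  have hlin : ∀ φ : 𝓑 →L[ℂ] ℂ, ∃ B, ∀ s, φ (U s) = B * s := by
    intro φ
    have hφ : ∀ s, ‖φ (U s)‖ ≤ ‖φ‖ * ‖U s‖ := fun s => φ.le_opNorm _
    rcases linear_or_poisson_decay (F := fun s => φ (U s))
      (G := Set.image (fun (a : ℕ → ℂ) (z : ℂ) => ∑' n, a n * z ^ n) A)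
      (C₀ := ‖φ‖ * ‖resolventCoeff T ρ 0‖) (φ.differentiable.comp hUd)
      (by simp [hU, resolventSingular_zero]) (fun z hz => by
        rw [mul_div_assoc]
        exact (hφ _).trans (mul_le_mul_of_nonneg_left
          (norm_resolventSingular_le_of_one_lt hT hres hρ hz) (norm_nonneg _))) (by
        rintro _ ⟨a, ha, rfl⟩
        obtain ⟨has, haT, ha1⟩ := hA a ha
        refine ⟨continuousOn_tsum_coeff has, differentiableOn_tsum_coeff has, ha1,
          ‖φ‖ * ((∑' n, ‖a n‖) * ‖resolventCoeff T ρ 0‖), fun z hz => ?_⟩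
        rw [mul_div_assoc]
        calc ‖∑' n, a n * z ^ n‖ * ‖φ (U (z - 1)⁻¹)‖
            ≤ ‖∑' n, a n * z ^ n‖ * (‖φ‖ * ‖U (z - 1)⁻¹‖) :=
              mul_le_mul_of_nonneg_left (hφ _) (norm_nonneg _)
          _ = ‖φ‖ * (‖∑' n, a n * z ^ n‖ * ‖U (z - 1)⁻¹‖) := by ring
          _ ≤ _ := mul_le_mul_of_nonneg_left
            (norm_mul_norm_resolventSingular_le hT hres hρ has haT hz) (norm_nonneg _)) (by
        obtain ⟨a, ha, ha0⟩ := hA0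
        refine ⟨_, ⟨a, ha, rfl⟩, ?_⟩
        simp only
        rw [tsum_eq_single 0 (fun n hn => by simp [hn])]
        simpa using ha0) with h | ⟨c, hc, h⟩
    · exact h
    · exact absurd ⟨c, hc, fun a ha => h _ ⟨a, ha, rfl⟩⟩ hdecay
  have hUs : ∀ s : ℂ, s ≠ 0 → (T - 1) * U s = s⁻¹ • U s - resolventCoeff T ρ 0 := by
    intro s hs
    have h1 := sub_mul_resolventSingular hres hρ (l := 1 + s⁻¹) (by simpa using hs)
    rw [add_sub_cancel_left, inv_inv, map_add, map_one] at h1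
    rw [← h1, Algebra.smul_def, sub_mul, sub_mul, add_mul]
    abel
  have hzero : ∀ φ : 𝓑 →L[ℂ] ℂ, φ ((T - 1) * resolventCoeff T ρ 0) = 0 := by
    intro φ
    have hconst : ∀ ψ : 𝓑 →L[ℂ] ℂ, ∀ s : ℂ, s ≠ 0 → ψ ((T - 1) * U s) = 0 := by
      intro ψ
      obtain ⟨B, hB⟩ := hlin ψ
      have h1 : ∀ s : ℂ, s ≠ 0 → ψ ((T - 1) * U s) = B - ψ (resolventCoeff T ρ 0) := by
        intro s hs
        rw [hUs s hs, map_sub, map_smul, hB, smul_eq_mul]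
        field_simp
      have h2 : Tendsto (fun s => ψ ((T - 1) * U s)) (nhdsWithin 0 {0}ᶜ) (nhds 0) := by
        have : Continuous fun s => ψ ((T - 1) * U s) :=
          ψ.continuous.comp (continuous_const.mul hUd.continuous)
        have h3 := this.tendsto 0
        simp only [hU, resolventSingular_zero, mul_zero, map_zero] at h3
        exact h3.mono_left nhdsWithin_le_nhds
      have h3 : Tendsto (fun s => ψ ((T - 1) * U s)) (nhdsWithin 0 {0}ᶜ)
          (nhds (B - ψ (resolventCoeff T ρ 0))) :=
        tendsto_const_nhds.congr' (by
          filter_upwards [self_mem_nhdsWithin] with s hs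
          exact (h1 s hs).symm)
      intro s hs
      rw [h1 s hs, tendsto_nhds_unique h3 h2]
    have h1 := hUs 1 one_ne_zero
    rw [inv_one, one_smul] at h1
    have h2 : (T - 1) * resolventCoeff T ρ 0 = (T - 1) * U 1 - (T - 1) * ((T - 1) * U 1) := by
      rw [← mul_sub, h1, sub_sub_cancel]
    rw [h2, map_sub, hconst φ 1 one_ne_zero]
    have h3 := hconst (φ.comp (ContinuousLinearMap.mul ℂ 𝓑 (T - 1))) 1 one_ne_zero
    simp only [ContinuousLinearMap.comp_apply, ContinuousLinearMap.mul_apply'] at h3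
    rw [h3, sub_zero]
  by_contra hne
  obtain ⟨φ, hφ⟩ := SeparatingDual.exists_ne_zero (R := ℂ) hne
  exact hφ (hzero φ)

end Resolvent

/-- The quotient of a Banach space by a closed subspace invariant under a contraction. -/
theorem exists_quotient_contraction {E : Type} [NormedAddCommGroup E] [NormedSpace ℂ E]
    [CompleteSpace E] (K : Submodule ℂ E) (hK : IsClosed (K : Set E)) (S : E →L[ℂ] E)
    (hS : ‖S‖ ≤ 1) (hinv : ∀ x ∈ K, S x ∈ K) :
    ∃ (X : Type) (_ : NormedAddCommGroup X) (_ : NormedSpace ℂ X) (_ : CompleteSpace X)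
      (T : X →L[ℂ] X) (p : E →L[ℂ] X), ‖T‖ ≤ 1 ∧ Function.Surjective p ∧
      (∀ x, T (p x) = p (S x)) ∧ (∀ x, p x = 0 ↔ x ∈ K) ∧
      ∀ φ : E →L[ℂ] ℂ, (∀ x ∈ K, φ x = 0) → ∃ χ : X →L[ℂ] ℂ, ∀ x, χ (p x) = φ x := by
  have := hK
  refine ⟨E ⧸ K, inferInstance, inferInstance, inferInstance,
    K.liftQL (K.mkQL.comp S) (fun x hx => ?_), K.mkQL, ?_, ?_, ?_, ?_, ?_⟩
  · simpa using hinv x hx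
  · refine ContinuousLinearMap.opNorm_le_bound _ zero_le_one fun y => ?_
    rw [one_mul]
    refine le_of_forall_pos_le_add fun ε hε => ?_
    obtain ⟨m, rfl, hm⟩ := Submodule.Quotient.norm_mk_lt y hε
    have h1 : K.liftQL (K.mkQL.comp S) (fun x hx => by simpa using hinv x hx)
        (Submodule.Quotient.mk m) = Submodule.Quotient.mk (S m) := by simp
    rw [h1]
    calc ‖(Submodule.Quotient.mk (S m) : E ⧸ K)‖ ≤ ‖S m‖ := Submodule.Quotient.norm_mk_le _ _
      _ ≤ ‖m‖ := by simpa using S.le_of_opNorm_le hS m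
      _ ≤ _ := hm.le
  · exact Submodule.mkQ_surjective K
  · intro x
    simp
  · intro x
    simp
  · intro φ hφ
    exact ⟨K.liftQL φ (fun x hx => by simpa using hφ x hx), fun x => by simp⟩

/-- The space of absolutely summable sequences. -/
abbrev EllOne : Type := lp (fun _ : ℕ => ℂ) 1

theorem EllOne.summable (x : EllOne) : Summable fun n => ‖x n‖ := by
  simpa using (memℓp_gen_iff (by norm_num)).1 x.2

theorem EllOne.norm_eq (x : EllOne) : ‖x‖ = ∑' n, ‖x n‖ := by
  simpa using lp.norm_eq_tsum_rpow (p := 1) (by norm_num) x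

/-- The element of `ℓ¹` given by a summable sequence. -/
def EllOne.mk (a : ℕ → ℂ) (ha : Summable fun n => ‖a n‖) : EllOne :=
  ⟨a, (memℓp_gen_iff (by norm_num)).2 (by simpa using ha)⟩

theorem EllOne.mk_apply (a : ℕ → ℂ) (ha : Summable fun n => ‖a n‖) (n : ℕ) :
    EllOne.mk a ha n = a n := rfl

/-- The right shift on `ℓ¹`. -/
def ellShift : EllOne →L[ℂ] EllOne :=
  LinearMap.mkContinuous
    { toFun := fun x => EllOne.mk (fun n => Nat.casesOn n 0 fun k => x k) (by
        rw [← summable_nat_add_iff 1]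
        simpa using x.summable)
      map_add' := fun x y => by
        ext n
        cases n
        · exact (add_zero (0 : ℂ)).symm
        · rfl
      map_smul' := fun c x => by
        ext n
        cases n <;> simp [EllOne.mk] } 1 fun x => by
    rw [one_mul, EllOne.norm_eq, EllOne.norm_eq x]
    refine le_of_eq ?_
    simp only [LinearMap.coe_mk, AddHom.coe_mk, EllOne.mk_apply]
    rw [Summable.tsum_eq_zero_add (by
      rw [← summable_nat_add_iff 1]
      simpa using x.summable)]
    simp

theorem norm_ellShift_le : ‖ellShift‖ ≤ 1 := LinearMap.mkContinuous_norm_le _ zero_le_one _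

theorem ellShift_zero (x : EllOne) : ellShift x 0 = 0 := rfl

theorem ellShift_succ (x : EllOne) (n : ℕ) : ellShift x (n + 1) = x n := rfl

/-- Evaluation at a point of the closed disc of the function with given Taylor coefficients. -/
def ellEval (z : ℂ) (hz : z ∈ closedBall (0 : ℂ) 1) : EllOne →L[ℂ] ℂ :=
  LinearMap.mkContinuous
    { toFun := fun x => ∑' n, x n * z ^ n
      map_add' := fun x y => by
        simp only [lp.coeFn_add, Pi.add_apply, add_mul]
        exact (summable_coeff_mul_pow x.summable hz).tsum_add
          (summable_coeff_mul_pow y.summable hz)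
      map_smul' := fun c x => by
        simp only [lp.coeFn_smul, Pi.smul_apply, smul_eq_mul, RingHom.id_apply, mul_assoc]
        exact (summable_coeff_mul_pow x.summable hz).tsum_mul_left c } 1 fun x => by
    rw [one_mul, EllOne.norm_eq x]
    exact tsum_of_norm_bounded x.summable.hasSum fun n => norm_coeff_mul_pow_le x n hz

/-- The function on the closed disc with given Taylor coefficients. -/
def ellFun (x : EllOne) (z : ℂ) : ℂ := ∑' n, x n * z ^ n

theorem ellEval_apply {z : ℂ} (hz : z ∈ closedBall (0 : ℂ) 1) (x : EllOne) :
    ellEval z hz x = ellFun x z := rfl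

theorem hasSum_ellFun (x : EllOne) {z : ℂ} (hz : z ∈ closedBall (0 : ℂ) 1) :
    HasSum (fun n => x n * z ^ n) (ellFun x z) := (summable_coeff_mul_pow x.summable hz).hasSum

theorem ellFun_mem (x : EllOne) : ellFun x ∈ APlus := ⟨x, x.summable, fun _ hz => hasSum_ellFun x hz⟩

theorem ellFun_shift (x : EllOne) {z : ℂ} (hz : z ∈ closedBall (0 : ℂ) 1) :
    ellFun (ellShift x) z = z * ellFun x z := by
  rw [ellFun, Summable.tsum_eq_zero_add (summable_coeff_mul_pow (ellShift x).summable hz),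
    ellShift_zero, zero_mul, zero_add, ellFun,
    ← (summable_coeff_mul_pow x.summable hz).tsum_mul_left]
  congr 1
  ext1 n
  rw [ellShift_succ, pow_succ]
  ring

theorem ellFun_shift_pow (x : EllOne) (k : ℕ) {z : ℂ} (hz : z ∈ closedBall (0 : ℂ) 1) :
    ellFun ((ellShift ^ k) x) z = z ^ k * ellFun x z := by
  induction k with
  | zero => simp
  | succ k ih =>
    rw [pow_succ', mul_apply_eq_comp, ellFun_shift _ hz, ih, pow_succ']
    ring

theorem hasFPowerSeriesOnBall_of_hasSum {a : ℕ → ℂ} {f : ℂ → ℂ} (ha : Summable fun n => ‖a n‖)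
    (h : ∀ z ∈ ball (0 : ℂ) 1, HasSum (fun n => a n * z ^ n) (f z)) :
    HasFPowerSeriesOnBall f (FormalMultilinearSeries.ofScalars ℂ a) 0 1 where
  r_le := by
    have := (FormalMultilinearSeries.ofScalars ℂ a).le_radius_of_summable (r := 1) (by
      simpa [FormalMultilinearSeries.ofScalars_norm] using ha)
    simpa using this
  r_pos := one_pos
  hasSum := fun {y} hy => by
    have hy' : y ∈ ball (0 : ℂ) 1 := by
      rw [← Metric.eball_ofReal]
      simpa using hy
    have := h y hy'
    simpa [FormalMultilinearSeries.ofScalars, mul_comm] using this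

theorem taylorCoeff_eq_of_hasSum {a : ℕ → ℂ} {f : ℂ → ℂ} (ha : Summable fun n => ‖a n‖)
    (h : ∀ z ∈ ball (0 : ℂ) 1, HasSum (fun n => a n * z ^ n) (f z)) (n : ℕ) :
    taylorCoeff f n = a n := by
  have h1 := (hasFPowerSeriesOnBall_of_hasSum ha h).hasFPowerSeriesAt
  have h2 := h1.analyticAt.hasFPowerSeriesAt
  have h3 := congrArg (fun p => FormalMultilinearSeries.coeff p n)
    (HasFPowerSeriesAt.eq_formalMultilinearSeries h2 h1)
  simpa [taylorCoeff, FormalMultilinearSeries.coeff_ofScalars] using h3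

theorem exists_ellOne_of_mem {f : ℂ → ℂ} (hf : f ∈ APlus) :
    ∃ x : EllOne, (∀ z ∈ closedBall (0 : ℂ) 1, f z = ellFun x z) ∧
      ∀ n, taylorCoeff f n = x n := by
  obtain ⟨a, ha, h⟩ := hf
  refine ⟨EllOne.mk a ha, fun z hz => ((h z hz).tsum_eq).symm, fun n => ?_⟩
  exact taylorCoeff_eq_of_hasSum ha (fun z hz => h z (ball_subset_closedBall hz)) n

theorem APlusNorm_eq_of_eqOn {f : ℂ → ℂ} {x : EllOne}
    (h : ∀ z ∈ closedBall (0 : ℂ) 1, f z = ellFun x z) : APlusNorm f = ‖x‖ := by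
  rw [APlusNorm, EllOne.norm_eq]
  congr 1
  ext1 n
  rw [taylorCoeff_eq_of_hasSum x.summable fun z hz => by
    rw [h z (ball_subset_closedBall hz)]
    exact hasSum_ellFun x (ball_subset_closedBall hz)]

theorem ellFun_sub (x y : EllOne) {z : ℂ} (hz : z ∈ closedBall (0 : ℂ) 1) :
    ellFun (x - y) z = ellFun x z - ellFun y z := by
  simp only [← ellEval_apply hz, map_sub]

theorem APlus_congr {f g : ℂ → ℂ} (hf : f ∈ APlus)
    (h : ∀ z ∈ closedBall (0 : ℂ) 1, g z = f z) : g ∈ APlus := by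
  obtain ⟨a, ha, hs⟩ := hf
  exact ⟨a, ha, fun z hz => by rw [h z hz]; exact hs z hz⟩

theorem APlus_of_eq_ellFun {g : ℂ → ℂ} (x : EllOne)
    (h : ∀ z ∈ closedBall (0 : ℂ) 1, g z = ellFun x z) : g ∈ APlus := APlus_congr (ellFun_mem x) h

theorem IsClosedIdealAPlus.congr {K : Set (ℂ → ℂ)} (hK : IsClosedIdealAPlus K) {f g : ℂ → ℂ}
    (hf : f ∈ K) (h : ∀ z ∈ closedBall (0 : ℂ) 1, g z = f z) : g ∈ K := by
  refine hK.2.2.2 g (APlus_congr (hK.1 hf) h) fun ε hε => ⟨f, hf, ?_⟩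
  rw [APlusNorm_eq_of_eqOn (x := 0) fun z hz => ?_]
  · simpa using hε
  · simp [ellFun, h z hz]

theorem const_mem_APlus (c : ℂ) : (fun _ => c) ∈ APlus := by
  refine APlus_of_eq_ellFun (EllOne.mk (Pi.single 0 c) (summable_of_hasFiniteSupport ?_))
    fun z _ => ?_
  · refine (Set.finite_singleton 0).subset fun n hn => ?_
    by_contra hne
    exact hn (by simp [Pi.single_eq_of_ne hne])
  · rw [ellFun, tsum_eq_single 0 fun n hn => by simp [EllOne.mk_apply, hn]]
    simp [EllOne.mk_apply]

/-- The series `∑ aₙ Sⁿ` of the shift, i.e. multiplication by `∑ aₙ zⁿ`. -/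
def ellMul (x : EllOne) : EllOne →L[ℂ] EllOne := ∑' n, x n • ellShift ^ n

theorem norm_pow_le_one {𝓑 : Type*} [NormedRing 𝓑] [NormOneClass 𝓑] {T : 𝓑} (hT : ‖T‖ ≤ 1)
    (n : ℕ) : ‖T ^ n‖ ≤ 1 := (norm_pow_le T n).trans (pow_le_one₀ (norm_nonneg _) hT)

theorem summable_smul_pow {𝓑 : Type*} [NormedRing 𝓑] [NormedAlgebra ℂ 𝓑] [CompleteSpace 𝓑]
    [NormOneClass 𝓑] {T : 𝓑} (hT : ‖T‖ ≤ 1) (x : EllOne) : Summable fun n => x n • T ^ n := by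
  refine Summable.of_norm_bounded x.summable fun n => ?_
  rw [norm_smul]
  exact mul_le_of_le_one_right (norm_nonneg _) (norm_pow_le_one hT n)

instance : Nontrivial EllOne :=
  ⟨⟨lp.single 1 0 1, 0, fun h => by simpa using congrArg norm h⟩⟩

theorem ellFun_mul (x y : EllOne) {z : ℂ} (hz : z ∈ closedBall (0 : ℂ) 1) :
    ellFun (ellMul x y) z = ellFun x z * ellFun y z := by
  have hs := summable_smul_pow norm_ellShift_le x
  have h := (ellEval z hz).hasSum ((ContinuousLinearMap.apply ℂ EllOne y).hasSum hs.hasSum)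
  have h2 : ∀ n, (ellEval z hz) ((ContinuousLinearMap.apply ℂ EllOne y) (x n • ellShift ^ n)) =
      x n * z ^ n * ellFun y z := by
    intro n
    simp only [map_smul, ContinuousLinearMap.apply_apply, smul_eq_mul, ellEval_apply,
      ellFun_shift_pow y n hz]
    ring
  simp_rw [h2] at h
  exact h.unique ((hasSum_ellFun x hz).mul_right _)

theorem norm_ellMul_le (x y : EllOne) : ‖ellMul x y‖ ≤ ‖x‖ * ‖y‖ := by
  have h : ‖ellMul x‖ ≤ ‖x‖ := by
    rw [EllOne.norm_eq]
    refine tsum_of_norm_bounded x.summable.hasSum fun n => ?_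
    rw [norm_smul]
    exact mul_le_of_le_one_right (norm_nonneg _) (norm_pow_le_one norm_ellShift_le n)
  exact (ellMul x).le_of_opNorm_le h y

theorem APlus_mul {f g : ℂ → ℂ} (hf : f ∈ APlus) (hg : g ∈ APlus) : f * g ∈ APlus := by
  obtain ⟨x, hx, -⟩ := exists_ellOne_of_mem hf
  obtain ⟨y, hy, -⟩ := exists_ellOne_of_mem hg
  exact APlus_of_eq_ellFun (ellMul x y) fun z hz => by
    rw [ellFun_mul x y hz, Pi.mul_apply, hx z hz, hy z hz]

theorem APlusNorm_mul_le {f g : ℂ → ℂ} (hf : f ∈ APlus) (hg : g ∈ APlus) :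
    APlusNorm (f * g) ≤ APlusNorm f * APlusNorm g := by
  obtain ⟨x, hx, -⟩ := exists_ellOne_of_mem hf
  obtain ⟨y, hy, -⟩ := exists_ellOne_of_mem hg
  rw [APlusNorm_eq_of_eqOn hx, APlusNorm_eq_of_eqOn hy,
    APlusNorm_eq_of_eqOn (x := ellMul x y) fun z hz => by
      rw [ellFun_mul x y hz, Pi.mul_apply, hx z hz, hy z hz]]
  exact norm_ellMul_le x y

theorem APlus_sub {f g : ℂ → ℂ} (hf : f ∈ APlus) (hg : g ∈ APlus) : f - g ∈ APlus := by
  obtain ⟨x, hx, -⟩ := exists_ellOne_of_mem hf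
  obtain ⟨y, hy, -⟩ := exists_ellOne_of_mem hg
  exact APlus_of_eq_ellFun (x - y) fun z hz => by
    rw [ellFun_sub x y hz, Pi.sub_apply, hx z hz, hy z hz]

theorem IsClosedIdealAPlus.div {I : Set (ℂ → ℂ)} (hI : IsClosedIdealAPlus I) {f : ℂ → ℂ}
    (hf : f ∈ APlus) : IsClosedIdealAPlus (Idiv I f) := by
  obtain ⟨h1, h2, h3, h4⟩ := hI
  refine ⟨fun g hg => hg.1, fun g hg h hh => ⟨?_, ?_⟩, fun g hg h hh => ⟨APlus_mul hg hh.1, ?_⟩,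
    fun g hg happ => ⟨hg, ?_⟩⟩
  · have := APlus_sub hg.1 (APlus_mul (const_mem_APlus (-1)) hh.1)
    refine APlus_congr this fun z _ => ?_
    simp
  · rw [mul_add]
    exact h2 _ hg.2 _ hh.2
  · rw [mul_left_comm]
    exact h3 _ hg _ hh.2
  · refine h4 _ (APlus_mul hf hg) fun ε hε => ?_
    have hn : 0 ≤ APlusNorm f := tsum_nonneg fun _ => norm_nonneg _
    obtain ⟨k, hk, hkε⟩ := happ (ε / (APlusNorm f + 1)) (by positivity)
    refine ⟨f * k, hk.2, ?_⟩
    rw [← mul_sub]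
    refine (APlusNorm_mul_le hf (APlus_sub hg hk.1)).trans_lt ?_
    rw [lt_div_iff₀ (by positivity)] at hkε
    have : 0 ≤ APlusNorm (g - k) := tsum_nonneg fun _ => norm_nonneg _
    nlinarith

/-- The closed subspace of `ℓ¹` corresponding to a closed ideal of `A⁺`. -/
def idealSubmodule (K : Set (ℂ → ℂ)) (hK : IsClosedIdealAPlus K) (hne : K.Nonempty) :
    Submodule ℂ EllOne where
  carrier := {x | ellFun x ∈ K}
  add_mem' := fun {x y} hx hy => by
    refine hK.congr (hK.2.1 _ hx _ hy) fun z hz => ?_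
    simp only [Pi.add_apply, ← ellEval_apply hz, map_add]
  zero_mem' := by
    obtain ⟨g, hg⟩ := hne
    refine hK.congr (hK.2.2.1 _ (const_mem_APlus 0) _ hg) fun z hz => ?_
    simp only [Pi.mul_apply, ← ellEval_apply hz, map_zero, zero_mul]
  smul_mem' := fun c x hx => by
    refine hK.congr (hK.2.2.1 _ (const_mem_APlus c) _ hx) fun z hz => ?_
    simp only [Pi.mul_apply, ← ellEval_apply hz, map_smul, smul_eq_mul]

theorem mem_idealSubmodule {K : Set (ℂ → ℂ)} (hK : IsClosedIdealAPlus K) (hne : K.Nonempty)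
    (x : EllOne) : x ∈ idealSubmodule K hK hne ↔ ellFun x ∈ K := Iff.rfl

theorem isClosed_idealSubmodule {K : Set (ℂ → ℂ)} (hK : IsClosedIdealAPlus K)
    (hne : K.Nonempty) : IsClosed (idealSubmodule K hK hne : Set EllOne) := by
  refine isClosed_of_closure_subset fun x hx => ?_
  refine hK.2.2.2 _ (ellFun_mem x) fun ε hε => ?_
  obtain ⟨y, hy, hxy⟩ := Metric.mem_closure_iff.1 hx ε hε
  refine ⟨ellFun y, hy, ?_⟩
  rw [APlusNorm_eq_of_eqOn (x := x - y) fun z hz => by rw [ellFun_sub x y hz, Pi.sub_apply],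
    ← dist_eq_norm]
  exact hxy

/-- The quotient of `A⁺` by a closed ideal, with the operator of multiplication by `z`. -/
theorem exists_ideal_quotient {K : Set (ℂ → ℂ)} (hK : IsClosedIdealAPlus K)
    (hne : K.Nonempty) :
    ∃ (X : Type) (_ : NormedAddCommGroup X) (_ : NormedSpace ℂ X) (_ : CompleteSpace X)
      (T : X →L[ℂ] X) (p : EllOne →L[ℂ] X), ‖T‖ ≤ 1 ∧ Function.Surjective p ∧
      (∀ x, T (p x) = p (ellShift x)) ∧ (∀ x, p x = 0 ↔ ellFun x ∈ K) ∧
      ∀ φ : EllOne →L[ℂ] ℂ, (∀ x, ellFun x ∈ K → φ x = 0) →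
        ∃ χ : X →L[ℂ] ℂ, ∀ x, χ (p x) = φ x :=
  exists_quotient_contraction (idealSubmodule K hK hne) (isClosed_idealSubmodule hK hne) ellShift
    norm_ellShift_le fun x hx => by
      rw [mem_idealSubmodule] at hx ⊢
      refine hK.congr (hK.2.2.1 _ (ellFun_mem (EllOne.mk (Pi.single 1 1)
        (summable_of_hasFiniteSupport ?_))) _ hx) fun z hz => ?_
      · refine (Set.finite_singleton 1).subset fun n hn => ?_
        by_contra hne'
        exact hn (by simp [Pi.single_eq_of_ne hne'])
      · rw [ellFun_shift x hz, Pi.mul_apply]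
        congr 1
        rw [ellFun, tsum_eq_single 1 fun n hn => by simp [EllOne.mk_apply, hn]]
        simp [EllOne.mk_apply]

theorem ellFun_eq_zero_of_mem_spectrum {𝓑 : Type*} [NormedRing 𝓑] [NormedAlgebra ℂ 𝓑]
    [CompleteSpace 𝓑] [NormOneClass 𝓑] {T : 𝓑} (hT : ‖T‖ ≤ 1) {x : EllOne}
    (hx : ∑' n, x n • T ^ n = 0) {l : ℂ} (hl : l ∈ spectrum ℂ T) :
    l ∈ closedBall (0 : ℂ) 1 ∧ ellFun x l = 0 := by
  have hl1 : l ∈ closedBall (0 : ℂ) 1 := by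
    simpa using (spectrum.norm_le_norm_of_mem hl).trans hT
  refine ⟨hl1, ?_⟩
  have h1 : Tendsto (fun N => ∑ n ∈ Finset.range N, x n * l ^ n) atTop (nhds (ellFun x l)) :=
    (hasSum_ellFun x hl1).tendsto_sum_nat
  have h2 : Tendsto (fun N => ∑ n ∈ Finset.range N, x n • T ^ n) atTop (nhds 0) := by
    rw [← hx]
    exact (summable_smul_pow hT x).hasSum.tendsto_sum_nat
  have h3 : ∀ N, ‖∑ n ∈ Finset.range N, x n * l ^ n‖ ≤ ‖∑ n ∈ Finset.range N, x n • T ^ n‖ := by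
    intro N
    set p : Polynomial ℂ := ∑ n ∈ Finset.range N, Polynomial.C (x n) * Polynomial.X ^ n with hp
    have h4 : p.eval l = ∑ n ∈ Finset.range N, x n * l ^ n := by
      simp [hp, Polynomial.eval_finsetSum]
    have h5 : Polynomial.aeval T p = ∑ n ∈ Finset.range N, x n • T ^ n := by
      simp [hp, Algebra.smul_def]
    rw [← h4, ← h5]
    exact spectrum.norm_le_norm_of_mem (spectrum.subset_polynomial_aeval T p ⟨l, hl, rfl⟩)
  have h4 := le_of_tendsto_of_tendsto' h1.norm h2.norm h3
  simpa using h4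

theorem functional_resolventCoeff {X : Type*} [NormedAddCommGroup X] [NormedSpace ℂ X]
    [CompleteSpace X] {T : X →L[ℂ] X} {ρ : ℝ} (χ : X →L[ℂ] ℂ) (hχ : ∀ v, χ (T v) = χ v)
    (hres : ∀ μ : ℂ, μ ≠ 1 → ‖μ - 1‖ ≤ ρ → μ ∈ resolventSet ℂ T) (hρ : 0 < ρ) (v : X) :
    χ (resolventCoeff T ρ 0 v) = χ v := by
  set L : (X →L[ℂ] X) →L[ℂ] ℂ := χ.comp (ContinuousLinearMap.apply ℂ X v) with hL
  have hLa : ∀ A, L A = χ (A v) := fun A => rfl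
  have h1 := clm_circleIntegral L (circleIntegrable_smul_resolvent hres hρ le_rfl 0)
  have h2 : ∮ z in C(1, ρ), L ((z - 1) ^ 0 • resolvent T z) =
      ∮ z in C(1, ρ), χ v * (z - 1)⁻¹ := by
    refine circleIntegral.integral_congr hρ.le fun z hz => ?_
    have hz' : ‖z - 1‖ = ρ := by simpa [dist_eq_norm] using hz
    have hz1 : z ≠ 1 := by
      rintro rfl
      simp at hz'
      linarith
    have h4 := resolvent_mul_cancel (hres z hz1 hz'.le)
    have h5 := congrArg (fun A : X →L[ℂ] X => χ (A v)) h4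
    simp only [mul_apply_eq_comp, sub_mul, Algebra.algebraMap_eq_smul_one, smul_mul_assoc,
      one_mul, sub_apply, smul_apply, map_sub, map_smul,
      hχ, one_apply_eq_self, smul_eq_mul] at h5
    simp only [pow_zero, one_smul, hLa]
    rw [← h5]
    field_simp [sub_ne_zero.2 hz1]
  rw [← hLa, resolventCoeff, map_smul, h1, h2, circleIntegral.integral_const_mul,
    circleIntegral.integral_sub_inv_of_mem_ball (mem_ball_self hρ), smul_eq_mul]
  have : (2 * Real.pi * Complex.I : ℂ) ≠ 0 := by simp [Real.pi_ne_zero]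
  field_simp

/-- Mean ergodic argument: a fixed vector of a contraction `τ` of the form `∑ cₖ τᵏ v` with
`∑ cₖ = 0` vanishes. -/
theorem eq_zero_of_fixed_of_tsum_eq_zero {X : Type*} [NormedAddCommGroup X] [NormedSpace ℂ X]
    [CompleteSpace X] {τ : X →L[ℂ] X} (hτ : ‖τ‖ ≤ 1) {c : ℕ → ℂ} (hc : Summable fun n => ‖c n‖)
    (hc0 : ∑' n, c n = 0) {v y : X} (hy : HasSum (fun n => c n • (τ ^ n) v) y) (hfix : τ y = y) :
    y = 0 := by
  have hτ1 : ∀ w, ‖τ w‖ ≤ ‖w‖ := fun w => by simpa using τ.le_of_opNorm_le hτ w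
  have hτn : ∀ n w, ‖(τ ^ n) w‖ ≤ ‖w‖ := by
    intro n
    induction n with
    | zero => intro w; simp
    | succ n ih =>
      intro w
      rw [pow_succ, mul_apply_eq_comp]
      exact (ih _).trans (hτ1 w)
  have hfixn : ∀ n, (τ ^ n) y = y := by
    intro n
    induction n with
    | zero => simp
    | succ n ih => rw [pow_succ, mul_apply_eq_comp, hfix, ih]
  set A : ℕ → X →L[ℂ] X := fun n => ((n : ℂ) + 1)⁻¹ • ∑ j ∈ Finset.range (n + 1), τ ^ j with hA
  have hn0 : ∀ n : ℕ, (n : ℂ) + 1 ≠ 0 := fun n => Nat.cast_add_one_ne_zero n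
  have hnorm : ∀ n : ℕ, ‖((n : ℂ) + 1)⁻¹‖ = ((n : ℝ) + 1)⁻¹ := by
    intro n
    rw [norm_inv]
    congr 1
    exact_mod_cast Complex.norm_natCast (n + 1)
  have hAy : ∀ n, A n y = y := by
    intro n
    simp only [hA, smul_apply, sum_apply, hfixn,
      Finset.sum_const, Finset.card_range]
    rw [← Nat.cast_smul_eq_nsmul ℂ, smul_smul]
    push_cast
    rw [inv_mul_cancel₀ (hn0 n), one_smul]
  have hAle : ∀ n w, ‖A n w‖ ≤ ‖w‖ := by
    intro n w
    simp only [hA, smul_apply, sum_apply]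
    rw [norm_smul, hnorm, inv_mul_le_iff₀ (by positivity)]
    refine (norm_sum_le_of_le _ fun j _ => hτn j w).trans_eq ?_
    simp
  have hAτ : ∀ n w, A n (τ w - w) = ((n : ℂ) + 1)⁻¹ • ((τ ^ (n + 1)) w - w) := by
    intro n w
    simp only [hA, smul_apply, sum_apply, map_sub]
    have : ∀ j, (τ ^ j) (τ w) = (τ ^ (j + 1)) w := fun j => by
      rw [pow_succ, mul_apply_eq_comp]
    simp_rw [this]
    rw [← smul_sub, ← Finset.sum_sub_distrib, Finset.sum_range_sub (fun j => (τ ^ j) w), pow_zero]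
    rfl
  have hinv : Tendsto (fun n : ℕ => ((n : ℝ) + 1)⁻¹) atTop (nhds 0) := by
    simpa using tendsto_one_div_add_atTop_nhds_zero_nat (𝕜 := ℝ)
  have hlim1 : ∀ w, Tendsto (fun n => A n (τ w - w)) atTop (nhds 0) := by
    intro w
    rw [tendsto_zero_iff_norm_tendsto_zero]
    refine squeeze_zero (fun _ => norm_nonneg _) (fun n => ?_)
      (by simpa using hinv.mul_const (2 * ‖w‖))
    rw [hAτ, norm_smul, hnorm]
    refine mul_le_mul_of_nonneg_left ?_ (by positivity)
    refine (norm_sub_le _ _).trans ?_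
    linarith [hτn (n + 1) w]
  have hlim : ∀ k w, Tendsto (fun n => A n ((τ ^ k) w - w)) atTop (nhds 0) := by
    intro k
    induction k with
    | zero => intro w; simp
    | succ k ih =>
      intro w
      have := (ih (τ w)).add (hlim1 w)
      simp only [← map_add, add_zero] at this
      refine this.congr fun n => ?_
      rw [pow_succ, mul_apply_eq_comp]
      congr 1
      abel
  have hcs : HasSum c 0 := hc0 ▸ hc.of_norm.hasSum
  have hsum : ∀ n, HasSum (fun k => c k • A n ((τ ^ k) v - v)) y := by
    intro n
    have h1 : HasSum (fun k => c k • ((τ ^ k) v - v)) y := by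
      have := hy.sub (hcs.smul_const v)
      simpa [smul_sub] using this
    have h2 := (A n).hasSum h1
    rw [hAy] at h2
    simpa only [map_smul] using h2
  have hfin : Tendsto (fun n => ∑' k, c k • A n ((τ ^ k) v - v)) atTop
      (nhds (∑' k, c k • (0 : X))) := by
    refine tendsto_tsum_of_dominated_convergence (bound := fun k => ‖c k‖ * (2 * ‖v‖))
      (hc.mul_right _) (fun k => (hlim k v).const_smul (c k)) (Eventually.of_forall fun n k => ?_)
    rw [norm_smul]
    refine mul_le_mul_of_nonneg_left ((hAle _ _).trans ((norm_sub_le _ _).trans ?_))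
      (norm_nonneg _)
    linarith [hτn k v]
  simp only [smul_zero, tsum_zero] at hfin
  have h3 : (fun n => ∑' k, c k • A n ((τ ^ k) v - v)) = fun _ => y :=
    funext fun n => (hsum n).tsum_eq
  rw [h3] at hfin
  exact tendsto_nhds_unique tendsto_const_nhds hfin

/-- A nonempty countable compact set of complex numbers has an isolated point. -/
theorem exists_isolated_of_countable {s : Set ℂ} (hs : IsClosed s) (hne : s.Nonempty)
    (hc : s.Countable) : ∃ p ∈ s, ∃ r > 0, ∀ q ∈ s, q ≠ p → r < dist q p := by
  by_contra hcon
  push Not at hcon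
  have hperf : Perfect s := ⟨hs, fun x hx => by
    rw [accPt_iff_nhds]
    intro U hU
    obtain ⟨r, hr, hrU⟩ := Metric.mem_nhds_iff.1 hU
    obtain ⟨q, hq, hqx, hqr⟩ := hcon x hx (r / 2) (by positivity)
    exact ⟨q, ⟨hrU (by rw [mem_ball]; linarith), hq⟩, hqx⟩⟩
  obtain ⟨f, hf, -, hinj⟩ := hperf.exists_nat_bool_injection hne
  have h1 : (Set.range f).Countable := hc.mono hf
  have h2 : (Set.univ : Set (ℕ → Bool)).Countable :=
    Set.countable_of_injective_of_countable_image hinj.injOn (by rwa [Set.image_univ])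
  obtain ⟨e, he⟩ := h2.exists_surjective Set.univ_nonempty
  obtain ⟨n, hn⟩ := he ⟨fun n => !((e n).1 n), Set.mem_univ _⟩
  have h3 := congrFun (congrArg Subtype.val hn) n
  simp at h3

theorem hasSum_smul_pow_apply {X : Type*} [NormedAddCommGroup X] [NormedSpace ℂ X]
    {T : X →L[ℂ] X} {P : EllOne →L[ℂ] X} (hP : ∀ x, T (P x) = P (ellShift x)) (x y : EllOne) :
    HasSum (fun n => x n • (T ^ n) (P y)) (P (ellMul x y)) := by
  have hs := summable_smul_pow norm_ellShift_le x
  have h := P.hasSum ((ContinuousLinearMap.apply ℂ EllOne y).hasSum hs.hasSum)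
  have hn : ∀ n y, (T ^ n) (P y) = P ((ellShift ^ n) y) := by
    intro n
    induction n with
    | zero => intro y; simp
    | succ n ih =>
      intro y
      rw [pow_succ, mul_apply_eq_comp, hP, ih, pow_succ, mul_apply_eq_comp]
  refine h.congr_fun ?_
  intro n
  simp [hn]

theorem mem_of_countable_hull {I : Set (ℂ → ℂ)} (hI : IsClosedIdealAPlus I) (hne : I.Nonempty)
    (hcount : (hull I).Countable) {f : ℂ → ℂ} (hf : f ∈ APlus)
    (hvan : ∀ z ∈ hull I ∩ sphere (0 : ℂ) 1, f z = 0)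
    (hin : ∀ z ∈ ball (0 : ℂ) 1, ∃ g ∈ Idiv I f, g z ≠ 0)
    (hdecay : ∀ l ∈ sphere (0 : ℂ) 1, ¬ ∃ c > 0, ∀ g ∈ Idiv I f,
      (∀ z ∈ closedBall (0 : ℂ) 1, ‖g z‖ ≤ 1) → ∀ z ∈ ball (0 : ℂ) 1,
        ‖g z‖ ≤ Real.exp (-(c * ((1 - ‖z‖ ^ 2) / ‖l - z‖ ^ 2)))) : f ∈ I := by
  by_contra hfI
  have hJ := hI.div hf
  set J := Idiv I f with hJdef
  have hIJ : I ⊆ J := fun g hg => ⟨hI.1 hg, hI.2.2.1 _ hf _ hg⟩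
  have hhull : hull J ⊆ hull I := fun z hz => ⟨hz.1, fun g hg => hz.2 g (hIJ hg)⟩
  obtain ⟨X, _, _, _, T, P, hT, hPs, hP, hP0, hPχ⟩ := exists_ideal_quotient hJ (hne.mono hIJ)
  have hfun : ∀ c : ℂ, ∃ x : EllOne, ∀ z ∈ closedBall (0 : ℂ) 1, ellFun x z = c := fun c => by
    obtain ⟨x, hx, -⟩ := exists_ellOne_of_mem (const_mem_APlus c)
    exact ⟨x, fun z hz => (hx z hz).symm⟩
  obtain ⟨one, hone⟩ := hfun 1
  have hPone : P one ≠ 0 := by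
    rw [Ne, hP0]
    intro h
    refine hfI (hI.congr h.2 fun z hz => ?_)
    rw [Pi.mul_apply, hone z hz, mul_one]
  have : Nontrivial X := ⟨⟨P one, 0, hPone⟩⟩
  have hann : ∀ x : EllOne, ellFun x ∈ J → ∑' n, x n • T ^ n = 0 := by
    intro x hx
    ext v
    obtain ⟨y, rfl⟩ := hPs v
    have h1 := (ContinuousLinearMap.apply ℂ X (P y)).hasSum (summable_smul_pow hT x).hasSum
    have h2 := hasSum_smul_pow_apply hP x y
    have h3 : P (ellMul x y) = 0 := by
      rw [hP0]
      refine hJ.congr (hJ.2.2.1 _ (ellFun_mem y) _ hx) fun z hz => ?_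
      rw [ellFun_mul x y hz, Pi.mul_apply, mul_comm]
    rw [h3] at h2
    have h4 := h1.unique (by simpa using h2)
    simpa using h4
  have hspec : spectrum ℂ T ⊆ hull J := by
    intro l hl
    refine ⟨by simpa using (spectrum.norm_le_norm_of_mem hl).trans hT, fun g hg => ?_⟩
    obtain ⟨x, hx, -⟩ := exists_ellOne_of_mem hg.1
    have hxJ : ellFun x ∈ J := hJ.congr hg fun z hz => (hx z hz).symm
    obtain ⟨hl1, hl2⟩ := ellFun_eq_zero_of_mem_spectrum hT (hann x hxJ) hl
    rw [hx l hl1, hl2]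
  obtain ⟨l, hl, ρ, hρ, hiso⟩ := exists_isolated_of_countable
    (spectrum.isClosed T) (spectrum.nonempty T)
    (hcount.mono (hspec.trans hhull))
  have hlJ := hspec hl
  have hl1 : ‖l‖ = 1 := by
    refine le_antisymm (by simpa using hlJ.1) (not_lt.1 fun h => ?_)
    obtain ⟨g, hg, hgl⟩ := hin l (by simpa using h)
    exact hgl (hlJ.2 g hg)
  have hl0 : l ≠ 0 := by
    rintro rfl
    simp at hl1
  have hlmul : ∀ z ∈ closedBall (0 : ℂ) 1, l * z ∈ closedBall (0 : ℂ) 1 := fun z hz => by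
    simpa [hl1] using hz
  set T' : X →L[ℂ] X := l⁻¹ • T with hT'
  have hT'1 : ‖T'‖ ≤ 1 := by
    rw [hT', norm_smul, norm_inv, hl1]
    simpa using hT
  have hres : ∀ μ : ℂ, μ ≠ 1 → ‖μ - 1‖ ≤ ρ → μ ∈ resolventSet ℂ T' := by
    intro μ hμ hμρ
    have h1 : l * μ ∈ resolventSet ℂ T := by
      by_contra hcon
      have h2 := hiso (l * μ) hcon fun h => hμ (by simpa [hl0] using h)
      rw [dist_eq_norm, show l * μ - l = l * (μ - 1) by ring, norm_mul, hl1, one_mul] at h2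
      linarith
    rw [spectrum.mem_resolventSet_iff] at h1 ⊢
    have h2 : IsUnit (algebraMap ℂ (X →L[ℂ] X) l⁻¹) := (IsUnit.mk0 _ (inv_ne_zero hl0)).map _
    have h3 := h2.mul h1
    convert h3 using 1
    rw [mul_sub, ← map_mul, inv_mul_cancel_left₀ hl0, hT', Algebra.smul_def]
  set A : Set (ℕ → ℂ) := {a | ∃ x : EllOne, ellFun x ∈ J ∧
    (∀ z ∈ closedBall (0 : ℂ) 1, ‖ellFun x z‖ ≤ 1) ∧ ∀ n, a n = x n * l ^ n} with hAdef
  have hAsum : ∀ (x : EllOne) (a : ℕ → ℂ), (∀ n, a n = x n * l ^ n) → ∀ z,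
      ∑' n, a n * z ^ n = ellFun x (l * z) := by
    intro x a ha z
    rw [ellFun]
    congr 1
    ext n
    rw [ha, mul_pow, mul_assoc]
  have hproj : (T' - 1) * resolventCoeff T' ρ 0 = 0 := by
    refine sub_one_mul_resolventCoeff_zero hT'1 hres hρ (A := A) ?_ ?_ ?_
    · rintro a ⟨x, hxJ, hx1, ha⟩
      refine ⟨?_, ?_, ?_⟩
      · refine x.summable.congr fun n => ?_
        rw [ha, norm_mul, norm_pow, hl1, one_pow, mul_one]
      · rw [← hann x hxJ]
        congr 1
        ext1 n
        rw [ha, hT', smul_pow, smul_smul, mul_assoc, ← mul_pow, mul_inv_cancel₀ hl0, one_pow,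
          mul_one]
      · intro z hz
        rw [hAsum x a ha]
        exact hx1 _ (hlmul z hz)
    · obtain ⟨g, hg, hg0⟩ := hin 0 (by simp)
      obtain ⟨x, hx, -⟩ := exists_ellOne_of_mem hg.1
      have hxJ : ellFun x ∈ J := hJ.congr hg fun z hz => (hx z hz).symm
      have hxb : ∀ z ∈ closedBall (0 : ℂ) 1, ‖ellFun x z‖ ≤ ‖x‖ := by
        intro z hz
        rw [EllOne.norm_eq]
        refine tsum_of_norm_bounded x.summable.hasSum fun n => ?_
        exact norm_coeff_mul_pow_le x n hz
      have hx0 : ellFun x 0 = x 0 := by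
        rw [ellFun, tsum_eq_single 0 fun n hn => by simp [hn]]
        simp
      have hx00 : x 0 ≠ 0 := by rwa [← hx0, ← hx 0 (by simp)]
      have hxn : ‖x‖ ≠ 0 := by
        intro h
        rw [norm_eq_zero] at h
        simp [h] at hx00
      have hfs : ∀ z ∈ closedBall (0 : ℂ) 1,
          ellFun (((‖x‖ : ℂ)⁻¹) • x) z = (‖x‖ : ℂ)⁻¹ * ellFun x z := fun z hz => by
        simp only [← ellEval_apply hz, map_smul, smul_eq_mul]
      refine ⟨fun n => (((‖x‖ : ℂ)⁻¹) • x) n * l ^ n, ⟨((‖x‖ : ℂ)⁻¹) • x, ?_, ?_, fun n => rfl⟩, ?_⟩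
      · exact hJ.congr (hJ.2.2.1 _ (const_mem_APlus ((‖x‖ : ℂ)⁻¹)) _ hxJ) hfs
      · intro z hz
        rw [hfs z hz, norm_mul, norm_inv, Complex.norm_real, norm_norm,
          inv_mul_le_iff₀ (by positivity), mul_one]
        exact hxb z hz
      · simp [hx00, hxn]
    · rintro ⟨c, hc, hcA⟩
      refine hdecay l (by simpa using hl1) ⟨c, hc, fun g hg hg1 z hz => ?_⟩
      obtain ⟨x, hx, -⟩ := exists_ellOne_of_mem hg.1
      have hxJ : ellFun x ∈ J := hJ.congr hg fun z hz => (hx z hz).symm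
      have hz' : l⁻¹ * z ∈ ball (0 : ℂ) 1 := by simpa [hl1] using hz
      have h := hcA (fun n => x n * l ^ n) ⟨x, hxJ, fun z hz => by rw [← hx z hz]; exact hg1 z hz,
        fun n => rfl⟩ (l⁻¹ * z) hz'
      rw [hAsum x _ (fun n => rfl), mul_inv_cancel_left₀ hl0,
        ← hx z (ball_subset_closedBall hz), norm_mul, norm_inv, hl1, inv_one, one_mul] at h
      have h2 : ‖1 - l⁻¹ * z‖ = ‖l - z‖ := by
        rw [show l - z = l * (1 - l⁻¹ * z) by rw [mul_sub, mul_inv_cancel_left₀ hl0, mul_one],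
          norm_mul, hl1, one_mul]
      rwa [h2] at h
  obtain ⟨x, hx⟩ := hPs (resolventCoeff T' ρ 0 (P one))
  have hT'x : T' (P x) = P x := by
    have h := congrArg (fun B : X →L[ℂ] X => B (P one)) hproj
    simpa [sub_eq_zero, ← hx] using h
  have hTx : P (ellShift x) = l • P x := by
    rw [← hP, ← hT'x, hT', smul_apply, smul_smul, mul_inv_cancel₀ hl0, one_smul, ← smul_apply,
      ← hT', hT'x]
  obtain ⟨χ, hχ⟩ := hPχ (ellEval l hlJ.1) fun x hx => by
    rw [ellEval_apply]
    exact hlJ.2 _ hx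
  have hχT : ∀ v, χ (T' v) = χ v := by
    intro v
    obtain ⟨y, rfl⟩ := hPs v
    rw [hT', smul_apply, hP, map_smul, hχ, hχ, ellEval_apply, ellEval_apply,
      ellFun_shift y hlJ.1, smul_eq_mul, inv_mul_cancel_left₀ hl0]
  have hχx : χ (P x) = 1 := by
    rw [hx, functional_resolventCoeff χ hχT hres hρ, hχ, ellEval_apply, hone l hlJ.1]
  have hPx : P x ≠ 0 := by
    intro h
    rw [h, map_zero] at hχx
    exact zero_ne_one hχx
  refine hPx ((hP0 x).2 ⟨ellFun_mem x, ?_⟩)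
  obtain ⟨φ, hφ, -⟩ := exists_ellOne_of_mem hf
  have hshift : ellFun (ellShift x - l • x) ∈ J := by
    rw [← hP0, map_sub, map_smul, hTx, sub_self]
  obtain ⟨Y, _, _, _, S, Q, hS, -, hQ, hQ0, -⟩ := exists_ideal_quotient hI hne
  have hprod : ∀ y, ellFun y ∈ J → Q (ellMul φ y) = 0 := by
    intro y hy
    rw [hQ0]
    refine hI.congr hy.2 fun z hz => ?_
    rw [ellFun_mul φ y hz, Pi.mul_apply, hφ z hz]
  set y := Q (ellMul φ x) with hy
  have hy0 : y = 0 := by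
    refine eq_zero_of_fixed_of_tsum_eq_zero (τ := l⁻¹ • S) (c := fun n => φ n * l ^ n)
      (v := Q x) ?_ ?_ ?_ ?_ ?_
    · rw [norm_smul, norm_inv, hl1]
      simpa using hS
    · refine φ.summable.congr fun n => ?_
      rw [norm_mul, norm_pow, hl1, one_pow, mul_one]
    · change ellFun φ l = 0
      rw [← hφ l hlJ.1]
      exact hvan l ⟨hhull hlJ, by simpa using hl1⟩
    · refine (hasSum_smul_pow_apply hQ φ x).congr_fun fun n => ?_
      rw [smul_pow, smul_apply, smul_smul, mul_assoc, ← mul_pow, mul_inv_cancel₀ hl0, one_pow,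
        mul_one]
    · have h1 := hprod _ hshift
      have h2 : Q (ellMul φ (ellShift x)) = S y := by
        rw [hy, hQ]
        rw [← sub_eq_zero, ← map_sub, hQ0]
        refine hI.congr (hI.2.2.1 _ (const_mem_APlus 0) _ hne.some_mem) fun z hz => ?_
        rw [ellFun_sub _ _ hz, ellFun_mul _ _ hz, ellFun_shift _ hz,
          ellFun_shift _ hz, ellFun_mul _ _ hz, Pi.mul_apply]
        ring
      rw [map_sub, map_sub, h2, map_smul, map_smul, ← hy, sub_eq_zero] at h1
      rw [smul_apply, h1, smul_smul, inv_mul_cancel₀ hl0, one_smul]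
  rw [hy, hQ0] at hy0
  refine hI.congr hy0 fun z hz => ?_
  rw [ellFun_mul φ x hz, Pi.mul_apply, hφ z hz]

theorem continuousOn_of_mem_APlus {f : ℂ → ℂ} (hf : f ∈ APlus) :
    ContinuousOn f (closedBall 0 1) := by
  obtain ⟨a, ha, h⟩ := hf
  exact (continuousOn_tsum_coeff ha).congr fun z hz => (h z hz).tsum_eq.symm

theorem differentiableOn_of_mem_APlus {f : ℂ → ℂ} (hf : f ∈ APlus) :
    DifferentiableOn ℂ f (ball 0 1) := by
  obtain ⟨a, ha, h⟩ := hf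
  exact (differentiableOn_tsum_coeff ha).congr
    fun z hz => (h z (ball_subset_closedBall hz)).tsum_eq.symm

theorem integral_zpow_eq (k : ℤ) :
    (2 * Real.pi * Complex.I : ℂ)⁻¹ * (∮ z in C(0, 1), z ^ k) = if k = -1 then 1 else 0 := by
  split_ifs with h
  · subst h
    have := circleIntegral.integral_sub_center_inv (0 : ℂ) (R := 1) one_ne_zero
    simp only [sub_zero] at this
    simp only [zpow_neg_one, this]
    exact inv_mul_cancel₀ (by simp [Real.pi_ne_zero])
  · have := circleIntegral.integral_sub_zpow_of_ne h 0 0 1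
    simp only [sub_zero] at this
    rw [this, mul_zero]

theorem hasSum_circleIntegral_of_hasSum_zpow {P : ℂ → ℂ} {ι : Type*} [Countable ι] {b : ι → ℂ}
    {m : ι → ℤ} (hb : Summable fun i => ‖b i‖)
    (h : ∀ z ∈ sphere (0 : ℂ) 1, HasSum (fun i => b i * z ^ m i) (P z)) :
    HasSum (fun i => b i * ∮ z in C(0, 1), z ^ m i) (∮ z in C(0, 1), P z) := by
  have hsph : ∀ θ, circleMap 0 1 θ ∈ sphere (0 : ℂ) 1 := circleMap_mem_sphere 0 zero_le_one
  have hne : ∀ θ, circleMap 0 1 θ ≠ 0 := fun θ => by simp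
  have h1 : HasSum (fun i => ∮ z in C(0, 1), b i * z ^ m i) (∮ z in C(0, 1), P z) := by
    refine intervalIntegral.hasSum_integral_of_dominated_convergence (fun i _ => ‖b i‖) ?_ ?_ ?_
      ?_ ?_
    · intro i
      refine Continuous.aestronglyMeasurable ?_
      have : Continuous fun θ => circleMap 0 1 θ ^ m i :=
        (continuous_circleMap 0 1).zpow₀ _ fun θ => Or.inl (hne θ)
      simp only [deriv_circleMap]
      fun_prop
    · refine fun i => Eventually.of_forall fun θ _ => ?_
      simp
    · exact Eventually.of_forall fun θ _ => hb
    · exact intervalIntegrable_const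
    · exact Eventually.of_forall fun θ _ => (h _ (hsph θ)).const_smul _
  simpa only [circleIntegral.integral_const_mul] using h1

/-- A function in the disc algebra whose boundary values have an absolutely convergent expansion
in powers of `z` (positive or negative) belongs to `A⁺`. -/
theorem mem_APlus_of_hasSum_zpow {P : ℂ → ℂ} (hc : ContinuousOn P (closedBall 0 1))
    (hd : DifferentiableOn ℂ P (ball 0 1)) {ι : Type*} [Countable ι] {b : ι → ℂ} {m : ι → ℤ}
    (hb : Summable fun i => ‖b i‖)
    (h : ∀ z ∈ sphere (0 : ℂ) 1, HasSum (fun i => b i * z ^ m i) (P z)) : P ∈ APlus := by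
  classical
  have hb' : ∀ n : ℕ, Summable fun i => ‖if m i = n then b i else 0‖ := fun n =>
    Summable.of_norm_bounded hb fun i => by
      rw [norm_norm]
      split_ifs <;> simp
  set c : ℕ → ℂ := fun n => ∑' i, if m i = n then b i else 0 with hcdef
  have hInt : ∀ n : ℕ, (2 * Real.pi * Complex.I : ℂ)⁻¹ *
      (∮ z in C(0, 1), (1 / (z - 0)) ^ n • (z - 0)⁻¹ • P z) = c n := by
    intro n
    have h1 : ∀ z ∈ sphere (0 : ℂ) 1, HasSum (fun i => b i * z ^ (m i - n - 1))
        ((1 / (z - 0)) ^ n • (z - 0)⁻¹ • P z) := by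
      intro z hz
      have hz0 : z ≠ 0 := by
        rintro rfl
        simp at hz
      have h2 := ((h z hz).const_smul (z - 0)⁻¹).const_smul ((1 / (z - 0)) ^ n)
      refine h2.congr_fun fun i => ?_
      rw [zpow_sub₀ hz0, zpow_sub₀ hz0, zpow_natCast, zpow_one]
      simp only [sub_zero, smul_eq_mul, div_eq_mul_inv]
      ring
    have h3 := (hasSum_circleIntegral_of_hasSum_zpow hb h1).mul_left
      (2 * Real.pi * Complex.I : ℂ)⁻¹
    rw [← h3.tsum_eq, hcdef]
    congr 1
    ext1 i
    rw [mul_left_comm, integral_zpow_eq]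
    by_cases hi : m i = n
    · simp [hi]
    · rw [if_neg hi, if_neg (by omega), mul_zero]
  have hcs : Summable fun n => ‖c n‖ := by
    refine summable_of_sum_le (c := ∑' i, ‖b i‖) (fun _ => norm_nonneg _) fun u => ?_
    calc ∑ n ∈ u, ‖c n‖ ≤ ∑ n ∈ u, ∑' i, ‖if m i = n then b i else 0‖ :=
          Finset.sum_le_sum fun n _ => norm_tsum_le_tsum_norm (hb' n)
      _ = ∑' i, ∑ n ∈ u, ‖if m i = n then b i else 0‖ := (Summable.tsum_finsetSum
          fun n _ => hb' n).symm
      _ ≤ ∑' i, ‖b i‖ := by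
        refine Summable.tsum_le_tsum (fun i => ?_) (summable_sum fun n _ => hb' n) hb
        by_cases hi : ∃ n ∈ u, m i = (n : ℤ)
        · obtain ⟨n, hn, hmn⟩ := hi
          rw [Finset.sum_eq_single_of_mem n hn fun k _ hk => ?_]
          · simp [hmn]
          · rw [if_neg, norm_zero]
            omega
        · push Not at hi
          rw [Finset.sum_eq_zero fun n hn => by rw [if_neg (hi n hn), norm_zero]]
          exact norm_nonneg _
  have hps := DiffContOnCl.hasFPowerSeriesOnBall (R := 1) (c := 0)
    (by simpa using DiffContOnCl.mk_ball hd hc) one_pos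
  have hball : ∀ z ∈ ball (0 : ℂ) 1, HasSum (fun n => c n * z ^ n) (P z) := by
    intro z hz
    have h1 := hps.hasSum_sub (y := z) (by
      have hz1 : ‖z‖ < 1 := by simpa using hz
      have : ‖z‖ₑ < 1 := by rwa [← ofReal_norm, ENNReal.ofReal_lt_one]
      simpa using this)
    refine h1.congr_fun fun n => ?_
    have h2 : (cauchyPowerSeries P 0 ((1 : NNReal) : ℝ) n) (fun _ => z - 0) =
        z ^ n • (cauchyPowerSeries P 0 ((1 : NNReal) : ℝ) n) (fun _ => 1) := by
      simp
    rw [h2, cauchyPowerSeries_apply, NNReal.coe_one, smul_eq_mul, smul_eq_mul, hInt, mul_comm]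
  refine ⟨c, hcs, fun z hz => ?_⟩
  have heq : EqOn (fun z => ∑' n, c n * z ^ n) P (closedBall 0 1) :=
    Set.EqOn.of_subset_closure (s := ball 0 1) (fun z hz => (hball z hz).tsum_eq)
      (continuousOn_tsum_coeff hcs) hc ball_subset_closedBall
      (by rw [closure_ball _ one_ne_zero])
  rw [← heq hz]
  exact (summable_coeff_mul_pow hcs hz).hasSum

theorem hasSum_mul_of_summable_norm {ι κ : Type*} {f : ι → ℂ} {g : κ → ℂ} {s t : ℂ}
    (hf : HasSum f s) (hg : HasSum g t) (hf' : Summable fun i => ‖f i‖)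
    (hg' : Summable fun i => ‖g i‖) : HasSum (fun i : ι × κ => f i.1 * g i.2) (s * t) :=
  hf.mul hg (summable_mul_of_summable_norm hf' hg')

/-- Division of an element of `A⁺` by a zero in the open disc. -/
theorem exists_eq_sub_mul_of_mem_APlus {h : ℂ → ℂ} (hh : h ∈ APlus) {w : ℂ}
    (hw : w ∈ ball (0 : ℂ) 1) (hhw : h w = 0) :
    ∃ k ∈ APlus, ∀ z ∈ closedBall (0 : ℂ) 1, h z = (z - w) * k z := by
  have hk : ∀ z, h z = (z - w) * dslope h w z := fun z => by
    have := sub_smul_dslope h w z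
    rw [hhw, sub_zero, smul_eq_mul] at this
    exact this.symm
  refine ⟨dslope h w, ?_, fun z _ => hk z⟩
  have hhd := differentiableOn_of_mem_APlus hh
  have hnhds : ball (0 : ℂ) 1 ∈ nhds w := isOpen_ball.mem_nhds hw
  have hw' : ‖w‖ < 1 := by simpa using hw
  obtain ⟨a, ha, hs⟩ := hh
  refine mem_APlus_of_hasSum_zpow (ι := ℕ × ℕ) (b := fun i => a i.1 * w ^ i.2)
    (m := fun i => (i.1 : ℤ) - i.2 - 1)
    ((continuousOn_dslope (mem_of_superset hnhds ball_subset_closedBall)).2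
      ⟨continuousOn_of_mem_APlus ⟨a, ha, hs⟩, hhd.differentiableAt hnhds⟩)
    ((Complex.differentiableOn_dslope hnhds).2 hhd) ?_ ?_
  · exact Summable.mul_norm ha (summable_norm_geometric_of_norm_lt_one hw')
  · intro z hz
    have hz1 : ‖z‖ = 1 := by simpa using hz
    have hz0 : z ≠ 0 := by
      rintro rfl
      simp at hz1
    have hzw : z - w ≠ 0 := by
      rw [sub_ne_zero]
      rintro rfl
      linarith
    have hwz : ‖w / z‖ < 1 := by rwa [norm_div, hz1, div_one]
    have h1 := (hasSum_geometric_of_norm_lt_one hwz).mul_right z⁻¹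
    have h2 : (1 - w / z)⁻¹ * z⁻¹ = (z - w)⁻¹ := by
      rw [← mul_inv, sub_mul, one_mul, div_mul_cancel₀ _ hz0]
    have hzc : z ∈ closedBall (0 : ℂ) 1 := sphere_subset_closedBall hz
    have h3 : Summable fun n => ‖a n * z ^ n‖ := by
      refine ha.congr fun n => ?_
      rw [norm_mul, norm_pow, hz1, one_pow, mul_one]
    have h4 : Summable fun n => ‖(w / z) ^ n * z⁻¹‖ := by
      simp only [norm_mul]
      exact (summable_norm_geometric_of_norm_lt_one hwz).mul_right _
    have h5 := hasSum_mul_of_summable_norm (hs z hzc) h1 h3 h4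
    have h6 : h z * ((1 - w / z)⁻¹ * z⁻¹) = dslope h w z := by
      rw [h2, hk z, mul_comm, inv_mul_cancel_left₀ hzw]
    rw [← h6]
    refine h5.congr_fun fun i => ?_
    rw [zpow_sub₀ hz0, zpow_sub₀ hz0, zpow_natCast, zpow_natCast, zpow_one, div_pow]
    simp only [div_eq_mul_inv]
    ring

theorem InnerDivides.trans {S T f : ℂ → ℂ} (h1 : InnerDivides S T) (h2 : InnerDivides T f) :
    InnerDivides S f := by
  obtain ⟨g, ⟨hg, C, hC⟩, hSg⟩ := h1
  obtain ⟨k, ⟨hk, D, hD⟩, hTk⟩ := h2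
  refine ⟨g * k, ⟨hg.mul hk, C * D, fun z hz => ?_⟩, fun z hz => ?_⟩
  · rw [Pi.mul_apply, norm_mul]
    exact mul_le_mul (hC z hz) (hD z hz) (norm_nonneg _) ((norm_nonneg _).trans (hC z hz))
  · rw [hTk z hz, hSg z hz, Pi.mul_apply, mul_assoc]

/-- The elementary Blaschke factor. -/
def blaschkeFactor (w z : ℂ) : ℂ := (z - w) / (1 - (starRingEnd ℂ) w * z)

theorem one_sub_conj_mul_ne_zero {w z : ℂ} (hw : ‖w‖ < 1) (hz : ‖z‖ ≤ 1) :
    1 - (starRingEnd ℂ) w * z ≠ 0 := by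
  intro h
  have h1 : ‖(starRingEnd ℂ) w * z‖ = 1 := by
    rw [← sub_eq_zero.1 h, norm_one]
  rw [norm_mul, RCLike.norm_conj] at h1
  nlinarith [norm_nonneg w, norm_nonneg z]

theorem normSq_one_sub_conj_mul (w z : ℂ) :
    ‖1 - (starRingEnd ℂ) w * z‖ ^ 2 - ‖z - w‖ ^ 2 = (1 - ‖w‖ ^ 2) * (1 - ‖z‖ ^ 2) := by
  simp only [← Complex.normSq_eq_norm_sq, Complex.normSq_apply]
  simp
  ring

theorem norm_blaschkeFactor_le {w z : ℂ} (hw : ‖w‖ < 1) (hz : ‖z‖ ≤ 1) :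
    ‖blaschkeFactor w z‖ ≤ 1 := by
  have h0 : 0 < ‖1 - (starRingEnd ℂ) w * z‖ := norm_pos_iff.2 (one_sub_conj_mul_ne_zero hw hz)
  rw [blaschkeFactor, norm_div, div_le_one h0]
  refine le_of_sq_le_sq ?_ h0.le
  have h1 : 0 ≤ (1 - ‖w‖ ^ 2) * (1 - ‖z‖ ^ 2) := by
    apply mul_nonneg <;> nlinarith [norm_nonneg w, norm_nonneg z]
  linarith [normSq_one_sub_conj_mul w z]

theorem norm_blaschkeFactor_eq {w z : ℂ} (hw : ‖w‖ < 1) (hz : ‖z‖ = 1) :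
    ‖blaschkeFactor w z‖ = 1 := by
  have h0 : 0 < ‖1 - (starRingEnd ℂ) w * z‖ := norm_pos_iff.2 (one_sub_conj_mul_ne_zero hw hz.le)
  rw [blaschkeFactor, norm_div, div_eq_one_iff_eq h0.ne']
  rw [← sq_eq_sq₀ (norm_nonneg _) h0.le]
  have h1 := normSq_one_sub_conj_mul w z
  rw [hz] at h1
  linarith

theorem isInnerFunction_blaschkeFactor_pow {w : ℂ} (hw : ‖w‖ < 1) (k : ℕ) :
    IsInnerFunction fun z => blaschkeFactor w z ^ k := by
  refine ⟨?_, fun z hz => ?_, Eventually.of_forall fun θ => ?_⟩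
  · refine DifferentiableOn.pow (DifferentiableOn.div (by fun_prop) (by fun_prop) fun z hz => ?_) k
    exact one_sub_conj_mul_ne_zero hw (by simpa using (ball_subset_closedBall hz))
  · rw [norm_pow]
    exact pow_le_one₀ (norm_nonneg _)
      (norm_blaschkeFactor_le hw (by simpa using (ball_subset_closedBall hz)))
  · have he : ‖Complex.exp ((θ : ℂ) * Complex.I)‖ = 1 := Complex.norm_exp_ofReal_mul_I θ
    have hc : ContinuousAt (fun r : ℝ =>
        ‖blaschkeFactor w ((r : ℂ) * Complex.exp ((θ : ℂ) * Complex.I)) ^ k‖) 1 := by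
      refine (ContinuousAt.pow (ContinuousAt.div (by fun_prop) (by fun_prop) ?_) k).norm
      simpa using one_sub_conj_mul_ne_zero hw he.le
    have h1 := hc.tendsto
    simp only [ofReal_one, one_mul, norm_pow, norm_blaschkeFactor_eq hw he, one_pow] at h1
    simp only [norm_pow]
    exact h1.mono_left nhdsWithin_le_nhds

theorem exists_norm_le_of_mem_APlus {f : ℂ → ℂ} (hf : f ∈ APlus) :
    ∃ C, 0 < C ∧ ∀ z ∈ closedBall (0 : ℂ) 1, ‖f z‖ ≤ C := by
  obtain ⟨C, hC⟩ := (isCompact_closedBall (0 : ℂ) 1).exists_bound_of_continuousOn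
    (continuousOn_of_mem_APlus hf)
  exact ⟨max C 1, by positivity, fun z hz => (hC z hz).trans (le_max_left _ _)⟩

theorem innerDivides_blaschkeFactor_pow {w : ℂ} (hw : ‖w‖ < 1) {k : ℕ} {h h₁ : ℂ → ℂ}
    (hh : h₁ ∈ APlus) (heq : ∀ z ∈ closedBall (0 : ℂ) 1, h z = (z - w) ^ k * h₁ z) :
    InnerDivides (fun z => blaschkeFactor w z ^ k) h := by
  obtain ⟨C, -, hC⟩ := exists_norm_le_of_mem_APlus hh
  refine ⟨fun z => (1 - (starRingEnd ℂ) w * z) ^ k * h₁ z,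
    ⟨DifferentiableOn.mul (by fun_prop) (differentiableOn_of_mem_APlus hh), 2 ^ k * C,
      fun z hz => ?_⟩, fun z hz => ?_⟩
  · have hz1 : ‖z‖ < 1 := by simpa using hz
    rw [norm_mul, norm_pow]
    have h1 : ‖1 - (starRingEnd ℂ) w * z‖ ≤ 2 := by
      refine (norm_sub_le _ _).trans ?_
      rw [norm_one, norm_mul, RCLike.norm_conj]
      nlinarith [norm_nonneg w, norm_nonneg z]
    exact mul_le_mul (pow_le_pow_left₀ (norm_nonneg _) h1 k) (hC z (ball_subset_closedBall hz))
      (norm_nonneg _) (by positivity)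
  · have h0 := one_sub_conj_mul_ne_zero hw (z := z) (by simpa using (ball_subset_closedBall hz))
    simp only [heq z (ball_subset_closedBall hz), blaschkeFactor]
    rw [← mul_assoc, ← mul_pow, div_mul_cancel₀ _ h0]

theorem exists_eq_pow_mul_of_innerDivides {w : ℂ} (hw : ‖w‖ < 1) {h : ℂ → ℂ} (hh : h ∈ APlus)
    {k : ℕ} (hdiv : InnerDivides (fun z => blaschkeFactor w z ^ k) h) :
    ∃ h₁ ∈ APlus, ∀ z ∈ closedBall (0 : ℂ) 1, h z = (z - w) ^ k * h₁ z := by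
  have hwb : w ∈ ball (0 : ℂ) 1 := by simpa using hw
  induction k with
  | zero => exact ⟨h, hh, fun z _ => by simp⟩
  | succ k ih =>
    obtain ⟨g, ⟨hg, hgb⟩, hhg⟩ := hdiv
    have hbd : DifferentiableOn ℂ (blaschkeFactor w) (ball 0 1) := by
      simpa using (isInnerFunction_blaschkeFactor_pow hw 1).1
    obtain ⟨h₁, hh₁, heq⟩ := ih ⟨fun z => blaschkeFactor w z * g z, ⟨hbd.mul hg, by
      obtain ⟨C, hC⟩ := hgb
      refine ⟨1 * C, fun z hz => ?_⟩
      rw [norm_mul]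
      exact mul_le_mul (norm_blaschkeFactor_le hw (by simpa using (ball_subset_closedBall hz)))
        (hC z hz) (norm_nonneg _) zero_le_one⟩, fun z hz => by
      simp only [hhg z hz, pow_succ, mul_assoc]⟩
    have hw0 : h₁ w = 0 := by
      have hnh : ball (0 : ℂ) 1 ∈ nhds w := isOpen_ball.mem_nhds hwb
      have h1 : ContinuousAt h₁ w :=
        ((differentiableOn_of_mem_APlus hh₁).differentiableAt hnh).continuousAt
      have h2 : ContinuousAt (fun z => blaschkeFactor w z * g z /
          (1 - (starRingEnd ℂ) w * z) ^ k) w := by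
        refine ContinuousAt.div ((hbd.differentiableAt hnh).continuousAt.mul
          (hg.differentiableAt hnh).continuousAt) (by fun_prop)
          (pow_ne_zero _ (one_sub_conj_mul_ne_zero hw hw.le))
      have h3 : ∀ᶠ z in nhdsWithin w {w}ᶜ, h₁ z =
          blaschkeFactor w z * g z / (1 - (starRingEnd ℂ) w * z) ^ k := by
        filter_upwards [self_mem_nhdsWithin, nhdsWithin_le_nhds hnh] with z hzw hz
        have h4 : z - w ≠ 0 := sub_ne_zero.2 hzw
        have h5 := one_sub_conj_mul_ne_zero hw (z := z)
          (by simpa using (ball_subset_closedBall hz))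
        have h6 := heq z (ball_subset_closedBall hz)
        simp only [hhg z hz, pow_succ, blaschkeFactor, div_pow] at h6
        rw [eq_div_iff (pow_ne_zero _ h5), blaschkeFactor]
        refine mul_left_cancel₀ (pow_ne_zero k h4) ?_
        rw [← mul_assoc, ← h6]
        generalize 1 - (starRingEnd ℂ) w * z = d at h5
        field_simp
      have h7 := tendsto_nhds_unique_of_eventuallyEq (h1.tendsto.mono_left nhdsWithin_le_nhds)
        (h2.tendsto.mono_left (nhdsWithin_le_nhds (s := {w}ᶜ))) h3
      rw [h7]
      simp [blaschkeFactor]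
    obtain ⟨h₂, hh₂, heq₂⟩ := exists_eq_sub_mul_of_mem_APlus hh₁ hwb hw0
    refine ⟨h₂, hh₂, fun z hz => ?_⟩
    rw [heq z hz, heq₂ z hz, pow_succ, mul_assoc]

theorem exists_not_pow_mul {g : ℂ → ℂ} (hg : g ∈ APlus) (hg0 : ∃ z ∈ ball (0 : ℂ) 1, g z ≠ 0)
    {w : ℂ} (hw : ‖w‖ < 1) :
    ∃ k : ℕ, ¬ ∃ h ∈ APlus, ∀ z ∈ closedBall (0 : ℂ) 1, g z = (z - w) ^ k * h z := by
  by_contra hcon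
  push Not at hcon
  have hwb : w ∈ ball (0 : ℂ) 1 := by simpa using hw
  have hnh : ball (0 : ℂ) 1 ∈ nhds w := isOpen_ball.mem_nhds hwb
  have han : AnalyticOnNhd ℂ g (ball 0 1) :=
    (differentiableOn_of_mem_APlus hg).analyticOnNhd isOpen_ball
  have htop : analyticOrderAt g w = ⊤ := by
    rw [ENat.eq_top_iff_forall_ge]
    intro n
    rw [natCast_le_analyticOrderAt (han w hwb)]
    obtain ⟨h, hh, heq⟩ := hcon n
    refine ⟨h, (differentiableOn_of_mem_APlus hh).analyticOnNhd isOpen_ball w hwb, ?_⟩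
    filter_upwards [hnh] with z hz
    rw [heq z (ball_subset_closedBall hz), smul_eq_mul]
  obtain ⟨z, hz, hgz⟩ := hg0
  exact hgz (han.eqOn_zero_of_preconnected_of_eventuallyEq_zero
    (convex_ball (0 : ℂ) 1).isPreconnected hwb (analyticOrderAt_eq_top.1 htop) hz)

theorem exists_mem_Idiv_ne_zero {I : Set (ℂ → ℂ)} (hI : IsClosedIdealAPlus I)
    (hne : NontrivialIdeal I) {SI : ℂ → ℂ} (hSI : IsGcdInner I SI) {f : ℂ → ℂ} (hf : f ∈ APlus)
    (hdiv : InnerDivides SI f) {w : ℂ} (hw : w ∈ ball (0 : ℂ) 1) : ∃ g ∈ Idiv I f, g w ≠ 0 := by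
  classical
  have hw1 : ‖w‖ < 1 := by simpa using hw
  have hex : ∃ k : ℕ, ∃ g ∈ I,
      ¬ ∃ h ∈ APlus, ∀ z ∈ closedBall (0 : ℂ) 1, g z = (z - w) ^ k * h z := by
    obtain ⟨g, hg, hg0⟩ := hne
    obtain ⟨k, hk⟩ := exists_not_pow_mul (hI.1 hg) hg0 hw1
    exact ⟨k, g, hg, hk⟩
  have hmin : ∀ m < Nat.find hex, ∀ g ∈ I,
      ∃ h ∈ APlus, ∀ z ∈ closedBall (0 : ℂ) 1, g z = (z - w) ^ m * h z := fun m hm g hg =>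
    by_contra fun hcon => Nat.find_min hex hm ⟨g, hg, hcon⟩
  obtain ⟨g, hg, hgn⟩ := Nat.find_spec hex
  obtain ⟨k, hk⟩ : ∃ k, Nat.find hex = k + 1 := by
    refine Nat.exists_eq_succ_of_ne_zero fun h => ?_
    rw [h] at hgn
    exact hgn ⟨g, hI.1 hg, fun z _ => by simp⟩
  rw [hk] at hgn hmin
  have hkI : ∀ f ∈ I, (∃ z ∈ ball (0 : ℂ) 1, f z ≠ 0) →
      InnerDivides (fun z => blaschkeFactor w z ^ k) f := fun f hf _ => by
    obtain ⟨h, hh, heq⟩ := hmin k k.lt_succ_self f hf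
    exact innerDivides_blaschkeFactor_pow hw1 hh heq
  obtain ⟨f₁, hf₁, hff₁⟩ := exists_eq_pow_mul_of_innerDivides hw1 hf
    ((hSI.2.2 _ (isInnerFunction_blaschkeFactor_pow hw1 k) hkI).trans hdiv)
  obtain ⟨g₁, hg₁, hgg₁⟩ := hmin k k.lt_succ_self g hg
  refine ⟨g₁, ⟨hg₁, ?_⟩, fun h0 => hgn ?_⟩
  · refine hI.congr (hI.2.2.1 _ hf₁ _ hg) fun z hz => ?_
    rw [Pi.mul_apply, Pi.mul_apply, hff₁ z hz, hgg₁ z hz]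
    ring
  · obtain ⟨g₂, hg₂, hgg₂⟩ := exists_eq_sub_mul_of_mem_APlus hg₁ hw h0
    refine ⟨g₂, hg₂, fun z hz => ?_⟩
    rw [hgg₁ z hz, hgg₂ z hz, pow_succ, mul_assoc]

theorem norm_atomInner {p : ℂ} (hp : ‖p‖ = 1) (a : ℝ) (z : ℂ) :
    ‖atomInner a p z‖ = Real.exp (-(a * ((1 - ‖z‖ ^ 2) / ‖p - z‖ ^ 2))) := by
  rw [atomInner, Complex.norm_exp, Complex.re_ofReal_mul, Complex.div_re, ← add_div,
    norm_sub_rev, ← Complex.normSq_eq_norm_sq, ← Complex.normSq_eq_norm_sq]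
  have h1 : Complex.normSq p = 1 := by rw [Complex.normSq_eq_norm_sq, hp, one_pow]
  congr 1
  rw [← mul_neg, ← neg_div, ← h1]
  congr 2
  simp only [Complex.add_re, Complex.sub_re, Complex.add_im, Complex.sub_im,
    Complex.normSq_apply]
  ring

theorem atomInner_mul_neg (a : ℝ) (p z : ℂ) : atomInner a p z * atomInner (-a) p z = 1 := by
  rw [atomInner, atomInner, ← Complex.exp_add]
  simp

theorem continuousAt_atomInner (a : ℝ) {p z : ℂ} (hz : z ≠ p) : ContinuousAt (atomInner a p) z := by
  have : z - p ≠ 0 := sub_ne_zero.2 hz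
  unfold atomInner
  fun_prop (disch := assumption)

theorem differentiableOn_atomInner (a : ℝ) {p : ℂ} (hp : ‖p‖ = 1) :
    DifferentiableOn ℂ (atomInner a p) (ball 0 1) := by
  intro z hz
  have : z - p ≠ 0 := by
    rw [sub_ne_zero]
    rintro rfl
    simp [hp] at hz
  refine DifferentiableAt.differentiableWithinAt ?_
  unfold atomInner
  fun_prop (disch := assumption)

theorem norm_atomInner_of_norm_eq_one {p z : ℂ} (hp : ‖p‖ = 1) (hz : ‖z‖ = 1) (a : ℝ) :
    ‖atomInner a p z‖ = 1 := by
  rw [norm_atomInner hp, hz]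
  simp

theorem norm_atomInner_le_one {p z : ℂ} (hp : ‖p‖ = 1) (hz : ‖z‖ ≤ 1) {a : ℝ} (ha : 0 ≤ a) :
    ‖atomInner a p z‖ ≤ 1 := by
  rw [norm_atomInner hp, Real.exp_le_one_iff, neg_nonpos]
  have : 0 ≤ 1 - ‖z‖ ^ 2 := by nlinarith [norm_nonneg z]
  positivity

theorem isInnerFunction_atomInner {p : ℂ} (hp : ‖p‖ = 1) {a : ℝ} (ha : 0 ≤ a) :
    IsInnerFunction (atomInner a p) := by
  refine ⟨differentiableOn_atomInner a hp, fun z hz => norm_atomInner_le_one hp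
    (by simpa using ball_subset_closedBall hz) ha, ?_⟩
  have hcount : {θ : ℝ | Complex.exp ((θ : ℂ) * Complex.I) = p}.Countable := by
    rcases Set.eq_empty_or_nonempty {θ : ℝ | Complex.exp ((θ : ℂ) * Complex.I) = p} with h | h
    · rw [h]
      exact Set.countable_empty
    · obtain ⟨θ₀, h₀⟩ := h
      refine (Set.countable_range fun n : ℤ => θ₀ + n * (2 * Real.pi)).mono fun θ hθ => ?_
      obtain ⟨n, hn⟩ := Complex.exp_eq_exp_iff_exists_int.1 (Eq.trans hθ (Eq.symm h₀))
      refine ⟨n, ?_⟩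
      have h1 : (θ : ℂ) = θ₀ + n * (2 * Real.pi) := by
        refine mul_right_cancel₀ Complex.I_ne_zero ?_
        rw [hn]
        ring
      exact_mod_cast h1.symm
  filter_upwards [hcount.ae_notMem _] with θ hθ
  have he : ‖Complex.exp ((θ : ℂ) * Complex.I)‖ = 1 := Complex.norm_exp_ofReal_mul_I θ
  have hc : ContinuousAt (fun r : ℝ =>
      ‖atomInner a p ((r : ℂ) * Complex.exp ((θ : ℂ) * Complex.I))‖) 1 := by
    refine ContinuousAt.norm (ContinuousAt.comp (g := atomInner a p) ?_ (by fun_prop))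
    refine continuousAt_atomInner a ?_
    simpa using hθ
  have h1 := hc.tendsto
  simp only [ofReal_one, one_mul, norm_atomInner_of_norm_eq_one hp he] at h1
  exact h1.mono_left nhdsWithin_le_nhds

/-- A function of the disc algebra with absolutely summable Taylor coefficients is in `A⁺`. -/
theorem mem_APlus_of_summable_taylorCoeff {P : ℂ → ℂ} (hc : ContinuousOn P (closedBall 0 1))
    (hd : DifferentiableOn ℂ P (ball 0 1)) (hs : Summable fun n => ‖taylorCoeff P n‖) :
    P ∈ APlus := by
  have hball : ∀ z ∈ ball (0 : ℂ) 1, HasSum (fun n => taylorCoeff P n * z ^ n) (P z) := by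
    intro z hz
    refine (Complex.hasSum_taylorSeries_on_ball hd hz).congr_fun fun n => ?_
    rw [taylorCoeff, sub_zero, smul_eq_mul, smul_eq_mul, div_eq_mul_inv]
    ring
  refine ⟨taylorCoeff P, hs, fun z hz => ?_⟩
  have heq : EqOn (fun z => ∑' n, taylorCoeff P n * z ^ n) P (closedBall 0 1) :=
    Set.EqOn.of_subset_closure (s := ball 0 1) (fun z hz => (hball z hz).tsum_eq)
      (continuousOn_tsum_coeff hs) hc ball_subset_closedBall
      (by rw [closure_ball _ one_ne_zero])
  rw [← heq hz]
  exact (summable_coeff_mul_pow hs hz).hasSum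

theorem norm_iteratedDeriv_le_of_bounded {Q : ℂ → ℂ} (hd : DifferentiableOn ℂ Q (ball 0 1))
    {C : ℝ} (hC : ∀ z ∈ ball (0 : ℂ) 1, ‖Q z‖ ≤ C) (n : ℕ) :
    ‖iteratedDeriv n Q 0‖ ≤ n.factorial * C := by
  have h1 : ∀ᶠ R : ℝ in nhdsWithin 1 (Iio 1),
      ‖iteratedDeriv n Q 0‖ ≤ n.factorial * C / R ^ n := by
    filter_upwards [self_mem_nhdsWithin, nhdsWithin_le_nhds (lt_mem_nhds (zero_lt_one' ℝ))]
      with R hR hR0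
    have hsub : closedBall (0 : ℂ) R ⊆ ball 0 1 := closedBall_subset_ball hR
    refine Complex.norm_iteratedDeriv_le_of_forall_mem_sphere_norm_le n hR0
      (DiffContOnCl.mk_ball (hd.mono (ball_subset_closedBall.trans hsub))
        (hd.continuousOn.mono hsub)) fun z hz => hC z (hsub (sphere_subset_closedBall hz))
  have h2 : ContinuousAt (fun R : ℝ => n.factorial * C / R ^ n) 1 := by
    refine ContinuousAt.div (by fun_prop) (by fun_prop) (by simp)
  have h3 := h2.tendsto.mono_left (nhdsWithin_le_nhds (s := Iio (1 : ℝ)))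
  simpa using ge_of_tendsto h3 h1

theorem mem_APlus_of_deriv_deriv_bounded {P : ℂ → ℂ} (hc : ContinuousOn P (closedBall 0 1))
    (hd : DifferentiableOn ℂ P (ball 0 1)) {C : ℝ}
    (hC : ∀ z ∈ ball (0 : ℂ) 1, ‖deriv (deriv P) z‖ ≤ C) : P ∈ APlus := by
  refine mem_APlus_of_summable_taylorCoeff hc hd ?_
  rw [← summable_nat_add_iff 2]
  have hb : ∀ n : ℕ, ‖taylorCoeff P (n + 2)‖ ≤ C * (1 / ((n + 1 : ℕ) : ℝ) ^ 2) := by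
    intro n
    have h1 := norm_iteratedDeriv_le_of_bounded ((hd.deriv isOpen_ball).deriv isOpen_ball) hC n
    rw [← iteratedDeriv_succ', ← iteratedDeriv_succ'] at h1
    have hC0 : 0 ≤ C := (norm_nonneg _).trans (hC 0 (by simp))
    rw [taylorCoeff, norm_div, Complex.norm_natCast, Nat.factorial_succ, Nat.factorial_succ]
    have h2 : (0 : ℝ) < n.factorial := by exact_mod_cast n.factorial_pos
    push_cast
    rw [div_le_iff₀ (by positivity)]
    refine h1.trans ?_
    have h3 : C * (1 / ((n : ℝ) + 1) ^ 2) * (((n : ℝ) + 1 + 1) * (((n : ℝ) + 1) * n.factorial)) =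
        n.factorial * C * (((n : ℝ) + 1 + 1) / ((n : ℝ) + 1)) := by
      field_simp
    rw [h3]
    refine le_mul_of_one_le_right (by positivity) ?_
    rw [one_le_div (by positivity)]
    linarith
  refine Summable.of_nonneg_of_le (fun _ => norm_nonneg _) hb (Summable.mul_left C ?_)
  exact (summable_nat_add_iff (f := fun n : ℕ => 1 / (n : ℝ) ^ 2) 1).2
    (Real.summable_one_div_nat_pow.2 one_lt_two)

theorem hasDerivAt_atomInner (a : ℝ) {p z : ℂ} (hz : z ≠ p) :
    HasDerivAt (atomInner a p) (atomInner a p z * (-(2 * a * p) / (z - p) ^ 2)) z := by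
  have h : z - p ≠ 0 := sub_ne_zero.2 hz
  have h1 := ((((hasDerivAt_id z).add_const p).div ((hasDerivAt_id z).sub_const p) h).const_mul
    (a : ℂ)).cexp
  refine h1.congr_deriv ?_
  simp only [atomInner, id, Pi.div_apply]
  congr 1
  field_simp
  ring

theorem one_sub_pow_mul_atomInner_mem_APlus {m : ℝ} (hm : 0 ≤ m) :
    (fun v => (1 - v) ^ 4 * atomInner m 1 v) ∈ APlus := by
  have hne : ∀ v ∈ ball (0 : ℂ) 1, v ≠ 1 := by
    rintro v hv rfl
    simp at hv
  have hd1 : ∀ v ∈ ball (0 : ℂ) 1, HasDerivAt (fun v => (1 - v) ^ 4 * atomInner m 1 v)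
      (atomInner m 1 v * (-4 * (1 - v) ^ 3 - 2 * m * (1 - v) ^ 2)) v := by
    intro v hv
    have h0 : v - 1 ≠ 0 := sub_ne_zero.2 (hne v hv)
    have h1 := (((hasDerivAt_id v).const_sub 1).pow 4).mul (hasDerivAt_atomInner m (hne v hv))
    refine h1.congr_deriv ?_
    simp only [id, Pi.pow_apply]
    generalize atomInner m 1 v = E
    field_simp
    push_cast
    ring
  have hd2 : ∀ v ∈ ball (0 : ℂ) 1,
      HasDerivAt (fun v => atomInner m 1 v * (-4 * (1 - v) ^ 3 - 2 * m * (1 - v) ^ 2))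
      (atomInner m 1 v * (12 * (1 - v) ^ 2 + 12 * m * (1 - v) + 4 * m ^ 2)) v := by
    intro v hv
    have h0 : v - 1 ≠ 0 := sub_ne_zero.2 (hne v hv)
    have hs := (hasDerivAt_id v).const_sub 1
    have h1 := (hasDerivAt_atomInner m (hne v hv)).mul
      (((hs.pow 3).const_mul (-4)).sub ((hs.pow 2).const_mul (2 * m : ℂ)))
    refine h1.congr_deriv ?_
    simp only [id, Pi.pow_apply, Pi.sub_apply]
    generalize atomInner m 1 v = E
    field_simp
    push_cast
    ring
  refine mem_APlus_of_deriv_deriv_bounded (C := 48 + 24 * m + 4 * m ^ 2) ?_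
    (fun v hv => (hd1 v hv).differentiableAt.differentiableWithinAt) ?_
  · intro v hv
    by_cases h1 : v = 1
    · subst h1
      rw [ContinuousWithinAt, sub_self, zero_pow (by norm_num), zero_mul]
      have h2 : Tendsto (fun v : ℂ => ‖(1 - v) ^ 4‖) (nhdsWithin 1 (closedBall 0 1)) (nhds 0) := by
        have : ContinuousAt (fun v : ℂ => ‖(1 - v) ^ 4‖) 1 := by fun_prop
        simpa using this.tendsto.mono_left (nhdsWithin_le_nhds (s := closedBall (0 : ℂ) 1))
      refine squeeze_zero_norm' ?_ h2
      filter_upwards [self_mem_nhdsWithin] with v hv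
      rw [norm_mul]
      exact mul_le_of_le_one_right (norm_nonneg _)
        (norm_atomInner_le_one (by simp) (by simpa using hv) hm)
    · exact ContinuousAt.continuousWithinAt
        (ContinuousAt.mul (by fun_prop) (continuousAt_atomInner m h1))
  · intro v hv
    have hev : deriv (fun v => (1 - v) ^ 4 * atomInner m 1 v) =ᶠ[nhds v]
        fun v => atomInner m 1 v * (-4 * (1 - v) ^ 3 - 2 * m * (1 - v) ^ 2) := by
      filter_upwards [isOpen_ball.mem_nhds hv] with w hw
      exact (hd1 w hw).deriv
    rw [hev.deriv_eq, (hd2 v hv).deriv, norm_mul]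
    have hv1 : ‖v‖ ≤ 1 := by simpa using ball_subset_closedBall hv
    have h2 : ‖1 - v‖ ≤ 2 := (norm_sub_le _ _).trans (by rw [norm_one]; linarith)
    refine (mul_le_of_le_one_left (norm_nonneg _)
      (norm_atomInner_le_one (by simp) hv1 hm)).trans ?_
    refine (norm_add₃_le).trans ?_
    simp only [norm_mul, norm_pow, Complex.norm_real, Real.norm_of_nonneg hm]
    norm_num
    nlinarith [norm_nonneg (1 - v)]

/-- The quotient of `g` by a singular inner factor concentrated at `p`, regularised at `p`. -/
def atomQuot (p : ℂ) (m : ℝ) (g : ℂ → ℂ) (z : ℂ) : ℂ := (z - p) ^ 4 * (g z * atomInner (-m) p z)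

theorem norm_mul_atomInner_neg_le {p : ℂ} (hp : ‖p‖ = 1) {m : ℝ} {g : ℂ → ℂ} (hg : g ∈ APlus)
    (hdiv : InnerDivides (atomInner m p) g) :
    ∃ C, ∀ z ∈ closedBall (0 : ℂ) 1, ‖g z * atomInner (-m) p z‖ ≤ C := by
  obtain ⟨k, ⟨-, C, hC⟩, hk⟩ := hdiv
  obtain ⟨M, -, hM⟩ := exists_norm_le_of_mem_APlus hg
  refine ⟨max C M, fun z hz => ?_⟩
  have hz1 : ‖z‖ ≤ 1 := by simpa using hz
  rcases hz1.lt_or_eq with h | h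
  · have hzb : z ∈ ball (0 : ℂ) 1 := by simpa using h
    rw [hk z hzb, mul_right_comm, atomInner_mul_neg, one_mul]
    exact (hC z hzb).trans (le_max_left _ _)
  · rw [norm_mul, norm_atomInner_of_norm_eq_one hp h, mul_one]
    exact (hM z hz).trans (le_max_right _ _)

theorem continuousOn_atomQuot {p : ℂ} (hp : ‖p‖ = 1) {m : ℝ} {g : ℂ → ℂ} (hg : g ∈ APlus)
    (hdiv : InnerDivides (atomInner m p) g) : ContinuousOn (atomQuot p m g) (closedBall 0 1) := by
  obtain ⟨C, hC⟩ := norm_mul_atomInner_neg_le hp hg hdiv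
  intro z hz
  by_cases h1 : z = p
  · subst h1
    rw [ContinuousWithinAt, atomQuot, sub_self, zero_pow (by norm_num), zero_mul]
    have h2 : Tendsto (fun v : ℂ => ‖(v - z) ^ 4‖ * C) (nhdsWithin z (closedBall 0 1))
        (nhds 0) := by
      have : ContinuousAt (fun v : ℂ => ‖(v - z) ^ 4‖ * C) z := by fun_prop
      simpa using this.tendsto.mono_left (nhdsWithin_le_nhds (s := closedBall (0 : ℂ) 1))
    refine squeeze_zero_norm' ?_ h2
    filter_upwards [self_mem_nhdsWithin] with v hv
    rw [atomQuot, norm_mul]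
    exact mul_le_mul_of_nonneg_left (hC v hv) (norm_nonneg _)
  · exact ContinuousWithinAt.mul (by fun_prop) ((continuousOn_of_mem_APlus hg z hz).mul
      (continuousAt_atomInner (-m) h1).continuousWithinAt)

theorem differentiableOn_atomQuot {p : ℂ} (hp : ‖p‖ = 1) (m : ℝ) {g : ℂ → ℂ} (hg : g ∈ APlus) :
    DifferentiableOn ℂ (atomQuot p m g) (ball 0 1) :=
  DifferentiableOn.mul (by fun_prop)
    ((differentiableOn_of_mem_APlus hg).mul (differentiableOn_atomInner (-m) hp))

theorem atomInner_one_div {p z : ℂ} (hz0 : z ≠ 0) (m : ℝ) :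
    atomInner m 1 (p / z) = atomInner (-m) p z := by
  rw [atomInner, atomInner]
  by_cases hzp : z = p
  · subst hzp
    simp [div_self hz0]
  · have h4 : z - p ≠ 0 := sub_ne_zero.2 hzp
    have h5 : p - z ≠ 0 := sub_ne_zero.2 (Ne.symm hzp)
    have h6 : (p / z + 1) / (p / z - 1) = -((z + p) / (z - p)) := by
      have : p / z - 1 ≠ 0 := by
        rw [div_sub_one hz0]
        exact div_ne_zero h5 hz0
      rw [div_eq_iff this, ← neg_div, div_mul_eq_mul_div, eq_div_iff h4]
      field_simp
      ring
    rw [h6]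
    push_cast
    ring_nf

theorem atomQuot_eq_mul {p z : ℂ} (hz0 : z ≠ 0) (m : ℝ) (g : ℂ → ℂ) :
    atomQuot p m g z = z ^ 4 * (g z * ((1 - p / z) ^ 4 * atomInner m 1 (p / z))) := by
  rw [atomInner_one_div hz0, atomQuot]
  generalize atomInner (-m) p z = E
  field_simp

theorem atomQuot_mem_APlus {p : ℂ} (hp : ‖p‖ = 1) {m : ℝ} (hm : 0 ≤ m) {g : ℂ → ℂ}
    (hg : g ∈ APlus) (hdiv : InnerDivides (atomInner m p) g) : atomQuot p m g ∈ APlus := by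
  obtain ⟨a, ha, hga⟩ := id hg
  obtain ⟨s, hs, hHs⟩ := one_sub_pow_mul_atomInner_mem_APlus hm
  have hs' : Summable fun n => ‖s n * p ^ n‖ := by simpa [hp] using hs
  have hb : Summable fun i : ℕ × ℕ => ‖a i.1 * (s i.2 * p ^ i.2)‖ :=
    Summable.mul_norm (f := a) (g := fun n => s n * p ^ n) ha hs'
  refine mem_APlus_of_hasSum_zpow (ι := ℕ × ℕ) (b := fun i => a i.1 * (s i.2 * p ^ i.2))
    (m := fun i => (i.1 : ℤ) + 4 - i.2) (continuousOn_atomQuot hp hg hdiv)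
    (differentiableOn_atomQuot hp m hg) hb fun z hz => ?_
  have hz1 : ‖z‖ = 1 := by simpa using hz
  have hz0 : z ≠ 0 := norm_ne_zero_iff.1 (hz1 ▸ one_ne_zero)
  have hv : p / z ∈ closedBall (0 : ℂ) 1 := by simp [hp, hz1]
  have h1 := (hasSum_mul_of_summable_norm (hga z (sphere_subset_closedBall hz)) (hHs _ hv)
    (by simpa [hz1] using ha) (by simpa [hp, hz1] using hs)).mul_left (z ^ 4)
  rw [atomQuot_eq_mul hz0]
  refine h1.congr_fun fun i => ?_
  have h4 : z ^ ((i.1 : ℤ) + 4 - i.2) = z ^ i.1 * z ^ 4 / z ^ i.2 := by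
    rw [zpow_sub₀ hz0, zpow_add₀ hz0, zpow_natCast, zpow_natCast]
    rfl
  rw [h4, div_pow]
  generalize z ^ i.1 = A
  generalize z ^ i.2 = B
  generalize p ^ i.2 = P
  ring

theorem norm_sub_le_norm_sub_one_add_mul {p z : ℂ} (hp : ‖p‖ = 1) (hz : ‖z‖ ≤ 1) {t : ℝ}
    (ht : 0 ≤ t) : ‖z - p‖ ≤ ‖z - (1 + t) * p‖ := by
  have h1 : Complex.normSq p = 1 := by rw [Complex.normSq_eq_norm_sq, hp, one_pow]
  have h2 : Complex.normSq z ≤ 1 := by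
    rw [Complex.normSq_eq_norm_sq]
    exact pow_le_one₀ (norm_nonneg _) hz
  refine le_of_sq_le_sq ?_ (norm_nonneg _)
  rw [← Complex.normSq_eq_norm_sq, ← Complex.normSq_eq_norm_sq]
  simp only [Complex.normSq_apply, Complex.sub_re, Complex.sub_im, Complex.mul_re, Complex.mul_im,
    Complex.add_re, Complex.add_im, Complex.one_re, Complex.one_im, Complex.ofReal_re,
    Complex.ofReal_im] at *
  have h3 : z.re * p.re + z.im * p.im ≤ 1 := by
    nlinarith [sq_nonneg (z.re - p.re), sq_nonneg (z.im - p.im)]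
  nlinarith [mul_nonneg ht (sub_nonneg.2 h3), sq_nonneg t]

theorem sub_one_add_mul_ne_zero {p z : ℂ} (hp : ‖p‖ = 1) (hz : ‖z‖ ≤ 1) {t : ℝ}
    (ht : 0 < t) : z - (1 + t) * p ≠ 0 := by
  rw [sub_ne_zero]
  rintro rfl
  rw [norm_mul, hp, mul_one, ← Complex.ofReal_one, ← Complex.ofReal_add, Complex.norm_real,
    Real.norm_of_nonneg (by positivity)] at hz
  linarith

theorem norm_atomQuot_le {p : ℂ} (hp : ‖p‖ = 1) {m : ℝ} {g : ℂ → ℂ} (hg : g ∈ APlus)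
    (hdiv : InnerDivides (atomInner m p) g) {M : ℝ} (hM : ∀ z ∈ closedBall (0 : ℂ) 1, ‖g z‖ ≤ M)
    {t : ℝ} (ht : 0 < t) {z : ℂ} (hz : z ∈ closedBall (0 : ℂ) 1) :
    ‖atomQuot p m g z * ((z - (1 + t) * p) ^ 4)⁻¹‖ ≤ M := by
  have hne : ∀ z ∈ closedBall (0 : ℂ) 1, (z - (1 + t) * p) ^ 4 ≠ 0 := fun z hz =>
    pow_ne_zero _ (sub_one_add_mul_ne_zero hp (by simpa using hz) ht)
  have hd : DiffContOnCl ℂ (fun z => atomQuot p m g z * ((z - (1 + t) * p) ^ 4)⁻¹)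
      (ball 0 1) := by
    refine DiffContOnCl.mk_ball ?_ ?_
    · refine (differentiableOn_atomQuot hp m hg).mul (DifferentiableOn.inv (by fun_prop)
        fun z hz => hne z (ball_subset_closedBall hz))
    · exact (continuousOn_atomQuot hp hg hdiv).mul (ContinuousOn.inv₀ (by fun_prop) hne)
  refine Complex.norm_le_of_forall_mem_frontier_norm_le (f := fun z =>
    atomQuot p m g z * ((z - (1 + t) * p) ^ 4)⁻¹) isBounded_ball hd ?_
    (by rwa [closure_ball _ one_ne_zero])
  rw [frontier_ball _ one_ne_zero]
  intro z hz
  have hz1 : ‖z‖ = 1 := by simpa using hz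
  have hzc := sphere_subset_closedBall hz
  rw [atomQuot, norm_mul, norm_mul, norm_mul, norm_atomInner_of_norm_eq_one hp hz1, mul_one,
    norm_inv, ← div_eq_mul_inv, div_le_iff₀ (norm_pos_iff.2 (hne z hzc)), norm_pow, norm_pow,
    mul_comm]
  exact mul_le_mul (hM z hzc) (pow_le_pow_left₀ (norm_nonneg _)
    (norm_sub_le_norm_sub_one_add_mul hp hz1.le ht.le) 4) (by positivity)
    ((norm_nonneg _).trans (hM z hzc))

theorem norm_mul_atomInner_neg_le_of_forall {p : ℂ} (hp : ‖p‖ = 1) {m : ℝ} {g : ℂ → ℂ} {C : ℝ}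
    {z : ℂ} (hz : z ∈ ball (0 : ℂ) 1)
    (h : ∀ t : ℝ, 0 < t → ‖atomQuot p m g z * ((z - (1 + t) * p) ^ 4)⁻¹‖ ≤ C) :
    ‖g z * atomInner (-m) p z‖ ≤ C := by
  have hzp : z - p ≠ 0 := by
    rw [sub_ne_zero]
    rintro rfl
    simp [hp] at hz
  have hc : ContinuousAt (fun t : ℝ => ‖atomQuot p m g z * ((z - (1 + t) * p) ^ 4)⁻¹‖) 0 := by
    refine (ContinuousAt.mul (by fun_prop) (ContinuousAt.inv₀ (by fun_prop) ?_)).norm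
    simpa using hzp
  have h1 := hc.tendsto.mono_left (nhdsWithin_le_nhds (s := Ioi 0))
  have h2 := le_of_tendsto h1 (by filter_upwards [self_mem_nhdsWithin] with t ht using h t ht)
  have h3 : atomQuot p m g z * ((z - (1 + (0 : ℝ)) * p) ^ 4)⁻¹ = g z * atomInner (-m) p z := by
    rw [atomQuot, ofReal_zero, add_zero, one_mul]
    generalize g z * atomInner (-m) p z = E
    field_simp
  rwa [h3] at h2

theorem innerDivides_atomInner_of_norm_le {p : ℂ} (hp : ‖p‖ = 1) {m : ℝ} {g : ℂ → ℂ}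
    (hg : g ∈ APlus) {M : ℝ} (h : ∀ z ∈ ball (0 : ℂ) 1, ‖g z‖ ≤ M * ‖atomInner m p z‖) :
    InnerDivides (atomInner m p) g := by
  refine ⟨fun z => g z * atomInner (-m) p z, ⟨(differentiableOn_of_mem_APlus hg).mul
    (differentiableOn_atomInner (-m) hp), M, fun z hz => ?_⟩, fun z _ => ?_⟩
  · rw [norm_mul]
    refine (mul_le_mul_of_nonneg_right (h z hz) (norm_nonneg _)).trans_eq ?_
    rw [mul_assoc, ← norm_mul, atomInner_mul_neg, norm_one, mul_one]
  · rw [mul_left_comm, atomInner_mul_neg, mul_one]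

theorem inv_sub_pow_mem_APlus {q : ℂ} (hq : 1 < ‖q‖) : (fun z => ((z - q) ^ 4)⁻¹) ∈ APlus := by
  have hq0 : q ≠ 0 := norm_pos_iff.1 (zero_lt_one.trans hq)
  have h1 : (fun z => (z - q)⁻¹) ∈ APlus := by
    refine ⟨fun n => -q⁻¹ * (q⁻¹) ^ n, ?_, fun z hz => ?_⟩
    · simp only [norm_mul, norm_pow]
      exact (summable_geometric_of_lt_one (norm_nonneg _)
        (by rw [norm_inv]; exact inv_lt_one_of_one_lt₀ hq)).mul_left _
    · have hz1 : ‖z‖ ≤ 1 := by simpa using hz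
      have hlt : ‖q⁻¹ * z‖ < 1 := by
        rw [norm_mul, norm_inv]
        exact (mul_le_of_le_one_right (by positivity) hz1).trans_lt (inv_lt_one_of_one_lt₀ hq)
      have hzq : z - q ≠ 0 := by
        rw [sub_ne_zero]
        rintro rfl
        linarith
      have h2 := (hasSum_geometric_of_norm_lt_one hlt).mul_left (-q⁻¹)
      have h3 : -q⁻¹ * (1 - q⁻¹ * z)⁻¹ = (z - q)⁻¹ := by
        rw [neg_mul, ← mul_inv, ← inv_neg]
        congr 1
        field_simp
        ring
      rw [h3] at h2
      refine h2.congr_fun fun n => ?_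
      rw [mul_pow, mul_assoc]
  have h2 := APlus_mul (APlus_mul h1 h1) (APlus_mul h1 h1)
  refine APlus_congr h2 fun z _ => ?_
  simp only [Pi.mul_apply]
  rw [← inv_pow]
  ring

/-- The set of `a ≥ 0` such that all elements of `I` decay at `p` like the singular inner function
of mass `a`. -/
def atomMasses (I : Set (ℂ → ℂ)) (p : ℂ) : Set ℝ :=
  {a | 0 ≤ a ∧ ∀ g ∈ I, ∀ M, (∀ z ∈ closedBall (0 : ℂ) 1, ‖g z‖ ≤ M) →
    ∀ z ∈ ball (0 : ℂ) 1, ‖g z‖ ≤ M * ‖atomInner a p z‖}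

theorem zero_mem_atomMasses (I : Set (ℂ → ℂ)) (p : ℂ) : 0 ∈ atomMasses I p :=
  ⟨le_rfl, fun g _ M hM z hz => by simpa [atomInner] using hM z (ball_subset_closedBall hz)⟩

theorem isClosed_atomMasses (I : Set (ℂ → ℂ)) (p : ℂ) : IsClosed (atomMasses I p) := by
  simp only [atomMasses, ofPred_and, ofPred_forall]
  refine isClosed_Ici.inter (isClosed_iInter fun g => isClosed_iInter fun _ =>
    isClosed_iInter fun M => isClosed_iInter fun _ => isClosed_iInter fun z =>
    isClosed_iInter fun _ => isClosed_le continuous_const ?_)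
  unfold atomInner
  fun_prop

theorem innerDivides_of_mem_atomMasses {I : Set (ℂ → ℂ)} (hI : I ⊆ APlus) {p : ℂ} (hp : ‖p‖ = 1)
    {a : ℝ} (ha : a ∈ atomMasses I p) {g : ℂ → ℂ} (hg : g ∈ I) :
    InnerDivides (atomInner a p) g := by
  obtain ⟨M, -, hM⟩ := exists_norm_le_of_mem_APlus (hI hg)
  exact innerDivides_atomInner_of_norm_le hp (hI hg) (ha.2 g hg M hM)

theorem bddAbove_atomMasses {I : Set (ℂ → ℂ)} (hI : I ⊆ APlus) (hne : NontrivialIdeal I) {p : ℂ}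
    (hp : ‖p‖ = 1) : BddAbove (atomMasses I p) := by
  obtain ⟨g, hg, z, hz, hgz⟩ := hne
  obtain ⟨M, hM0, hM⟩ := exists_norm_le_of_mem_APlus (hI hg)
  have hz1 : ‖z‖ < 1 := by simpa using hz
  have hzp : p - z ≠ 0 := by
    rw [sub_ne_zero]
    rintro rfl
    linarith
  have hq : 0 < (1 - ‖z‖ ^ 2) / ‖p - z‖ ^ 2 := by
    have : ‖z‖ ^ 2 < 1 := pow_lt_one₀ (norm_nonneg _) hz1 two_ne_zero
    have h2 := norm_pos_iff.2 hzp
    have h3 : 0 < 1 - ‖z‖ ^ 2 := by linarith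
    positivity
  refine ⟨M / ‖g z‖ / ((1 - ‖z‖ ^ 2) / ‖p - z‖ ^ 2), fun a ha => ?_⟩
  have h1 := ha.2 g hg M hM z hz
  rw [norm_atomInner hp] at h1
  rw [le_div_iff₀ hq, le_div_iff₀ (norm_pos_iff.2 hgz)]
  generalize (1 - ‖z‖ ^ 2) / ‖p - z‖ ^ 2 = q at *
  have h2 : a * q ≤ Real.exp (a * q) := by linarith [Real.add_one_le_exp (a * q)]
  calc a * q * ‖g z‖ ≤ Real.exp (a * q) * (M * Real.exp (-(a * q))) :=
        mul_le_mul h2 h1 (norm_nonneg _) (Real.exp_pos _).le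
    _ = M := by rw [mul_left_comm, ← Real.exp_add]; simp

theorem not_forall_mem_Idiv_norm_le {I : Set (ℂ → ℂ)} (hI : IsClosedIdealAPlus I)
    (hne : NontrivialIdeal I) {SI : ℂ → ℂ} (hSI : IsGcdInner I SI) {f : ℂ → ℂ} (hf : f ∈ APlus)
    (hdiv : InnerDivides SI f) {p : ℂ} (hp : ‖p‖ = 1) {c : ℝ} (hc : 0 < c)
    (h : ∀ g ∈ Idiv I f, (∀ z ∈ closedBall (0 : ℂ) 1, ‖g z‖ ≤ 1) →
      ∀ z ∈ ball (0 : ℂ) 1, ‖g z‖ ≤ ‖atomInner c p z‖) : False := by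
  have hbdd := bddAbove_atomMasses hI.1 hne hp
  obtain ⟨m, hm, hmax⟩ : ∃ m ∈ atomMasses I p, ∀ a ∈ atomMasses I p, a ≤ m :=
    ⟨_, (isClosed_atomMasses I p).csSup_mem ⟨0, zero_mem_atomMasses I p⟩ hbdd,
      fun a ha => le_csSup hbdd ha⟩
  have hdivI : ∀ g ∈ I, InnerDivides (atomInner m p) g := fun g hg =>
    innerDivides_of_mem_atomMasses hI.1 hp hm hg
  have hdivf : InnerDivides (atomInner m p) f :=
    (hSI.2.2 _ (isInnerFunction_atomInner hp hm.1) fun g hg _ => hdivI g hg).trans hdiv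
  have hmem : ∀ g ∈ I, atomQuot p m g ∈ Idiv I f := fun g hg => by
    refine ⟨atomQuot_mem_APlus hp hm.1 (hI.1 hg) (hdivI g hg), hI.congr
      (hI.2.2.1 _ (atomQuot_mem_APlus hp hm.1 hf hdivf) _ hg) fun z _ => ?_⟩
    simp only [Pi.mul_apply, atomQuot]
    ring
  have hJ := IsClosedIdealAPlus.div hI hf
  suffices hmc : m + c ∈ atomMasses I p by linarith [hmax _ hmc]
  refine ⟨by linarith [hm.1], fun g hg M hM z hz => ?_⟩
  have hM' : ∀ M', 0 < M' → (∀ z ∈ closedBall (0 : ℂ) 1, ‖g z‖ ≤ M') →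
      ‖g z * atomInner (-m) p z‖ ≤ M' * ‖atomInner c p z‖ := by
    intro M' hM0 hM
    refine norm_mul_atomInner_neg_le_of_forall hp hz fun t ht => ?_
    have hq : 1 < ‖(1 + t) * p‖ := by
      rw [norm_mul, hp, mul_one, ← Complex.ofReal_one, ← Complex.ofReal_add, Complex.norm_real,
        Real.norm_of_nonneg (by positivity)]
      linarith
    have hk := hJ.2.2.1 _ (const_mem_APlus ((M' : ℂ)⁻¹)) _
      (hJ.2.2.1 _ (inv_sub_pow_mem_APlus hq) _ (hmem g hg))
    have hval : ∀ z, ‖((fun _ => (M' : ℂ)⁻¹) * ((fun z : ℂ => ((z - (1 + t) * p) ^ 4)⁻¹) *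
        atomQuot p m g) : ℂ → ℂ) z‖ = M'⁻¹ * ‖atomQuot p m g z * ((z - (1 + t) * p) ^ 4)⁻¹‖ := by
      intro z
      rw [Pi.mul_apply, Pi.mul_apply, norm_mul, norm_inv, Complex.norm_real,
        Real.norm_of_nonneg hM0.le, mul_comm (atomQuot p m g z)]
    have h1 := h _ hk (fun w hw => by
      rw [hval, inv_mul_le_iff₀ hM0, mul_one]
      exact norm_atomQuot_le hp (hI.1 hg) (hdivI g hg) hM ht hw) z hz
    rwa [hval, inv_mul_le_iff₀ hM0] at h1
  have hfin : ‖g z * atomInner (-m) p z‖ ≤ M * ‖atomInner c p z‖ := by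
    have hM0 : 0 ≤ M := (norm_nonneg _).trans (hM 0 (by simp))
    have hcont : Continuous fun M' : ℝ => M' * ‖atomInner c p z‖ := by fun_prop
    refine ge_of_tendsto (hcont.continuousAt.tendsto.mono_left
      (nhdsWithin_le_nhds (s := Ioi M))) ?_
    filter_upwards [self_mem_nhdsWithin] with M' hlt
    exact hM' M' (hM0.trans_lt hlt) fun z hz => (hM z hz).trans (le_of_lt hlt)
  have hadd : atomInner (m + c) p z = atomInner c p z * atomInner m p z := by
    rw [atomInner, atomInner, atomInner, ← Complex.exp_add]
    push_cast
    ring_nf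
  calc ‖g z‖ = ‖g z * atomInner (-m) p z‖ * ‖atomInner m p z‖ := by
        rw [← norm_mul, mul_assoc, mul_comm (atomInner (-m) p z), atomInner_mul_neg, mul_one]
    _ ≤ M * ‖atomInner c p z‖ * ‖atomInner m p z‖ :=
        mul_le_mul_of_nonneg_right hfin (norm_nonneg _)
    _ = _ := by rw [hadd, norm_mul, mul_assoc]

/-- If `I ≠ {0}` is a closed ideal of `A⁺` whose hull is finite or
countable, then `I = I⁺(h(I) ∩ Γ) ∩ S_I·H^∞`. -/
theorem stmt_4 (I : Set (ℂ → ℂ)) (hI : IsClosedIdealAPlus I) (hne : NontrivialIdeal I)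
    (SI : ℂ → ℂ) (hSI : IsGcdInner I SI) (hcount : (hull I).Countable) :
    ∀ f : ℂ → ℂ, f ∈ I ↔
      (f ∈ APlus ∧ (∀ z ∈ hull I ∩ Metric.sphere (0 : ℂ) 1, f z = 0) ∧
        InnerDivides SI f) := by
  intro f
  constructor
  · intro hf
    refine ⟨hI.1 hf, fun z hz => hz.1.2 f hf, ?_⟩
    by_cases h0 : ∃ z ∈ ball (0 : ℂ) 1, f z ≠ 0
    · exact hSI.2.1 f hf h0
    · push Not at h0
      exact ⟨fun _ => 0, ⟨differentiableOn_const 0, 0, fun z _ => by simp⟩, fun z hz => by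
        rw [h0 z hz, mul_zero]⟩
  · rintro ⟨hf, hvan, hdiv⟩
    refine mem_of_countable_hull hI (hne.imp fun _ h => h.1) hcount hf hvan
      (fun w hw => exists_mem_Idiv_ne_zero hI hne hSI hf hdiv hw) ?_
    rintro l hl ⟨c, hc, h⟩
    have hl1 : ‖l‖ = 1 := by simpa using hl
    refine not_forall_mem_Idiv_norm_le hI hne hSI hf hdiv hl1 hc fun g hg hg1 z hz => ?_
    rw [norm_atomInner hl1]
    exact h g hg hg1 z hz
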